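/- arXiv:1303.0364 — 2 statements merged into one kernel-verified Lean document; each statement's English description precedes it below -/
import Mathlib

section
/- Let f ∈ L log L(𝕋²) and for n ≥ 1 define S^{(1)}_{nn}(x,y,f) = (1/π²) p.v. ∬_{𝕋²} [sin(nt)·cos(ns)/(4 tan(t/2))] f(x+t, y+s) dt ds. Then there is an absolute constant c > 0 such that ∬_{𝕋²} sup_{n≥1} |S^{(1)}_{nn}(x,y,f)| dx dy ≤ c·(1 + ∬_{𝕋²} |f| log⁺|f|). -/
open MeasureTheory Filter Set

noncomputable section

/-- `[-π, π)`, a fundamental domain for the circle `𝕋 = ℝ/2πℤ`. -/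
def T1 : Set ℝ := Set.Ico (-Real.pi) Real.pi

/-- `[-π, π)²`, a fundamental domain for the torus `𝕋²`. -/
def T2 : Set (ℝ × ℝ) := T1 ×ˢ T1

/-- `log⁺ u = log u` for `u > 1`, and `0` otherwise. -/
def logPlus (u : ℝ) : ℝ := if 1 < u then Real.log u else 0

/-- `f` is `2π`-periodic in each variable. -/
def Biperiodic (f : ℝ × ℝ → ℝ) : Prop :=
  ∀ x y : ℝ, f (x + 2 * Real.pi, y) = f (x, y) ∧ f (x, y + 2 * Real.pi) = f (x, y)

/-- Fourier coefficients `f̂(m,n)` of a function on `𝕋²`. -/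
def fourierCoef2 (f : ℝ × ℝ → ℝ) (m n : ℤ) : ℂ :=
  (1 / (4 * (Real.pi : ℂ) ^ 2)) *
    ∫ p in T2, (f p : ℂ) * Complex.exp (-Complex.I * ((m : ℂ) * (p.1 : ℂ) + (n : ℂ) * (p.2 : ℂ)))

/-- Quadratic partial sums `S_{nn}(x, y, f)` of the double Fourier series.
(For real `f` the symmetric sum is real, so we take the real part.) -/
def Snn (f : ℝ × ℝ → ℝ) (n : ℕ) (x y : ℝ) : ℝ :=
  (∑ m ∈ Finset.Icc (-(n : ℤ)) (n : ℤ), ∑ k ∈ Finset.Icc (-(n : ℤ)) (n : ℤ),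
    fourierCoef2 f m k * Complex.exp (Complex.I * ((m : ℂ) * (x : ℂ) + (k : ℂ) * (y : ℂ)))).re

/-- The `BMO[0,1]` norm:
`‖g‖_BMO = sup_{I ⊂ [0,1]} (1/|I|) ∫_I |g - g_I| + |∫_0^1 g|`. -/
def bmoNorm (g : ℝ → ℝ) : ℝ :=
  (⨆ I : {p : ℝ × ℝ // 0 ≤ p.1 ∧ p.1 < p.2 ∧ p.2 ≤ 1},
      (I.1.2 - I.1.1)⁻¹ *
        ∫ t in Set.Icc I.1.1 I.1.2,
          |g t - (I.1.2 - I.1.1)⁻¹ * ∫ s in Set.Icc I.1.1 I.1.2, g s|) +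
    |∫ t in Set.Icc (0 : ℝ) 1, g t|

/-- The step function `Σ_{k=0}^n ξ_k 𝟙_{δ_k^n}` with `δ_k^n = [k/(n+1), (k+1)/(n+1)]`. -/
def stepFun (ξ : ℕ → ℝ) (n : ℕ) (t : ℝ) : ℝ :=
  ∑ k ∈ Finset.range (n + 1),
    Set.indicator (Set.Icc ((k : ℝ) / ((n : ℝ) + 1)) (((k : ℝ) + 1) / ((n : ℝ) + 1)))
      (fun _ => ξ k) t

/-- `bmo[ξ_n] = sup_{n ≥ 0} ‖Σ_{k=0}^n ξ_k 𝟙_{δ_k^n}‖_BMO`. -/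
def bmoSeq (ξ : ℕ → ℝ) : ℝ := ⨆ n : ℕ, bmoNorm (stepFun ξ n)

/-- `L` is the principal value `p.v. ∫_𝕋 g`, i.e. the limit as `ε → 0⁺` of the
integrals over `{ε < |t| < π}`. -/
def pvT1 (g : ℝ → ℝ) (L : ℝ) : Prop :=
  Filter.Tendsto (fun ε : ℝ => ∫ t in {t : ℝ | ε < |t| ∧ |t| < Real.pi}, g t)
    (nhdsWithin 0 (Set.Ioi 0)) (nhds L)

/-- `L` is the two-dimensional principal value `p.v. ∬_{𝕋²} g`, the limit as `ε → 0⁺`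
of the integrals over `{ε < |t| < π, ε < |s| < π}`. -/
def pvT2 (g : ℝ × ℝ → ℝ) (L : ℝ) : Prop :=
  Filter.Tendsto
    (fun ε : ℝ =>
      ∫ q in {q : ℝ × ℝ | (ε < |q.1| ∧ |q.1| < Real.pi) ∧ ε < |q.2| ∧ |q.2| < Real.pi}, g q)
    (nhdsWithin 0 (Set.Ioi 0)) (nhds L)

/-- Luxemburg norm with respect to a Young function `M`. -/
def luxNorm {α : Type*} [MeasurableSpace α] (μ : Measure α) (M : ℝ → ℝ) (g : α → ℝ) : ℝ :=
  sInf {lam : ℝ | 0 < lam ∧ ∫⁻ x, ENNReal.ofReal (M (|g x| / lam)) ∂μ ≤ 1}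

/-- The Young function `Φ(t) = t log⁺ t`. -/
def PhiY (t : ℝ) : ℝ := t * logPlus t

/-- The Young function `Ψ(t) = eᵗ - 1`. -/
def PsiY (t : ℝ) : ℝ := Real.exp t - 1

/-- Principal value `p.v. ∬_{𝕋²} g dt ds` taken in the first variable `t` only
(limit as `ε → 0⁺` of integrals over `{ε < |t| < π} × 𝕋`). -/
def pvT2fst (g : ℝ × ℝ → ℝ) (L : ℝ) : Prop :=
  Filter.Tendsto
    (fun ε : ℝ => ∫ q in {q : ℝ × ℝ | (ε < |q.1| ∧ |q.1| < Real.pi) ∧ q.2 ∈ T1}, g q)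
    (nhdsWithin 0 (Set.Ioi 0)) (nhds L)


/-! ### Translation invariance on the torus -/

def muT : Measure ℝ := volume.restrict T1

instance : Fact (0 < 2 * Real.pi) := ⟨by positivity⟩

lemma muT_eq : muT = volume.restrict (Ioc (-Real.pi) (-Real.pi + 2 * Real.pi)) := by
  have : -Real.pi + 2 * Real.pi = Real.pi := by ring
  rw [this, muT, T1]
  exact Measure.restrict_congr_set Ico_ae_eq_Ioc

instance : IsFiniteMeasure muT := by
  rw [muT_eq]; infer_instance

lemma muT_univ : muT univ = ENNReal.ofReal (2 * Real.pi) := by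
  rw [muT_eq]; simp

lemma muT_real_univ : muT.real univ = 2 * Real.pi := by
  rw [Measure.real, muT_univ, ENNReal.toReal_ofReal (by positivity)]

def muT2 : Measure (ℝ × ℝ) := volume.restrict T2

lemma muT2_eq : muT2 = muT.prod muT := by
  rw [muT2, muT, Measure.prod_restrict]; rfl

instance : IsFiniteMeasure muT2 := by rw [muT2_eq]; infer_instance

def tau (a x : ℝ) : ℝ := (AddCircle.equivIoc (2 * Real.pi) (-Real.pi) ((a + x : ℝ) : AddCircle (2 * Real.pi)) : ℝ)

lemma tau_spec (a x : ℝ) : ∃ k : ℤ, tau a x = a + x + k * (2 * Real.pi) := by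
  have h : ((tau a x : ℝ) : AddCircle (2 * Real.pi)) = ((a + x : ℝ) : AddCircle (2 * Real.pi)) :=
    (AddCircle.equivIoc (2 * Real.pi) (-Real.pi)).symm_apply_apply _
  rw [← sub_eq_zero, ← AddCircle.coe_sub, AddCircle.coe_eq_zero_iff] at h
  obtain ⟨k, hk⟩ := h
  refine ⟨k, ?_⟩
  rw [zsmul_eq_mul] at hk
  linarith

lemma tau_mp (a : ℝ) : MeasurePreserving (tau a) muT muT := by
  have h1 := AddCircle.measurePreserving_mk (2 * Real.pi) (-Real.pi)
  have h2 := measurePreserving_add_left (volume : Measure (AddCircle (2 * Real.pi))) (a : AddCircle (2 * Real.pi))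
  have h3 := AddCircle.measurePreserving_equivIoc (2 * Real.pi) (a := -Real.pi)
  have h4 : MeasurePreserving (Subtype.val : Ioc (-Real.pi) (-Real.pi + 2 * Real.pi) → ℝ) (Measure.comap Subtype.val volume) (volume.restrict (Ioc (-Real.pi) (-Real.pi + 2 * Real.pi))) :=
    measurePreserving_subtype_coe measurableSet_Ioc
  rw [muT_eq]
  exact h4.comp (h3.comp (h2.comp h1))

lemma tau2_mp (a b : ℝ) : MeasurePreserving (Prod.map (tau a) (tau b)) muT2 muT2 := by
  rw [muT2_eq]; exact (tau_mp a).prod (tau_mp b)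

def Bip {E : Type*} (f : ℝ × ℝ → E) : Prop :=
  ∀ x y : ℝ, f (x + 2 * Real.pi, y) = f (x, y) ∧ f (x, y + 2 * Real.pi) = f (x, y)

lemma Bip.tau {E : Type*} {f : ℝ × ℝ → E} (hf : Bip f) (a b : ℝ) (q : ℝ × ℝ) :
    f (a + q.1, b + q.2) = f (Prod.map (tau a) (tau b) q) := by
  obtain ⟨k, hk⟩ := tau_spec a q.1
  obtain ⟨l, hl⟩ := tau_spec b q.2
  have p1 : ∀ y, Function.Periodic (fun x => f (x, y)) (2 * Real.pi) := fun y x => (hf x y).1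
  have p2 : ∀ x, Function.Periodic (fun y => f (x, y)) (2 * Real.pi) := fun x y => (hf x y).2
  simp only [Prod.map, hk, hl]
  have h1 := (p1 (b + q.2 + l * (2 * Real.pi))).int_mul k (a + q.1)
  have h2 := (p2 (a + q.1)).int_mul l (b + q.2)
  rw [h1, h2]

lemma Bip.lintegral_shift {g : ℝ × ℝ → ENNReal} (hg : Measurable g) (hf : Bip g) (a b : ℝ) :
    ∫⁻ q, g (a + q.1, b + q.2) ∂muT2 = ∫⁻ q, g q ∂muT2 := by
  simp_rw [hf.tau a b]
  exact (tau2_mp a b).lintegral_comp hg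

lemma Bip.integral_shift {g : ℝ × ℝ → ℂ} (hg : Measurable g) (hf : Bip g) (a b : ℝ) :
    ∫ q, g (a + q.1, b + q.2) ∂muT2 = ∫ q, g q ∂muT2 := by
  simp_rw [hf.tau a b]
  have := integral_map (μ := muT2) (tau2_mp a b).measurable.aemeasurable (f := g) (hg.stronglyMeasurable.aestronglyMeasurable)
  rw [← this, (tau2_mp a b).map_eq]

lemma Bip.integrable_shift {g : ℝ × ℝ → ℝ} (hg : Integrable g muT2) (hf : Bip g) (a b : ℝ) :
    Integrable (fun q : ℝ × ℝ => g (a + q.1, b + q.2)) muT2 := by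
  simp_rw [hf.tau a b]
  exact (tau2_mp a b).integrable_comp_of_integrable hg

/-! ### Characters -/

def ee (k : ℤ) (x : ℝ) : ℂ := Complex.exp (((k * x : ℝ) : ℂ) * Complex.I)

lemma ee_add (k : ℤ) (x y : ℝ) : ee k (x + y) = ee k x * ee k y := by
  simp only [ee, ← Complex.exp_add]; congr 1; push_cast; ring

lemma ee_mul (k l : ℤ) (x : ℝ) : ee k x * ee l x = ee (k + l) x := by
  simp only [ee, ← Complex.exp_add]; congr 1; push_cast; ring

lemma ee_neg (k : ℤ) (x : ℝ) : ee k (-x) = ee (-k) x := by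
  simp only [ee]; congr 1; push_cast; ring

lemma ee_zero (x : ℝ) : ee 0 x = 1 := by simp [ee]

lemma ee_conj (k : ℤ) (x : ℝ) : (starRingEnd ℂ) (ee k x) = ee (-k) x := by
  simp only [ee, ← Complex.exp_conj]; congr 1; simp

lemma ee_norm (k : ℤ) (x : ℝ) : ‖ee k x‖ = 1 := by
  simp only [ee]; exact Complex.norm_exp_ofReal_mul_I _

lemma ee_cont (k : ℤ) : Continuous (ee k) := by
  unfold ee; fun_prop

lemma ee_per (k : ℤ) (x : ℝ) : ee k (x + 2 * Real.pi) = ee k x := by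
  rw [ee_add]
  have : ee k (2 * Real.pi) = 1 := by
    have := Complex.exp_int_mul_two_pi_mul_I k
    simp only [ee]; rw [← this]; congr 1; push_cast; ring
  rw [this, mul_one]

lemma ee_cos (k : ℤ) (x : ℝ) : ee k x + ee (-k) x = 2 * (Real.cos (k * x) : ℂ) := by
  simp only [ee]
  rw [Complex.ofReal_cos, Complex.cos]
  push_cast
  rw [show -(k : ℂ) * x * Complex.I = -(k * x) * Complex.I by ring]
  ring

lemma ee_pow (k : ℕ) (x : ℝ) : ee k x = (ee 1 x) ^ k := by
  simp only [ee, ← Complex.exp_nat_mul]; congr 1; push_cast; ring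

lemma integral_ee (k : ℤ) : ∫ x, ee k x ∂muT = if k = 0 then 2 * (Real.pi : ℂ) else 0 := by
  split_ifs with h
  · subst h
    simp only [ee_zero]
    rw [integral_const, muT_real_univ]; simp
  · rw [muT_eq, ← intervalIntegral.integral_of_le (by linarith [Real.pi_pos])]
    have hk : (k : ℂ) * Complex.I ≠ 0 := by simp [h]
    have h1 : ∀ x : ℝ, ee k x = Complex.exp ((k * Complex.I) * x) := by
      intro x; simp only [ee]; congr 1; push_cast; ring
    simp_rw [h1]
    rw [integral_exp_mul_complex hk, ← h1, ← h1, ee_per]; simp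

/-! ### The pointwise inequality -/

lemma ptwise (z : ℂ) (hz : 0 < z.re) :
    |z.im| ≤ 5 * (-(z * Complex.log z).re) + (5 * z.re * Real.log z.re + 10 * z.re) := by
  set u := z.re with hu
  set v := z.im with hv
  set r := ‖z‖ with hr
  have hr2 : r ^ 2 = u ^ 2 + v ^ 2 := by
    rw [hr, Complex.sq_norm, Complex.normSq_apply]; ring
  have hr0 : 0 < r := by
    rw [hr, norm_pos_iff]; intro h; rw [hu, h] at hz; simp at hz
  have hre : (z * Complex.log z).re = u * Real.log r - v * z.arg := by
    rw [Complex.mul_re, Complex.log_re, Complex.log_im]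
  -- lower bound for the argument term
  have harg : v ^ 2 / r ≤ v * z.arg := by
    have hs : v = r * Real.sin z.arg := (Complex.norm_mul_sin_arg z).symm
    have hpi := Real.pi_gt_three
    have hle : |z.arg| ≤ Real.pi := Complex.abs_arg_le_pi z
    have h1 : Real.sin z.arg ^ 2 ≤ Real.sin z.arg * z.arg := by
      rcases le_total 0 z.arg with h | h
      · have := Real.sin_le h
        have h0 := Real.sin_nonneg_of_nonneg_of_le_pi h (by rw [abs_of_nonneg h] at hle; exact hle)
        nlinarith
      · have := Real.sin_le (neg_nonneg.2 h)
        have h0 := Real.sin_nonneg_of_nonneg_of_le_pi (neg_nonneg.2 h) (by rw [abs_of_nonpos h] at hle; exact hle)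
        rw [Real.sin_neg] at this h0
        nlinarith
    rw [div_le_iff₀ hr0, hs]
    nlinarith [mul_le_mul_of_nonneg_left h1 (sq_nonneg r)]
  -- upper bound for the logarithm
  set s := |v| / u with hsdef
  have hs0 : 0 ≤ s := by positivity
  have hlog : Real.log r ≤ Real.log u + s / 2 + 1 / 2 * Real.log 2 := by
    have h1 : r ^ 2 ≤ u ^ 2 * (2 * Real.exp s) := by
      have h2 : 1 + s + s ^ 2 / 2 ≤ Real.exp s := Real.quadratic_le_exp_of_nonneg hs0
      have h3 : v ^ 2 = u ^ 2 * s ^ 2 := by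
        rw [hsdef, div_pow, sq_abs]; field_simp
      rw [hr2, h3]
      have : 0 < u ^ 2 := by positivity
      nlinarith
    have h2 := Real.log_le_log (by positivity) h1
    rw [Real.log_pow, Real.log_mul (by positivity) (by positivity), Real.log_mul (by positivity) (by positivity), Real.log_exp, Real.log_pow] at h2
    push_cast at h2
    linarith
  have hv1 : |v| = u * s := by rw [hsdef]; field_simp
  have hl2 := Real.log_two_lt_d9
  rw [hre]
  have key : |v| ≤ 5 * (v ^ 2 / r - u * (s / 2 + 1 / 2 * Real.log 2)) + 10 * u := by
    rcases le_total s 1 with h | h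
    · have : 0 ≤ v ^ 2 / r := by positivity
      rw [hv1]
      nlinarith
    · have h3 : 7 / 10 * |v| ≤ v ^ 2 / r := by
        rw [le_div_iff₀ hr0, ← sq_abs v]
        have h4 : u ≤ |v| := by rw [hv1]; nlinarith
        have h5 : r ≤ 10 / 7 * |v| := by
          apply le_of_sq_le_sq _ (by positivity)
          rw [hr2, mul_pow, sq_abs, ← sq_abs v]; nlinarith
        nlinarith [abs_nonneg v]
      have h5 : u * (s / 2) = |v| / 2 := by rw [hv1]; ring
      nlinarith [abs_nonneg v]
  have := mul_le_mul_of_nonneg_left hlog hz.le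
  nlinarith

/-! ### Zygmund's inequality for trigonometric polynomials -/

def Psi (r : ℝ) : ℝ := 5 * (1 + r) * Real.log (1 + r) + 10 * (1 + r)

def qq (m : ℤ) (z : ℂ) : ℂ := if 0 < m then 2 * z ^ m.toNat else if m = 0 then 1 else 0

lemma qq_diff (m : ℤ) : Differentiable ℂ (qq m) := by
  unfold qq; split_ifs <;> fun_prop

lemma qq_circle (m : ℤ) (θ : ℝ) : qq m (ee 1 θ) = ee m θ + (m.sign : ℂ) * ee m θ := by
  unfold qq
  split_ifs with h h'
  · rw [← ee_pow, Int.toNat_of_nonneg h.le, Int.sign_eq_one_of_pos h]; push_cast; ring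
  · subst h'; simp [ee_zero]
  · rw [Int.sign_eq_neg_one_of_neg (by omega)]; push_cast; ring

lemma circle_param {z : ℂ} (hz : ‖z‖ = 1) : z = ee 1 z.arg := by
  have := Complex.norm_mul_exp_arg_mul_I z
  rw [hz] at this
  simp only [ee]
  conv_lhs => rw [← this]
  simp

lemma integral_circle (h : ℂ → ℂ) :
    Real.circleAverage h 0 1 = (2 * Real.pi)⁻¹ • ∫ θ, h (ee 1 θ) ∂muT := by
  rw [Real.circleAverage_def, muT_eq, ← intervalIntegral.integral_of_le (by linarith [Real.pi_pos])]
  congr 1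
  have hp : Function.Periodic (fun θ => h (circleMap 0 1 θ)) (2 * Real.pi) := by
    intro θ; simp only [periodic_circleMap 0 1 θ]
  have := hp.intervalIntegral_add_eq 0 (-Real.pi)
  rw [zero_add] at this
  rw [this]
  congr 1; ext θ; congr 1; simp [circleMap, ee]

lemma zyg {ι : Type*} (s : Finset ι) (b : ι → ℂ) (m : ι → ℤ) (ρ : ℝ → ℝ)
    (hρ : ∀ θ, ∑ i ∈ s, b i * ee (m i) θ = (ρ θ : ℂ)) (hρ0 : ∀ θ, 0 ≤ ρ θ)
    (hG : ∀ θ, (∑ i ∈ s, ((m i).sign : ℂ) * (b i * ee (m i) θ)).re = 0) :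
    ∫ θ, ‖∑ i ∈ s, ((m i).sign : ℂ) * (b i * ee (m i) θ)‖ ∂muT ≤ ∫ θ, Psi (ρ θ) ∂muT := by
  set G : ℝ → ℂ := fun θ => ∑ i ∈ s, ((m i).sign : ℂ) * (b i * ee (m i) θ) with hGdef
  set F : ℂ → ℂ := fun z => 1 + ∑ i ∈ s, b i * qq (m i) z with hF
  have hFd : Differentiable ℂ F := by
    have := qq_diff
    simp only [hF]; fun_prop
  have hFc : ∀ θ, F (ee 1 θ) = 1 + ρ θ + G θ := by
    intro θ
    simp only [hF, hGdef, ← hρ, qq_circle, mul_add, Finset.sum_add_distrib]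
    rw [add_assoc]; congr 2
    apply Finset.sum_congr rfl; intros; ring
  have hG' : ∀ θ, (G θ).re = 0 := hG
  have hFre : ∀ θ, (F (ee 1 θ)).re = 1 + ρ θ := by
    intro θ; rw [hFc]; simp [hG' θ]
  have hFim : ∀ θ, |(F (ee 1 θ)).im| = ‖G θ‖ := by
    intro θ; rw [hFc]
    have h1 : G θ = ((G θ).im : ℂ) * Complex.I := by
      apply Complex.ext <;> simp [hG' θ]
    conv_rhs => rw [h1, norm_mul, Complex.norm_I, mul_one, Complex.norm_real, Real.norm_eq_abs]
    simp
  -- minimum principle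
  have hmin : ∀ z ∈ Metric.closedBall (0 : ℂ) 1, 1 ≤ (F z).re := by
    intro z hz
    have hd : DiffContOnCl ℂ (fun z => Complex.exp (-F z)) (Metric.ball 0 1) :=
      (hFd.neg.cexp).diffContOnCl
    have := Complex.norm_le_of_forall_mem_frontier_norm_le Metric.isBounded_ball hd (C := Real.exp (-1))
      (fun w hw => by
        rw [frontier_ball _ one_ne_zero] at hw
        rw [circle_param (z := w) (by simpa using hw), Complex.norm_exp, Complex.neg_re, hFre]
        apply Real.exp_le_exp.2
        linarith [hρ0 w.arg]) (z := z) (by rwa [closure_ball _ one_ne_zero])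
    rw [Complex.norm_exp, Real.exp_le_exp, Complex.neg_re] at this
    linarith
  have hslit : ∀ z ∈ Metric.closedBall (0 : ℂ) 1, F z ∈ Complex.slitPlane := fun z hz =>
    Or.inl (by linarith [hmin z hz])
  have hHd : ∀ z ∈ Metric.closedBall (0 : ℂ) 1, DifferentiableAt ℂ (fun z => F z * Complex.log (F z)) z :=
    fun z hz => (hFd z).mul ((hFd z).clog (hslit z hz))
  have hmv := circleAverage_of_differentiable_on_off_countable (f := fun z => F z * Complex.log (F z))
    (c := 0) (R := 1) (s := ∅) countable_empty
    (fun z hz => (hHd z (by simpa using hz)).continuousAt.continuousWithinAt)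
    (fun z hz => hHd z (Metric.ball_subset_closedBall (by simpa using hz)))
  rw [integral_circle] at hmv
  have hee : Continuous (ee 1) := ee_cont 1
  have hball : ∀ θ, ee 1 θ ∈ Metric.closedBall (0 : ℂ) 1 := fun θ => by simp [ee_norm]
  have hHc : Continuous (fun θ => F (ee 1 θ) * Complex.log (F (ee 1 θ))) := by
    rw [continuous_iff_continuousAt]
    intro θ
    exact ContinuousAt.comp (f := ee 1) (hHd _ (hball θ)).continuousAt hee.continuousAt
  have cint : ∀ {E : Type} [NormedAddCommGroup E] (g : ℝ → E), Continuous g → Integrable g muT := by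
    intro E _ g hg
    rw [muT_eq]; exact (hg.integrableOn_Ioc)
  -- value at the centre
  have hF0im : (F 0).im = 0 := by
    have h1 : F 0 = 1 + ∑ i ∈ s, b i * (if m i = 0 then 1 else 0) := by
      simp only [hF]; congr 1
      apply Finset.sum_congr rfl; intro i _; congr 1
      unfold qq; split_ifs with h h' <;> first | rfl | omega | skip
      rw [zero_pow (by omega)]; simp
    have h2 : (2 * Real.pi : ℂ) * ∑ i ∈ s, b i * (if m i = 0 then 1 else 0) = ((∫ θ, ρ θ ∂muT : ℝ) : ℂ) := by
      rw [← integral_complex_ofReal]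
      simp_rw [← hρ]
      rw [integral_finsetSum _ (fun i _ => cint _ (by have := ee_cont (m i); fun_prop))]
      simp_rw [integral_const_mul, integral_ee, Finset.mul_sum]
      apply Finset.sum_congr rfl; intro i _; split_ifs <;> ring
    have h3 := congrArg Complex.im h2
    have h4 : (2 * Real.pi : ℂ) = ((2 * Real.pi : ℝ) : ℂ) := by push_cast; ring
    rw [h4, Complex.im_ofReal_mul, Complex.ofReal_im] at h3
    rw [h1, Complex.add_im, Complex.one_im, zero_add]
    exact (mul_eq_zero.1 h3).resolve_left (by positivity)
  have hF0 : 0 ≤ (F 0 * Complex.log (F 0)).re := by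
    have h1 : F 0 = ((F 0).re : ℂ) := by apply Complex.ext <;> simp [hF0im]
    have h2 := hmin 0 (by simp)
    rw [h1, ← Complex.ofReal_log (by linarith), ← Complex.ofReal_mul, Complex.ofReal_re]
    exact mul_nonneg (by linarith) (Real.log_nonneg h2)
  have hint : 0 ≤ ∫ θ, (F (ee 1 θ) * Complex.log (F (ee 1 θ))).re ∂muT := by
    have h1 := integral_re (cint _ hHc)
    simp only [RCLike.re_eq_complex_re] at h1
    rw [h1]
    have h2 := congrArg Complex.re hmv
    rw [Complex.smul_re] at h2
    rw [← h2, smul_eq_mul] at hF0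
    exact (mul_nonneg_iff_of_pos_left (by positivity)).1 hF0
  have hρc : Continuous ρ := by
    have : ρ = fun θ => (∑ i ∈ s, b i * ee (m i) θ).re := by ext θ; rw [hρ]; simp
    rw [this]
    have := ee_cont
    fun_prop
  have hPc : Continuous fun θ => Psi (ρ θ) := by
    unfold Psi
    have : Continuous fun θ => Real.log (1 + ρ θ) :=
      (by fun_prop : Continuous fun θ => 1 + ρ θ).log (fun θ => by linarith [hρ0 θ])
    fun_prop
  have hGc : Continuous G := by
    have := ee_cont
    simp only [hGdef]; fun_prop
  have hrec : Continuous fun θ => (F (ee 1 θ) * Complex.log (F (ee 1 θ))).re := Complex.continuous_re.comp hHc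
  calc ∫ θ, ‖G θ‖ ∂muT ≤ ∫ θ, (Psi (ρ θ) - 5 * (F (ee 1 θ) * Complex.log (F (ee 1 θ))).re) ∂muT := by
        apply integral_mono (cint _ hGc.norm) (cint _ (by fun_prop))
        intro θ
        have := ptwise (F (ee 1 θ)) (by rw [hFre]; linarith [hρ0 θ])
        rw [hFim, hFre] at this
        simp only [Psi]; linarith
    _ = ∫ θ, Psi (ρ θ) ∂muT - 5 * ∫ θ, (F (ee 1 θ) * Complex.log (F (ee 1 θ))).re ∂muT := by
        rw [integral_sub (cint _ hPc) (cint _ (by fun_prop)), integral_const_mul]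
    _ ≤ _ := by linarith

/-! ### Fejér means in two variables -/

lemma muT_integrable {E : Type} [NormedAddCommGroup E] (g : ℝ → E) (hg : Continuous g) :
    Integrable g muT := by
  rw [muT_eq]; exact hg.integrableOn_Ioc

def co (f : ℝ × ℝ → ℝ) (j k : ℤ) : ℂ :=
  ((4 * Real.pi ^ 2 : ℝ) : ℂ)⁻¹ * ∫ p, (f p : ℂ) * (ee (-j) p.1 * ee (-k) p.2) ∂muT2

def ww (L : ℕ) (j : ℤ) : ℝ := 1 - |(j : ℝ)| / L

def KK (L : ℕ) (t : ℝ) : ℝ := Complex.normSq (∑ i ∈ Finset.range L, ee i t) / L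

lemma KK_nonneg (L : ℕ) (t : ℝ) : 0 ≤ KK L t := by
  unfold KK; have := Complex.normSq_nonneg (∑ i ∈ Finset.range L, ee i t); positivity

lemma KK_cont (L : ℕ) : Continuous (KK L) := by
  have := ee_cont
  unfold KK
  exact (Complex.continuous_normSq.comp (by fun_prop)).div_const _

lemma KK_neg (L : ℕ) (t : ℝ) : KK L (-t) = KK L t := by
  unfold KK
  rw [← Complex.normSq_conj, map_sum]
  simp_rw [ee_conj, ee_neg, neg_neg]

lemma KK_le (L : ℕ) (t : ℝ) : KK L t ≤ L := by
  unfold KK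
  rcases Nat.eq_zero_or_pos L with h | h
  · subst h; simp
  rw [div_le_iff₀ (by positivity), Complex.normSq_eq_norm_sq]
  have : ‖∑ i ∈ Finset.range L, ee i t‖ ≤ L := by
    refine (norm_sum_le _ _).trans ?_
    simp [ee_norm]
  nlinarith [norm_nonneg (∑ i ∈ Finset.range L, ee i t)]

lemma dir_eq (L : ℕ) (t : ℝ) : ∑ j ∈ Finset.Icc (-(L : ℤ)) L, ee j t
    = 1 + ∑ i ∈ Finset.range L, (ee (i + 1) t + ee (-(i + 1)) t) := by
  induction L with
  | zero => simp [ee_zero]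
  | succ n ih =>
    rw [Finset.sum_range_succ, ← add_assoc, ← ih]
    have : Finset.Icc (-((n + 1 : ℕ) : ℤ)) ((n + 1 : ℕ) : ℤ)
        = insert ((n : ℤ) + 1) (insert (-((n : ℤ) + 1)) (Finset.Icc (-(n : ℤ)) n)) := by
      ext j; simp only [Finset.mem_Icc, Finset.mem_insert]; push_cast; omega
    rw [this, Finset.sum_insert (by simp; omega), Finset.sum_insert (by simp)]
    ring

lemma normSq_eq (L : ℕ) (t : ℝ) : (Complex.normSq (∑ i ∈ Finset.range L, ee i t) : ℂ)
    = ∑ j ∈ Finset.Icc (-(L : ℤ)) L, (((L : ℝ) - |(j : ℝ)| : ℝ) : ℂ) * ee j t := by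
  induction L with
  | zero => simp
  | succ n ih =>
    have hstep : ∑ j ∈ Finset.Icc (-((n + 1 : ℕ) : ℤ)) ((n + 1 : ℕ) : ℤ), (((((n + 1 : ℕ) : ℝ)) - |(j : ℝ)| : ℝ) : ℂ) * ee j t
        = ∑ j ∈ Finset.Icc (-(n : ℤ)) n, (((n : ℝ) - |(j : ℝ)| : ℝ) : ℂ) * ee j t
          + ∑ j ∈ Finset.Icc (-(n : ℤ)) n, ee j t := by
      have : Finset.Icc (-((n + 1 : ℕ) : ℤ)) ((n + 1 : ℕ) : ℤ)
          = insert ((n : ℤ) + 1) (insert (-((n : ℤ) + 1)) (Finset.Icc (-(n : ℤ)) n)) := by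
        ext j; simp only [Finset.mem_Icc, Finset.mem_insert]; push_cast; omega
      rw [this, Finset.sum_insert (by simp; omega), Finset.sum_insert (by simp), ← Finset.sum_add_distrib]
      have h1 : |((n : ℝ) + 1)| = n + 1 := abs_of_nonneg (by positivity)
      have h2 : |(-1 + -(n : ℝ))| = n + 1 := by rw [← h1, ← abs_neg]; congr 1; ring
      have h3 : |(-(n : ℝ) - 1)| = n + 1 := by rw [← h1, ← abs_neg]; congr 1; ring
      simp only [Int.cast_add, Int.cast_neg, Int.cast_natCast, Int.cast_one, Nat.cast_add, Nat.cast_one, abs_neg, h1, sub_self, Complex.ofReal_zero, zero_mul, zero_add]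
      apply Finset.sum_congr rfl; intro j _; push_cast; ring
    rw [hstep, ← ih, dir_eq, Complex.normSq_eq_conj_mul_self, Complex.normSq_eq_conj_mul_self, Finset.sum_range_succ, map_add, add_mul, mul_add, mul_add, map_sum]
    simp_rw [ee_conj]
    rw [ee_mul]
    have e1 : (∑ i ∈ Finset.range n, ee (-(i : ℤ)) t) * ee n t = ∑ i ∈ Finset.range n, ee (i + 1) t := by
      rw [Finset.sum_mul, ← Finset.sum_range_reflect]
      apply Finset.sum_congr rfl; intro i hi
      have := Finset.mem_range.1 hi
      rw [ee_mul]; congr 1; omega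
    have e2 : ee (-(n : ℤ)) t * (∑ i ∈ Finset.range n, ee (i : ℤ) t) = ∑ i ∈ Finset.range n, ee (-(i + 1)) t := by
      rw [Finset.mul_sum, ← Finset.sum_range_reflect]
      apply Finset.sum_congr rfl; intro i hi
      have := Finset.mem_range.1 hi
      rw [ee_mul]; congr 1; omega
    rw [e1, e2, Finset.sum_add_distrib, neg_add_cancel, ee_zero]
    ring

lemma KK_eq (L : ℕ) (hL : 1 ≤ L) (t : ℝ) :
    (KK L t : ℂ) = ∑ j ∈ Finset.Icc (-(L : ℤ)) L, (ww L j : ℂ) * ee j t := by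
  have hL' : (L : ℂ) ≠ 0 := by simp; omega
  unfold KK ww
  push_cast
  rw [normSq_eq, Finset.sum_div]
  apply Finset.sum_congr rfl; intro j _
  push_cast; field_simp

lemma KK_integral (L : ℕ) (hL : 1 ≤ L) (c : ℝ) : ∫ x, KK L (x - c) ∂muT = 2 * Real.pi := by
  have h : ((∫ x, KK L (x - c) ∂muT : ℝ) : ℂ) = ((2 * Real.pi : ℝ) : ℂ) := by
    rw [← integral_complex_ofReal]
    simp_rw [KK_eq L hL, sub_eq_add_neg, ee_add]
    rw [integral_finsetSum _ (fun i _ => muT_integrable _ (by have := ee_cont i; fun_prop))]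
    simp_rw [integral_const_mul, integral_mul_const, integral_ee]
    rw [Finset.sum_eq_single 0]
    · simp [ww, ee_zero]
    · intro j _ hj; simp [hj]
    · intro h; simp at h
  exact_mod_cast h

/-- product kernel, normalised -/
def K2 (L : ℕ) (p q : ℝ × ℝ) : ℝ := (4 * Real.pi ^ 2)⁻¹ * (KK L (p.1 - q.1) * KK L (p.2 - q.2))

lemma K2_symm (L : ℕ) (p q : ℝ × ℝ) : K2 L p q = K2 L q p := by
  unfold K2
  rw [← KK_neg L (p.1 - q.1), ← KK_neg L (p.2 - q.2), neg_sub, neg_sub]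

lemma K2_nonneg (L : ℕ) (p q : ℝ × ℝ) : 0 ≤ K2 L p q := by
  have h1 := KK_nonneg L (p.1 - q.1)
  have h2 := KK_nonneg L (p.2 - q.2)
  unfold K2; positivity

lemma K2_cont (L : ℕ) : Continuous (fun z : (ℝ × ℝ) × (ℝ × ℝ) => K2 L z.1 z.2) := by
  have := KK_cont L
  unfold K2; fun_prop

lemma K2_cont_right (L : ℕ) (p : ℝ × ℝ) : Continuous (K2 L p) := by
  have := KK_cont L
  unfold K2; fun_prop

lemma K2_bound (L : ℕ) (p q : ℝ × ℝ) : ‖K2 L p q‖ ≤ (4 * Real.pi ^ 2)⁻¹ * (L * L) := by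
  rw [Real.norm_of_nonneg (K2_nonneg L p q)]
  unfold K2
  have h1 := KK_nonneg L (p.1 - q.1)
  have h2 := KK_nonneg L (p.2 - q.2)
  have h3 := KK_le L (p.1 - q.1)
  have h4 := KK_le L (p.2 - q.2)
  gcongr

lemma K2_integrable (L : ℕ) (p : ℝ × ℝ) : Integrable (K2 L p) muT2 :=
  Integrable.of_bound (K2_cont_right L p).aestronglyMeasurable _ (Eventually.of_forall (K2_bound L p))

lemma K2_mul_integrable (L : ℕ) (p : ℝ × ℝ) {g : ℝ × ℝ → ℝ} (hg : Integrable g muT2) :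
    Integrable (fun q => g q * K2 L p q) muT2 :=
  hg.mul_bdd (K2_cont_right L p).aestronglyMeasurable (Eventually.of_forall (K2_bound L p))

lemma K2_integral (L : ℕ) (hL : 1 ≤ L) (p : ℝ × ℝ) : ∫ q, K2 L p q ∂muT2 = 1 := by
  simp_rw [K2_symm L p]
  unfold K2
  rw [integral_const_mul, muT2_eq, integral_prod_mul (fun x => KK L (x - p.1)) (fun x => KK L (x - p.2)), KK_integral L hL, KK_integral L hL]
  have := Real.pi_pos
  field_simp; norm_num

def PR (f : ℝ × ℝ → ℝ) (L : ℕ) (p : ℝ × ℝ) : ℝ := ∫ q, f q * K2 L p q ∂muT2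

lemma PR_nonneg {f : ℝ × ℝ → ℝ} (hf : ∀ q, 0 ≤ f q) (L : ℕ) (p : ℝ × ℝ) : 0 ≤ PR f L p :=
  integral_nonneg (fun q => mul_nonneg (hf q) (K2_nonneg L p q))

lemma Psi_tangent (a r : ℝ) (ha : 0 ≤ a) (hr : 0 ≤ r) :
    Psi a + (5 * Real.log (1 + a) + 15) * (r - a) ≤ Psi r := by
  unfold Psi
  have h1 := Real.log_le_sub_one_of_pos (x := (1 + a) / (1 + r)) (by positivity)
  rw [Real.log_div (by positivity) (by positivity)] at h1
  have h2 := mul_le_mul_of_nonneg_left h1 (show 0 ≤ 1 + r by positivity)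
  have h3 : (1 + r) * ((1 + a) / (1 + r) - 1) = a - r := by field_simp; ring
  rw [h3] at h2
  nlinarith

lemma Psi_nonneg (a : ℝ) (ha : 0 ≤ a) : 0 ≤ Psi a := by
  unfold Psi
  have := Real.log_nonneg (show 1 ≤ 1 + a by linarith)
  positivity

lemma jensen {f : ℝ × ℝ → ℝ} (hf : ∀ q, 0 ≤ f q) (hi : Integrable f muT2)
    (hP : Integrable (fun q => Psi (f q)) muT2) (L : ℕ) (hL : 1 ≤ L) (p : ℝ × ℝ) :
    Psi (PR f L p) ≤ ∫ q, Psi (f q) * K2 L p q ∂muT2 := by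
  set a := PR f L p with ha
  set d := 5 * Real.log (1 + a) + 15
  have i0 := K2_integrable L p
  have i1 := K2_mul_integrable L p hi
  have h : ∫ q, ((Psi a - d * a) * K2 L p q + d * (f q * K2 L p q)) ∂muT2 ≤ ∫ q, Psi (f q) * K2 L p q ∂muT2 := by
    apply integral_mono ((i0.const_mul _).add (i1.const_mul _)) (K2_mul_integrable L p hP)
    intro q
    have := mul_le_mul_of_nonneg_right (Psi_tangent a (f q) (PR_nonneg hf L p) (hf q)) (K2_nonneg L p q)
    refine le_trans (le_of_eq ?_) this
    change (Psi a - d * a) * K2 L p q + d * (f q * K2 L p q) = (Psi a + d * (f q - a)) * K2 L p q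
    ring
  rw [integral_add (i0.const_mul _) (i1.const_mul _), integral_const_mul, integral_const_mul, K2_integral L hL] at h
  change (Psi a - d * a) * 1 + d * a ≤ _ at h
  linarith

lemma PR_Psi {f : ℝ × ℝ → ℝ} (hf : ∀ q, 0 ≤ f q) (hi : Integrable f muT2) (hm : Measurable f)
    (hP : Integrable (fun q => Psi (f q)) muT2) (L : ℕ) (hL : 1 ≤ L) :
    ∫⁻ p, ENNReal.ofReal (Psi (PR f L p)) ∂muT2 ≤ ∫⁻ q, ENNReal.ofReal (Psi (f q)) ∂muT2 := by
  have hPm : Measurable fun q => Psi (f q) := by unfold Psi; fun_prop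
  calc ∫⁻ p, ENNReal.ofReal (Psi (PR f L p)) ∂muT2
      ≤ ∫⁻ p, ∫⁻ q, ENNReal.ofReal (Psi (f q)) * ENNReal.ofReal (K2 L p q) ∂muT2 ∂muT2 := by
        apply lintegral_mono; intro p
        refine (ENNReal.ofReal_le_ofReal (jensen hf hi hP L hL p)).trans ?_
        rw [ofReal_integral_eq_lintegral_ofReal (K2_mul_integrable L p hP)
          (Eventually.of_forall fun q => mul_nonneg (Psi_nonneg _ (hf q)) (K2_nonneg L p q))]
        apply le_of_eq
        congr 1; ext q
        rw [ENNReal.ofReal_mul (Psi_nonneg _ (hf q))]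
    _ = ∫⁻ q, ∫⁻ p, ENNReal.ofReal (Psi (f q)) * ENNReal.ofReal (K2 L p q) ∂muT2 ∂muT2 := by
        apply lintegral_lintegral_swap
        apply Measurable.aemeasurable
        have := (K2_cont L).measurable
        exact ((hPm.comp measurable_snd).ennreal_ofReal).mul this.ennreal_ofReal
    _ = _ := by
        congr 1; ext q
        rw [lintegral_const_mul' _ _ ENNReal.ofReal_ne_top]
        simp_rw [fun p => K2_symm L p q]
        rw [← ofReal_integral_eq_lintegral_ofReal (K2_integrable L q) (Eventually.of_forall fun p => K2_nonneg L q p), K2_integral L hL]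
        simp

/-! ### The conjugate polynomials -/

def box (L : ℕ) : Finset (ℤ × ℤ) := Finset.Icc (-(L : ℤ)) L ×ˢ Finset.Icc (-(L : ℤ)) L

def cc (f : ℝ × ℝ → ℝ) (L : ℕ) (q : ℤ × ℤ) : ℂ := ((ww L q.1 * ww L q.2 : ℝ) : ℂ) * co f q.1 q.2

def GG (f : ℝ × ℝ → ℝ) (L : ℕ) (σ : ℤ) (p : ℝ × ℝ) : ℂ :=
  ∑ q ∈ box L, ((q.2 - σ * q.1).sign : ℂ) * (cc f L q * (ee q.1 p.1 * ee q.2 p.2))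

lemma GG_cont (f : ℝ × ℝ → ℝ) (L : ℕ) (σ : ℤ) : Continuous (GG f L σ) := by
  have := ee_cont
  unfold GG; fun_prop

lemma ee_bdd_integrable {f : ℝ × ℝ → ℝ} (hi : Integrable f muT2) (j k : ℤ) :
    Integrable (fun p : ℝ × ℝ => (f p : ℂ) * (ee j p.1 * ee k p.2)) muT2 := by
  have h1 := ee_cont j
  have h2 := ee_cont k
  refine Integrable.mul_bdd (c := 1) hi.ofReal (Continuous.aestronglyMeasurable (by fun_prop))
    (Eventually.of_forall fun p => ?_)
  rw [norm_mul, ee_norm, ee_norm, one_mul]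

lemma PR_eq {f : ℝ × ℝ → ℝ} (hi : Integrable f muT2) (L : ℕ) (hL : 1 ≤ L) (p : ℝ × ℝ) :
    ∑ q ∈ box L, cc f L q * (ee q.1 p.1 * ee q.2 p.2) = (PR f L p : ℂ) := by
  unfold PR
  rw [← integral_complex_ofReal]
  have h : ∀ q : ℝ × ℝ, ((f q * K2 L p q : ℝ) : ℂ) = ∑ i ∈ box L,
      (((4 * Real.pi ^ 2 : ℝ) : ℂ)⁻¹ * ((ww L i.1 * ww L i.2 : ℝ) : ℂ) * (ee i.1 p.1 * ee i.2 p.2)) * ((f q : ℂ) * (ee (-i.1) q.1 * ee (-i.2) q.2)) := by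
    intro q
    unfold K2 box
    rw [Complex.ofReal_mul, Complex.ofReal_mul, Complex.ofReal_mul, Complex.ofReal_inv, KK_eq L hL, KK_eq L hL, Finset.sum_mul_sum, ← Finset.sum_product', Finset.mul_sum, Finset.mul_sum]
    apply Finset.sum_congr rfl; intro i _
    rw [sub_eq_add_neg, sub_eq_add_neg, ee_add, ee_add, ee_neg, ee_neg]
    push_cast; ring
  simp_rw [h]
  rw [integral_finsetSum _ (fun i _ => (ee_bdd_integrable hi _ _).const_mul _)]
  simp_rw [integral_const_mul]
  apply Finset.sum_congr rfl; intro i _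
  unfold cc co
  ring

lemma co_conj (f : ℝ × ℝ → ℝ) (j k : ℤ) : (starRingEnd ℂ) (co f j k) = co f (-j) (-k) := by
  unfold co
  rw [map_mul, ← integral_conj]
  simp only [map_mul, ee_conj, Complex.conj_ofReal, map_inv₀]

lemma GG_re (f : ℝ × ℝ → ℝ) (L : ℕ) (σ : ℤ) (p : ℝ × ℝ) : (GG f L σ p).re = 0 := by
  have h : (starRingEnd ℂ) (GG f L σ p) = - GG f L σ p := by
    unfold GG
    rw [map_sum, ← Finset.sum_neg_distrib]
    apply Finset.sum_nbij' (fun q => -q) (fun q => -q)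
    · intro q hq; simp only [box, Finset.mem_product, Finset.mem_Icc, Prod.fst_neg, Prod.snd_neg] at *; omega
    · intro q hq; simp only [box, Finset.mem_product, Finset.mem_Icc, Prod.fst_neg, Prod.snd_neg] at *; omega
    · intro q _; simp
    · intro q _; simp
    · intro q _
      have hs : (-q.2 - σ * -q.1).sign = -(q.2 - σ * q.1).sign := by
        rw [← Int.sign_neg]; congr 1; ring
      simp only [cc, map_mul, co_conj, ee_conj, Complex.conj_ofReal, Prod.fst_neg, Prod.snd_neg, hs, ww, Int.cast_neg, abs_neg]
      rw [map_intCast]; push_cast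
      ring
  have := congrArg Complex.re h
  simp at this
  linarith

lemma line_mul (σ : ℤ) (j k : ℤ) (p : ℝ × ℝ) (θ : ℝ) :
    ee j (-σ * θ + p.1) * ee k (θ + p.2) = (ee j p.1 * ee k p.2) * ee (k - σ * j) θ := by
  simp only [ee, ← Complex.exp_add]; congr 1; push_cast; ring

lemma GG_line {f : ℝ × ℝ → ℝ} (hf : ∀ q, 0 ≤ f q) (hi : Integrable f muT2) (L : ℕ) (hL : 1 ≤ L)
    (σ : ℤ) (p : ℝ × ℝ) :
    ∫⁻ θ, ‖GG f L σ (-σ * θ + p.1, θ + p.2)‖ₑ ∂muT ≤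
      ∫⁻ θ, ENNReal.ofReal (Psi (PR f L (-σ * θ + p.1, θ + p.2))) ∂muT := by
  have hGe : ∀ θ, GG f L σ (-σ * θ + p.1, θ + p.2) = ∑ q ∈ box L, ((q.2 - σ * q.1).sign : ℂ) * ((cc f L q * (ee q.1 p.1 * ee q.2 p.2)) * ee (q.2 - σ * q.1) θ) := by
    intro θ
    unfold GG
    apply Finset.sum_congr rfl; intro q _
    rw [line_mul]; ring
  have hPe : ∀ θ, ∑ q ∈ box L, (cc f L q * (ee q.1 p.1 * ee q.2 p.2)) * ee (q.2 - σ * q.1) θ = (PR f L (-σ * θ + p.1, θ + p.2) : ℂ) := by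
    intro θ
    rw [← PR_eq hi L hL]
    apply Finset.sum_congr rfl; intro q _
    rw [line_mul]; ring
  have key := zyg (box L) (fun q => cc f L q * (ee q.1 p.1 * ee q.2 p.2)) (fun q => q.2 - σ * q.1)
    (fun θ => PR f L (-σ * θ + p.1, θ + p.2)) hPe (fun θ => PR_nonneg hf L _)
    (fun θ => by rw [← hGe]; exact GG_re _ _ _ _)
  simp_rw [← hGe] at key
  have hc : Continuous fun θ : ℝ => GG f L σ (-σ * θ + p.1, θ + p.2) := (GG_cont f L σ).comp (by fun_prop)
  have hρc : Continuous fun θ : ℝ => PR f L (-σ * θ + p.1, θ + p.2) := by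
    have : (fun θ : ℝ => PR f L (-σ * θ + p.1, θ + p.2)) = fun θ => (∑ q ∈ box L, (cc f L q * (ee q.1 p.1 * ee q.2 p.2)) * ee (q.2 - σ * q.1) θ).re := by
      ext θ; rw [hPe]; simp
    rw [this]
    have := ee_cont
    fun_prop
  have hPc : Continuous fun θ : ℝ => Psi (PR f L (-σ * θ + p.1, θ + p.2)) := by
    unfold Psi
    have : Continuous fun θ : ℝ => Real.log (1 + PR f L (-σ * θ + p.1, θ + p.2)) :=
      (by fun_prop : Continuous fun θ : ℝ => 1 + PR f L (-σ * θ + p.1, θ + p.2)).log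
        (fun θ => by have := PR_nonneg hf L (-σ * θ + p.1, θ + p.2); positivity)
    fun_prop
  rw [← ofReal_integral_norm_eq_lintegral_enorm (muT_integrable _ hc),
    ← ofReal_integral_eq_lintegral_ofReal (muT_integrable _ hPc) (Eventually.of_forall fun θ => Psi_nonneg _ (PR_nonneg hf L _))]
  exact ENNReal.ofReal_le_ofReal key

lemma avg {g : ℝ × ℝ → ENNReal} (hg : Measurable g) (hb : Bip g) (σ : ℤ) :
    ∫⁻ p, ∫⁻ θ, g (-σ * θ + p.1, θ + p.2) ∂muT ∂muT2 = ENNReal.ofReal (2 * Real.pi) * ∫⁻ p, g p ∂muT2 := by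
  rw [lintegral_lintegral_swap]
  · simp_rw [fun θ : ℝ => hb.lintegral_shift hg (-σ * θ) θ]
    rw [lintegral_const, muT_univ, mul_comm]
  · apply Measurable.aemeasurable
    apply hg.comp
    fun_prop

lemma GG_bip (f : ℝ × ℝ → ℝ) (L : ℕ) (σ : ℤ) : Bip (GG f L σ) := by
  intro x y
  simp only [GG, ee_per, and_self]

lemma PR_bip {f : ℝ × ℝ → ℝ} (hi : Integrable f muT2) (L : ℕ) (hL : 1 ≤ L) : Bip (PR f L) := by
  intro x y
  constructor <;> apply Complex.ofReal_injective <;> rw [← PR_eq hi L hL, ← PR_eq hi L hL] <;> simp only [ee_per]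

lemma PR_cont {f : ℝ × ℝ → ℝ} (hi : Integrable f muT2) (L : ℕ) (hL : 1 ≤ L) : Continuous (PR f L) := by
  have : PR f L = fun p => (∑ q ∈ box L, cc f L q * (ee q.1 p.1 * ee q.2 p.2)).re := by
    ext p; rw [PR_eq hi L hL]; simp
  rw [this]
  have := ee_cont
  fun_prop

lemma GG_bound {f : ℝ × ℝ → ℝ} (hf : ∀ q, 0 ≤ f q) (hi : Integrable f muT2) (hm : Measurable f)
    (hP : Integrable (fun q => Psi (f q)) muT2) (L : ℕ) (hL : 1 ≤ L) (σ : ℤ) :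
    ∫⁻ p, ‖GG f L σ p‖ₑ ∂muT2 ≤ ∫⁻ q, ENNReal.ofReal (Psi (f q)) ∂muT2 := by
  refine le_trans ?_ (PR_Psi hf hi hm hP L hL)
  have h1 := avg (g := fun p => ‖GG f L σ p‖ₑ) (GG_cont f L σ).measurable.enorm
    (fun x y => by simp only [(GG_bip f L σ x y).1, (GG_bip f L σ x y).2, and_self]) σ
  have hPm : Measurable fun q => Psi (PR f L q) := by
    have := (PR_cont hi L hL).measurable
    unfold Psi; fun_prop
  have h2 := avg (g := fun p => ENNReal.ofReal (Psi (PR f L p))) hPm.ennreal_ofReal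
    (fun x y => by simp only [(PR_bip hi L hL x y).1, (PR_bip hi L hL x y).2, and_self]) σ
  have h3 := lintegral_mono (μ := muT2) (GG_line hf hi L hL σ)
  rw [h1, h2] at h3
  have hpi : ENNReal.ofReal (2 * Real.pi) ≠ 0 := by
    simp [Real.pi_pos]
  exact (ENNReal.mul_le_mul_iff_right hpi ENNReal.ofReal_ne_top).1 h3

/-! ### The maximal function -/

def dd (n : ℕ) (j : ℤ) : ℤ := ((n : ℤ) - j).sign + ((n : ℤ) + j).sign

lemma dd_eq_zero (n : ℕ) (j : ℤ) (hj : j ∉ Finset.Icc (-(n : ℤ)) n) : dd n j = 0 := by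
  simp only [Finset.mem_Icc, not_and_or, not_le] at hj
  unfold dd
  rcases hj with h | h
  · rw [Int.sign_eq_one_of_pos (by omega), Int.sign_eq_neg_one_of_neg (by omega)]; rfl
  · rw [Int.sign_eq_neg_one_of_neg (by omega), Int.sign_eq_one_of_pos (by omega)]; rfl

/-- `T_n` acting on a coefficient array `c` -/
def TC (c : ℤ × ℤ → ℂ) (N n : ℕ) (p : ℝ × ℝ) : ℂ :=
  4⁻¹ * ∑ j ∈ Finset.Icc (-(N : ℤ)) N, (dd n j : ℂ) *
    (c (j, n) * (ee j p.1 * ee n p.2) + c (j, -n) * (ee j p.1 * ee (-n) p.2))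

def TT (f : ℝ × ℝ → ℝ) (n : ℕ) (p : ℝ × ℝ) : ℂ := TC (fun q => co f q.1 q.2) n n p

lemma TC_ext (c : ℤ × ℤ → ℂ) (N n : ℕ) (h : n ≤ N) (p : ℝ × ℝ) : TC c n n p = TC c N n p := by
  unfold TC
  congr 1
  apply Finset.sum_subset
  · apply Finset.Icc_subset_Icc <;> omega
  · intro j _ hj
    rw [dd_eq_zero n j hj]; simp

def AA (f : ℝ × ℝ → ℝ) (L : ℕ) (σ n : ℤ) (x : ℝ) : ℂ :=
  ∑ j ∈ Finset.Icc (-(L : ℤ)) L, ((n - σ * j).sign : ℂ) * (cc f L (j, n) * ee j x)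

lemma AA_eq (f : ℝ × ℝ → ℝ) (L : ℕ) (σ n : ℤ) (hn : n ∈ Finset.Icc (-(L : ℤ)) L) (x : ℝ) :
    ∫ y, GG f L σ (x, y) * ee (-n) y ∂muT = 2 * Real.pi * AA f L σ n x := by
  have h : ∀ y, GG f L σ (x, y) * ee (-n) y = ∑ q ∈ box L, (((q.2 - σ * q.1).sign : ℂ) * (cc f L q * ee q.1 x)) * ee (q.2 - n) y := by
    intro y
    unfold GG
    rw [Finset.sum_mul]
    apply Finset.sum_congr rfl; intro q _
    rw [sub_eq_add_neg q.2 n, ← ee_mul]; ring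
  simp_rw [h]
  rw [integral_finsetSum _ (fun i _ => muT_integrable _ (by have := ee_cont (i.2 - n); fun_prop))]
  simp_rw [integral_const_mul, integral_ee]
  unfold box AA
  rw [Finset.sum_product, Finset.mul_sum]
  apply Finset.sum_congr rfl; intro j _
  rw [Finset.sum_eq_single n]
  · simp; ring
  · intro k _ hk; simp [sub_eq_zero, hk]
  · intro h; exact absurd hn h

def II (f : ℝ × ℝ → ℝ) (L : ℕ) (σ : ℤ) (x : ℝ) : ENNReal := ∫⁻ y, ‖GG f L σ (x, y)‖ₑ ∂muT

lemma AA_bound (f : ℝ × ℝ → ℝ) (L : ℕ) (σ n : ℤ) (hn : n ∈ Finset.Icc (-(L : ℤ)) L) (x : ℝ) :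
    ‖AA f L σ n x‖ₑ ≤ II f L σ x := by
  have h1 : ‖2 * Real.pi * AA f L σ n x‖ₑ ≤ II f L σ x := by
    rw [← AA_eq f L σ n hn]
    refine (enorm_integral_le_lintegral_enorm _).trans (le_of_eq ?_)
    unfold II
    congr 1; ext y
    rw [enorm_mul, ← ofReal_norm (ee _ _), ee_norm]; simp
  refine le_trans ?_ h1
  rw [← ofReal_norm, ← ofReal_norm]
  apply ENNReal.ofReal_le_ofReal
  rw [norm_mul]
  have : 1 ≤ ‖(2 * Real.pi : ℂ)‖ := by
    simp [abs_of_pos Real.pi_pos]; linarith [Real.pi_gt_three]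
  nlinarith [norm_nonneg (AA f L σ n x)]

lemma TC_eq (f : ℝ × ℝ → ℝ) (L n : ℕ) (p : ℝ × ℝ) :
    TC (cc f L) L n p = 4⁻¹ * (AA f L 1 n p.1 * ee n p.2 + AA f L (-1) n p.1 * ee n p.2
      - AA f L 1 (-n) p.1 * ee (-n) p.2 - AA f L (-1) (-n) p.1 * ee (-n) p.2) := by
  unfold TC AA dd
  congr 1
  simp only [Finset.sum_mul]
  rw [← Finset.sum_add_distrib, ← Finset.sum_sub_distrib, ← Finset.sum_sub_distrib]
  apply Finset.sum_congr rfl; intro j _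
  have h1 : (-(n : ℤ) - 1 * j).sign = -((n : ℤ) + j).sign := by
    rw [← Int.sign_neg]; congr 1; ring
  have h2 : (-(n : ℤ) - (-1) * j).sign = -((n : ℤ) - j).sign := by
    rw [← Int.sign_neg]; congr 1; ring
  have h3 : ((n : ℤ) - (-1) * j).sign = ((n : ℤ) + j).sign := by congr 1; ring
  rw [h1, h2, h3, one_mul]
  push_cast
  ring

lemma TC_bound (f : ℝ × ℝ → ℝ) (L n : ℕ) (h : n ≤ L) (p : ℝ × ℝ) :
    ‖TC (cc f L) L n p‖ₑ ≤ II f L 1 p.1 + II f L (-1) p.1 := by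
  have m1 : (n : ℤ) ∈ Finset.Icc (-(L : ℤ)) L := by simp; omega
  have m2 : -(n : ℤ) ∈ Finset.Icc (-(L : ℤ)) L := by simp; omega
  have b1 := AA_bound f L 1 n m1 p.1
  have b2 := AA_bound f L (-1) n m1 p.1
  have b3 := AA_bound f L 1 (-n) m2 p.1
  have b4 := AA_bound f L (-1) (-n) m2 p.1
  have e1 : ∀ k : ℤ, ‖ee k p.2‖ₑ = 1 := fun k => by rw [← ofReal_norm, ee_norm]; simp
  have hr : ‖TC (cc f L) L n p‖ ≤ 4⁻¹ * (‖AA f L 1 n p.1‖ + ‖AA f L (-1) n p.1‖ + ‖AA f L 1 (-n) p.1‖ + ‖AA f L (-1) (-n) p.1‖) := by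
    rw [TC_eq, norm_mul]
    have : ‖(4⁻¹ : ℂ)‖ = 4⁻¹ := by simp
    rw [this]
    gcongr
    refine (norm_sub_le _ _).trans ?_
    gcongr
    · refine (norm_sub_le _ _).trans ?_
      gcongr
      · refine (norm_add_le _ _).trans ?_
        simp [ee_norm]
      · simp [ee_norm]
    · simp [ee_norm]
  by_cases ht : II f L 1 p.1 + II f L (-1) p.1 = ⊤
  · rw [ht]; exact le_top
  · have t := ENNReal.add_ne_top.1 ht
    rw [← ENNReal.ofReal_toReal t.1, ← ofReal_norm, ENNReal.ofReal_le_ofReal_iff ENNReal.toReal_nonneg] at b1 b3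
    rw [← ENNReal.ofReal_toReal t.2, ← ofReal_norm, ENNReal.ofReal_le_ofReal_iff ENNReal.toReal_nonneg] at b2 b4
    rw [← ENNReal.ofReal_toReal ht, ← ofReal_norm, ENNReal.toReal_add t.1 t.2]
    apply ENNReal.ofReal_le_ofReal
    have := norm_nonneg (AA f L 1 n p.1)
    have := norm_nonneg (AA f L (-1) n p.1)
    linarith

lemma ww_tendsto (j : ℤ) : Tendsto (fun L : ℕ => ww L j) atTop (nhds 1) := by
  unfold ww
  have := (tendsto_const_div_atTop_nhds_zero_nat |(j : ℝ)|).const_sub 1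
  simpa using this

lemma cc_tendsto (f : ℝ × ℝ → ℝ) (q : ℤ × ℤ) :
    Tendsto (fun L : ℕ => cc f L q) atTop (nhds (co f q.1 q.2)) := by
  unfold cc
  have h := (ww_tendsto q.1).mul (ww_tendsto q.2)
  have h2 := (Complex.continuous_ofReal.tendsto _).comp h
  have h3 := h2.mul_const (co f q.1 q.2)
  simpa using h3

lemma TC_tendsto (f : ℝ × ℝ → ℝ) (n : ℕ) (p : ℝ × ℝ) :
    Tendsto (fun L : ℕ => TC (cc f L) n n p) atTop (nhds (TT f n p)) := by
  unfold TT TC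
  apply Tendsto.const_mul
  apply tendsto_finsetSum
  intro j _
  apply Tendsto.const_mul
  exact ((cc_tendsto f (j, n)).mul_const _).add ((cc_tendsto f (j, -n)).mul_const _)

def MM (f : ℝ × ℝ → ℝ) (p : ℝ × ℝ) : ENNReal :=
  liminf (fun L : ℕ => II f L 1 p.1 + II f L (-1) p.1) atTop

lemma TT_le_MM (f : ℝ × ℝ → ℝ) (n : ℕ) (p : ℝ × ℝ) : ‖TT f n p‖ₑ ≤ MM f p := by
  have h := (TC_tendsto f n p).enorm
  rw [← h.liminf_eq]
  refine liminf_le_liminf ?_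
  filter_upwards [eventually_ge_atTop n] with L hL
  rw [TC_ext _ L n hL]
  exact TC_bound f L n hL p

lemma II_meas (f : ℝ × ℝ → ℝ) (L : ℕ) (σ : ℤ) : Measurable (II f L σ) := by
  unfold II
  exact Measurable.lintegral_prod_right' (f := fun p => ‖GG f L σ p‖ₑ) (GG_cont f L σ).measurable.enorm

lemma II_int (f : ℝ × ℝ → ℝ) (L : ℕ) (σ : ℤ) :
    ∫⁻ p, II f L σ p.1 ∂muT2 = ENNReal.ofReal (2 * Real.pi) * ∫⁻ p, ‖GG f L σ p‖ₑ ∂muT2 := by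
  rw [muT2_eq, lintegral_prod (fun p : ℝ × ℝ => II f L σ p.1) ((II_meas f L σ).comp measurable_fst).aemeasurable,
    lintegral_prod _ (GG_cont f L σ).measurable.enorm.aemeasurable]
  simp only [lintegral_const, muT_univ]
  rw [lintegral_mul_const' _ _ ENNReal.ofReal_ne_top, mul_comm]
  rfl

lemma MM_meas (f : ℝ × ℝ → ℝ) : Measurable (MM f) := by
  unfold MM
  apply Measurable.liminf
  intro L
  exact ((II_meas f L 1).comp measurable_fst).add ((II_meas f L (-1)).comp measurable_fst)

lemma MM_int {f : ℝ × ℝ → ℝ} (hf : ∀ q, 0 ≤ f q) (hi : Integrable f muT2) (hm : Measurable f)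
    (hP : Integrable (fun q => Psi (f q)) muT2) :
    ∫⁻ p, MM f p ∂muT2 ≤ ENNReal.ofReal (4 * Real.pi) * ∫⁻ q, ENNReal.ofReal (Psi (f q)) ∂muT2 := by
  unfold MM
  refine (lintegral_liminf_le (fun L => ((II_meas f L 1).comp measurable_fst).add ((II_meas f L (-1)).comp measurable_fst))).trans ?_
  refine (liminf_le_liminf (v := fun _ => ENNReal.ofReal (4 * Real.pi) * ∫⁻ q, ENNReal.ofReal (Psi (f q)) ∂muT2) ?_).trans (le_of_eq (by simp))
  filter_upwards [eventually_ge_atTop 1] with L hL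
  have h4 : ENNReal.ofReal (4 * Real.pi) = ENNReal.ofReal (2 * Real.pi) + ENNReal.ofReal (2 * Real.pi) := by
    rw [← ENNReal.ofReal_add (by positivity) (by positivity)]; congr 1; ring
  have : ∫⁻ p, (II f L 1 p.1 + II f L (-1) p.1) ∂muT2 = ENNReal.ofReal (2 * Real.pi) * ∫⁻ p, ‖GG f L 1 p‖ₑ ∂muT2 + ENNReal.ofReal (2 * Real.pi) * ∫⁻ p, ‖GG f L (-1) p‖ₑ ∂muT2 := by
    have hmeas : Measurable (fun p : ℝ × ℝ => II f L 1 p.1) := (II_meas f L 1).comp measurable_fst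
    rw [lintegral_add_left hmeas, II_int, II_int]
  refine (le_of_eq this).trans ?_
  rw [h4, add_mul]
  have g1 := GG_bound hf hi hm hP L hL 1
  have g2 := GG_bound hf hi hm hP L hL (-1)
  gcongr

/-! ### The kernel identity -/

lemma dd_zero (j : ℤ) : dd 0 j = 0 := by
  simp [dd]

lemma dd_succ (n : ℕ) (j : ℤ) : dd (n + 1) j = dd n j + ((if j = (n : ℤ) then 1 else 0) + (if j = -(n : ℤ) then 1 else 0)
    + (if j = (n : ℤ) + 1 then 1 else 0) + (if j = -((n : ℤ) + 1) then 1 else 0)) := by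
  have key : ∀ a : ℤ, (a + 1).sign = a.sign + ((if a = 0 then 1 else 0) + (if a = -1 then 1 else 0)) := by
    intro a
    rcases lt_trichotomy a 0 with h | h | h
    · rw [Int.sign_eq_neg_one_of_neg h]
      by_cases h1 : a = -1
      · subst h1; simp
      · rw [Int.sign_eq_neg_one_of_neg (by omega)]; simp [h1, h.ne]
    · subst h; simp
    · rw [Int.sign_eq_one_of_pos h, Int.sign_eq_one_of_pos (by omega)]
      have : a ≠ -1 := by omega
      simp [this, h.ne']
  unfold dd
  have e1 : ((n + 1 : ℕ) : ℤ) - j = ((n : ℤ) - j) + 1 := by push_cast; ring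
  have e2 : ((n + 1 : ℕ) : ℤ) + j = ((n : ℤ) + j) + 1 := by push_cast; ring
  rw [e1, e2, key, key]
  have i1 : ((n : ℤ) - j = 0) = (j = n) := by apply propext; omega
  have i2 : ((n : ℤ) - j = -1) = (j = n + 1) := by apply propext; omega
  have i3 : ((n : ℤ) + j = 0) = (j = -(n : ℤ)) := by apply propext; omega
  have i4 : ((n : ℤ) + j = -1) = (j = -((n : ℤ) + 1)) := by apply propext; omega
  simp only [i1, i2, i3, i4]
  ring

lemma dd_sum_aux (M : ℕ) (t : ℝ) (n : ℕ) (hn : n ≤ M) :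
    (∑ j ∈ Finset.Icc (-(M : ℤ)) M, (dd n j : ℂ) * ee j t) * (Real.sin (t / 2) : ℂ)
      = 2 * (Real.sin (n * t) : ℂ) * (Real.cos (t / 2) : ℂ) := by
  induction n with
  | zero => simp [dd_zero]
  | succ n ih =>
    have ih := ih (by omega)
    have hs : ∑ j ∈ Finset.Icc (-(M : ℤ)) M, (dd (n + 1) j : ℂ) * ee j t
        = (∑ j ∈ Finset.Icc (-(M : ℤ)) M, (dd n j : ℂ) * ee j t)
          + ((ee n t + ee (-n) t) + (ee (n + 1 : ℤ) t + ee (-(n + 1 : ℤ)) t)) := by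
      simp_rw [dd_succ]
      push_cast
      simp_rw [add_mul, ite_mul, one_mul, zero_mul, Finset.sum_add_distrib, Finset.sum_ite_eq']
      rw [if_pos (by simp; omega), if_pos (by simp; omega), if_pos (by simp; omega), if_pos (by simp; omega)]
      ring
    rw [hs, ee_cos, ee_cos, add_mul, ih]
    push_cast
    have r1 : Real.sin ((n + 1 : ℝ) * t) = Real.sin (n * t + t / 2 + t / 2) := by congr 1; ring
    have r2 : Real.sin (n * t) = Real.sin (n * t + t / 2 - t / 2) := by congr 1; ring
    have r3 : Real.cos ((n + 1 : ℝ) * t) = Real.cos (n * t + t / 2 + t / 2) := by congr 1; ring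
    have r4 : Real.cos (n * t) = Real.cos (n * t + t / 2 - t / 2) := by congr 1; ring
    have key : 2 * Real.sin (n * t) * Real.cos (t / 2) + (2 * Real.cos (n * t) + 2 * Real.cos ((n + 1 : ℝ) * t)) * Real.sin (t / 2)
        = 2 * Real.sin ((n + 1 : ℝ) * t) * Real.cos (t / 2) := by
      rw [r1, r2, r3, r4, Real.sin_add (n * t + t / 2), Real.sin_sub (n * t + t / 2), Real.cos_add (n * t + t / 2), Real.cos_sub (n * t + t / 2)]
      ring
    have := congrArg (fun r : ℝ => (r : ℂ)) key
    push_cast at this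
    exact this

lemma dd_neg (n : ℕ) (j : ℤ) : dd n (-j) = dd n j := by
  unfold dd; rw [sub_neg_eq_add, ← sub_eq_add_neg, add_comm]

lemma dd_sum (n : ℕ) (t : ℝ) (h1 : Real.sin (t / 2) ≠ 0) :
    ∑ j ∈ Finset.Icc (-(n : ℤ)) n, (dd n j : ℂ) * ee (-j) t
      = 2 * (Real.sin (n * t) / Real.tan (t / 2) : ℝ) := by
  have h := dd_sum_aux n (-t) n le_rfl
  simp_rw [ee_neg] at h
  rw [neg_div, Real.sin_neg, Real.cos_neg, mul_neg, Real.sin_neg] at h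
  rw [Real.tan_eq_sin_div_cos, div_div_eq_mul_div]
  have h1' : (Real.sin (t / 2) : ℂ) ≠ 0 := by exact_mod_cast h1
  push_cast at h h1' ⊢
  rw [← mul_div_assoc, eq_div_iff h1']
  linear_combination -h

/-- the kernel as a trigonometric polynomial -/
def Kn (n : ℕ) (q : ℝ × ℝ) : ℂ :=
  4⁻¹ * ∑ j ∈ Finset.Icc (-(n : ℤ)) n, (dd n j : ℂ) *
    (((4 * Real.pi ^ 2 : ℝ) : ℂ)⁻¹ * (ee (-j) q.1 * ee (-n) q.2) + ((4 * Real.pi ^ 2 : ℝ) : ℂ)⁻¹ * (ee (-j) q.1 * ee n q.2))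

lemma Kn_eq (n : ℕ) (q : ℝ × ℝ) (h1 : Real.sin (q.1 / 2) ≠ 0) :
    Kn n q = (((1 / Real.pi ^ 2) * (Real.sin ((n : ℝ) * q.1) * Real.cos ((n : ℝ) * q.2) / (4 * Real.tan (q.1 / 2))) : ℝ) : ℂ) := by
  have hs := dd_sum n q.1 h1
  have hc := ee_cos n q.2
  have : Kn n q = 4⁻¹ * ((4 * Real.pi ^ 2 : ℝ) : ℂ)⁻¹ * (∑ j ∈ Finset.Icc (-(n : ℤ)) n, (dd n j : ℂ) * ee (-j) q.1) * (ee n q.2 + ee (-n) q.2) := by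
    unfold Kn
    simp only [mul_assoc, Finset.sum_mul, Finset.mul_sum]
    apply Finset.sum_congr rfl; intro j _; ring
  rw [this, hs, hc]
  push_cast
  have : (Real.pi : ℂ) ≠ 0 := by exact_mod_cast Real.pi_ne_zero
  rw [mul_inv]
  simp only [div_eq_mul_inv, mul_inv, one_mul]
  ring

lemma Kn_cont (n : ℕ) : Continuous (Kn n) := by
  unfold Kn
  have := ee_cont
  fun_prop

lemma co_mul {f : ℝ × ℝ → ℝ} (hm : Measurable f) (hb : Bip f) (j k : ℤ) (p : ℝ × ℝ) :
    co f j k * (ee j p.1 * ee k p.2) = ((4 * Real.pi ^ 2 : ℝ) : ℂ)⁻¹ * ∫ q, (f (p.1 + q.1, p.2 + q.2) : ℂ) * (ee (-j) q.1 * ee (-k) q.2) ∂muT2 := by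
  have hg : Measurable (fun q : ℝ × ℝ => (f q : ℂ) * (ee (-j) q.1 * ee (-k) q.2)) := by
    have h1 := (ee_cont (-j)).measurable
    have h2 := (ee_cont (-k)).measurable
    have := Complex.measurable_ofReal
    fun_prop
  have hB : Bip (fun q : ℝ × ℝ => (f q : ℂ) * (ee (-j) q.1 * ee (-k) q.2)) := by
    intro x y
    simp only [(hb x y).1, (hb x y).2, ee_per, and_self]
  have h := hB.integral_shift hg p.1 p.2
  unfold co
  rw [← h, mul_assoc, ← integral_mul_const]
  congr 1
  apply integral_congr_ae
  filter_upwards with q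
  rw [ee_add, ee_add]
  have a1 : ee (-j) p.1 * ee j p.1 = 1 := by rw [ee_mul]; simp [ee_zero]
  have a2 : ee (-k) p.2 * ee k p.2 = 1 := by rw [ee_mul]; simp [ee_zero]
  linear_combination (f (p.1 + q.1, p.2 + q.2) : ℂ) * ee (-j) q.1 * ee (-k) q.2 * (ee (-k) p.2 * ee k p.2) * a1 + (f (p.1 + q.1, p.2 + q.2) : ℂ) * ee (-j) q.1 * ee (-k) q.2 * a2

lemma TT_eq {f : ℝ × ℝ → ℝ} (hm : Measurable f) (hb : Bip f) (hi : Integrable f muT2) (n : ℕ) (p : ℝ × ℝ) :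
    TT f n p = ∫ q, Kn n q * (f (p.1 + q.1, p.2 + q.2) : ℂ) ∂muT2 := by
  have hs := hb.integrable_shift hi p.1 p.2
  have I := fun j k => ee_bdd_integrable hs j k
  unfold TT TC Kn
  simp_rw [co_mul hm hb, neg_neg]
  have : ∀ q : ℝ × ℝ, (4⁻¹ * ∑ j ∈ Finset.Icc (-(n : ℤ)) n, (dd n j : ℂ) *
    (((4 * Real.pi ^ 2 : ℝ) : ℂ)⁻¹ * (ee (-j) q.1 * ee (-n) q.2) + ((4 * Real.pi ^ 2 : ℝ) : ℂ)⁻¹ * (ee (-j) q.1 * ee n q.2))) * (f (p.1 + q.1, p.2 + q.2) : ℂ)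
    = 4⁻¹ * ∑ j ∈ Finset.Icc (-(n : ℤ)) n, (dd n j : ℂ) *
    (((4 * Real.pi ^ 2 : ℝ) : ℂ)⁻¹ * ((f (p.1 + q.1, p.2 + q.2) : ℂ) * (ee (-j) q.1 * ee (-n) q.2)) + ((4 * Real.pi ^ 2 : ℝ) : ℂ)⁻¹ * ((f (p.1 + q.1, p.2 + q.2) : ℂ) * (ee (-j) q.1 * ee n q.2))) := by
    intro q
    rw [mul_assoc, Finset.sum_mul]
    congr 1
    apply Finset.sum_congr rfl; intro j _; ring
  simp_rw [this]
  rw [integral_const_mul, integral_finsetSum]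
  · congr 1
    apply Finset.sum_congr rfl; intro j _
    rw [integral_const_mul, integral_add ((I _ _).const_mul _) ((I _ _).const_mul _), integral_const_mul, integral_const_mul]
  · intro j _
    exact (((I _ _).const_mul _).add ((I _ _).const_mul _)).const_mul _

/-! ### Identification of the principal value -/

lemma pv_eq {f : ℝ × ℝ → ℝ} (hm : Measurable f) (hb : Bip f) (hi : Integrable f muT2) (n : ℕ) (p : ℝ × ℝ) (S : ℝ)
    (h : pvT2fst (fun q => (1 / Real.pi ^ 2) *
              (Real.sin ((n : ℝ) * q.1) * Real.cos ((n : ℝ) * q.2) /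
                (4 * Real.tan (q.1 / 2))) * f (p.1 + q.1, p.2 + q.2)) S) : (S : ℂ) = TT f n p := by
  have hs := hb.integrable_shift hi p.1 p.2
  set F : ℝ × ℝ → ℂ := fun q => Kn n q * (f (p.1 + q.1, p.2 + q.2) : ℂ) with hF
  have hFm : Measurable F := by
    have := (Kn_cont n).measurable
    have h2 := Complex.measurable_ofReal
    fun_prop
  obtain ⟨C, hC⟩ : ∃ C, ∀ q ∈ Icc (-Real.pi) Real.pi ×ˢ Icc (-Real.pi) Real.pi, ‖Kn n q‖ ≤ C :=
    (isCompact_Icc.prod isCompact_Icc).exists_bound_of_continuousOn (Kn_cont n).continuousOn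
  have hT2m : MeasurableSet T2 := measurableSet_Ico.prod measurableSet_Ico
  have hsub : ∀ q ∈ T2, q ∈ Icc (-Real.pi) Real.pi ×ˢ Icc (-Real.pi) Real.pi :=
    fun q hq => ⟨Ico_subset_Icc_self hq.1, Ico_subset_Icc_self hq.2⟩
  set A : ℝ → Set (ℝ × ℝ) := fun ε => {q : ℝ × ℝ | (ε < |q.1| ∧ |q.1| < Real.pi) ∧ q.2 ∈ T1} with hA
  have hAm : ∀ ε, MeasurableSet (A ε) := by
    intro ε
    have m1 : MeasurableSet {q : ℝ × ℝ | ε < |q.1|} := measurableSet_lt measurable_const (by fun_prop)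
    have m2 : MeasurableSet {q : ℝ × ℝ | |q.1| < Real.pi} := measurableSet_lt (by fun_prop) measurable_const
    have m3 : MeasurableSet {q : ℝ × ℝ | q.2 ∈ T1} := measurable_snd measurableSet_Ico
    exact (m1.inter m2).inter m3
  have hAT : ∀ ε, A ε ⊆ T2 := by
    intro ε q hq
    have := abs_lt.1 hq.1.2
    exact ⟨⟨this.1.le, this.2⟩, hq.2⟩
  have hlim : Tendsto (fun ε : ℝ => ∫ q, (A ε).indicator F q ∂muT2) (nhdsWithin 0 (Ioi 0)) (nhds (∫ q, F q ∂muT2)) := by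
    apply tendsto_integral_filter_of_dominated_convergence (fun q => C * ‖f (p.1 + q.1, p.2 + q.2)‖)
    · filter_upwards with ε
      exact (hFm.indicator (hAm ε)).aestronglyMeasurable
    · filter_upwards with ε
      refine (ae_restrict_iff' hT2m).2 (Eventually.of_forall fun q hq => ?_)
      have hc := hC q (hsub q hq)
      refine (norm_indicator_le_norm_self _ _).trans ?_
      rw [hF, norm_mul, Complex.norm_real]
      gcongr
    · exact hs.norm.const_mul _
    · have n1 : ∀ᵐ q : ℝ × ℝ ∂muT2, q.1 ≠ 0 ∧ q.1 ≠ -Real.pi := by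
        rw [muT2_eq]
        have : ∀ᵐ x ∂muT, x ≠ 0 ∧ x ≠ -Real.pi := by
          apply ae_restrict_of_ae
          filter_upwards [Measure.ae_ne volume (0 : ℝ), Measure.ae_ne volume (-Real.pi)] with x h1 h2 using ⟨h1, h2⟩
        exact Measure.quasiMeasurePreserving_fst.ae this
      filter_upwards [n1, ae_restrict_mem hT2m] with q h1 hq
      apply tendsto_const_nhds.congr'
      have : ∀ᶠ ε in nhdsWithin (0 : ℝ) (Ioi 0), ε < |q.1| :=
        nhdsWithin_le_nhds (eventually_lt_nhds (abs_pos.2 h1.1))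
      filter_upwards [this] with ε hε
      rw [indicator_of_mem]
      refine ⟨⟨hε, abs_lt.2 ⟨lt_of_le_of_ne hq.1.1 (Ne.symm h1.2), hq.1.2⟩⟩, hq.2⟩
  have h2 := (Complex.continuous_ofReal.tendsto _).comp h
  rw [TT_eq hm hb hi]
  refine tendsto_nhds_unique_of_eventuallyEq h2 hlim ?_
  filter_upwards [self_mem_nhdsWithin] with ε hε
  have hε : 0 < ε := hε
  simp only [Function.comp]
  rw [integral_indicator (hAm ε), muT2, Measure.restrict_restrict (hAm ε), inter_eq_left.2 (hAT ε), ← integral_complex_ofReal]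
  apply setIntegral_congr_fun (hAm ε)
  intro q hq
  simp only [hF]
  have hq1 := abs_lt.1 hq.1.2
  have hq2 : 0 < |q.1| := hε.trans hq.1.1
  rw [Kn_eq]
  · push_cast; ring
  · intro h0
    have := (Real.sin_eq_zero_iff_of_lt_of_lt (by linarith) (by linarith)).1 h0
    have : q.1 = 0 := by linarith
    rw [this] at hq2; simp at hq2

/-! ### Conclusion -/

lemma logPlus_nonneg (u : ℝ) : 0 ≤ logPlus u := by
  unfold logPlus; split_ifs with h
  · exact (Real.log_pos h).le
  · exact le_rfl

lemma Psi_le (r : ℝ) (hr : 0 ≤ r) : Psi r ≤ 90 * (1 + r * logPlus r) := by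
  unfold Psi logPlus
  have l2 : Real.log 2 ≤ 1 := by linarith [Real.log_two_lt_d9]
  split_ifs with h
  · have hl := Real.log_pos h
    have h1 : Real.log (1 + r) ≤ 1 + Real.log r := by
      have : Real.log (1 + r) ≤ Real.log (2 * r) := Real.log_le_log (by linarith) (by linarith)
      rw [Real.log_mul (by norm_num) (by linarith)] at this
      linarith
    have h2 : r ≤ 3 + r * Real.log r := by
      by_cases h3 : 1 ≤ Real.log r
      · nlinarith
      · have : r ≤ Real.exp 1 := (Real.log_le_iff_le_exp (by linarith)).1 (not_le.1 h3).le
        have := Real.exp_one_lt_d9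
        nlinarith
    have h4 : (1 + r) * Real.log (1 + r) ≤ (2 * r) * (1 + Real.log r) := by
      apply mul_le_mul (by linarith) h1 (Real.log_nonneg (by linarith)) (by linarith)
    nlinarith
  · have h1 : Real.log (1 + r) ≤ 1 := (Real.log_le_log (by linarith) (by linarith)).trans l2
    have h0 : 0 ≤ Real.log (1 + r) := Real.log_nonneg (by linarith)
    nlinarith

lemma Psi_meas : Measurable Psi := by
  unfold Psi
  have := Real.measurable_log
  fun_prop

lemma Psi_part (a b : ℝ) (h : b = |a| ∨ b = 0) : Psi b ≤ 90 * (1 + |a| * logPlus |a|) := by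
  have h0 := mul_nonneg (abs_nonneg a) (logPlus_nonneg |a|)
  rcases h with h | h
  · rw [h]; exact Psi_le _ (abs_nonneg a)
  · rw [h]; have := Psi_le 0 le_rfl; simp at this; linarith

lemma part_pos (a : ℝ) : max a 0 = |a| ∨ max a 0 = 0 := by
  rcases le_total a 0 with h | h
  · right; exact max_eq_right h
  · left; rw [max_eq_left h, abs_of_nonneg h]

lemma MM_final {f g : ℝ × ℝ → ℝ} (hm : Measurable g) (h0 : ∀ q, 0 ≤ g q) (hg : Integrable g muT2)
    (hfg : ∀ q, g q = |f q| ∨ g q = 0)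
    (hl : Integrable (fun p => |f p| * logPlus |f p|) muT2) :
    ∫⁻ p, MM g p ∂muT2 ≤ ENNReal.ofReal (4 * Real.pi * (90 * (4 * Real.pi ^ 2 + ∫ p, |f p| * logPlus |f p| ∂muT2))) := by
  have hb : Integrable (fun p => 90 * (1 + |f p| * logPlus |f p|)) muT2 :=
    ((integrable_const 1).add hl).const_mul 90
  have hP : Integrable (fun q => Psi (g q)) muT2 := by
    refine hb.mono' (Psi_meas.comp hm).aestronglyMeasurable (Eventually.of_forall fun q => ?_)
    rw [Real.norm_eq_abs, abs_of_nonneg (Psi_nonneg _ (h0 q))]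
    exact Psi_part _ _ (hfg q)
  refine (MM_int h0 hg hm hP).trans ?_
  rw [ENNReal.ofReal_mul (p := 4 * Real.pi) (q := 90 * _) (by positivity)]
  refine mul_le_mul_right ?_ _
  have hv : muT2.real univ = 4 * Real.pi ^ 2 := by
    rw [muT2_eq, Measure.real, ← univ_prod_univ, Measure.prod_prod, ENNReal.toReal_mul, muT_univ, ENNReal.toReal_ofReal (by positivity)]
    ring
  have hI : ∫ p, 90 * (1 + |f p| * logPlus |f p|) ∂muT2 = 90 * (4 * Real.pi ^ 2 + ∫ p, |f p| * logPlus |f p| ∂muT2) := by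
    rw [integral_const_mul, integral_add (integrable_const _) hl, integral_const, hv]; simp
  rw [← hI, ofReal_integral_eq_lintegral_ofReal hb]
  · apply lintegral_mono; intro q
    exact ENNReal.ofReal_le_ofReal (Psi_part _ _ (hfg q))
  · refine Eventually.of_forall fun q => ?_
    have h0 := mul_nonneg (abs_nonneg (f q)) (logPlus_nonneg |f q|)
    show 0 ≤ 90 * (1 + |f q| * logPlus |f q|)
    linarith

lemma TT_sub {f g h : ℝ × ℝ → ℝ} (hg : Integrable g muT2) (hh : Integrable h muT2)
    (e : ∀ q, f q = g q - h q) (n : ℕ) (p : ℝ × ℝ) : TT f n p = TT g n p - TT h n p := by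
  have hc : ∀ j k, co f j k = co g j k - co h j k := by
    intro j k
    unfold co
    rw [← mul_sub, ← integral_sub (ee_bdd_integrable hg _ _) (ee_bdd_integrable hh _ _)]
    congr 2; ext q
    rw [e]; push_cast; ring
  unfold TT TC
  rw [← mul_sub, ← Finset.sum_sub_distrib]
  congr 1
  apply Finset.sum_congr rfl; intro j _
  simp only [hc]; ring
/-- for `f ∈ L log L(𝕋²)` and
`S^{(1)}_{nn}(x,y,f) = (1/π²) p.v. ∬_{𝕋²} [sin(nt) cos(ns)/(4 tan(t/2))] f(x+t,y+s) dt ds`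
(defined for a.e. `(x,y)`), one has
`∬_{𝕋²} sup_{n≥1} |S^{(1)}_{nn}(x,y,f)| dx dy ≤ c (1 + ∬ |f| log⁺|f|)`
for an absolute constant `c > 0`. -/
theorem integral_sup_Snn1_bound :
    ∃ c : ℝ, 0 < c ∧ ∀ f : ℝ × ℝ → ℝ, Measurable f → Biperiodic f →
      IntegrableOn f T2 → IntegrableOn (fun p => |f p| * logPlus |f p|) T2 →
      ∀ S1 : ℕ → ℝ × ℝ → ℝ,
        (∀ n : ℕ, 1 ≤ n → ∀ᵐ p : ℝ × ℝ,
          pvT2fst (fun q => (1 / Real.pi ^ 2) *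
              (Real.sin ((n : ℝ) * q.1) * Real.cos ((n : ℝ) * q.2) /
                (4 * Real.tan (q.1 / 2))) * f (p.1 + q.1, p.2 + q.2)) (S1 n p)) →
        (∫ p in T2, ⨆ n : ℕ, |S1 (n + 1) p|) ≤
          c * (1 + ∫ p in T2, |f p| * logPlus |f p|) := by
  refine ⟨720 * Real.pi * (4 * Real.pi ^ 2), by positivity, ?_⟩
  intro f hm hb hi hl S1 hS
  have hi : Integrable f muT2 := hi
  have hl : Integrable (fun p => |f p| * logPlus |f p|) muT2 := hl
  have hB : Bip f := hb
  change (∫ p, ⨆ n : ℕ, |S1 (n + 1) p| ∂muT2) ≤ _ * (1 + ∫ p, |f p| * logPlus |f p| ∂muT2)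
  have i1 : Integrable (fun q => max (f q) 0) muT2 := hi.pos_part
  have i2 : Integrable (fun q => max (-f q) 0) muT2 := hi.neg_part
  have b1 := MM_final (f := f) (g := fun q => max (f q) 0) (by fun_prop) (fun q => le_max_right _ _) i1
    (fun q => part_pos _) hl
  have b2 := MM_final (f := f) (g := fun q => max (-f q) 0) (by fun_prop) (fun q => le_max_right _ _) i2
    (fun q => by have := part_pos (-f q); rwa [abs_neg] at this) hl
  have hS2 : ∀ᵐ p ∂muT2, ∀ n : ℕ, (S1 (n + 1) p : ℂ) = TT f (n + 1) p := by
    rw [ae_all_iff]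
    intro n
    apply ae_restrict_of_ae
    filter_upwards [hS (n + 1) (by omega)] with p hp
    exact pv_eq hm hB hi (n + 1) p _ hp
  have hI0 : 0 ≤ ∫ p, |f p| * logPlus |f p| ∂muT2 :=
    integral_nonneg fun q => mul_nonneg (abs_nonneg _) (logPlus_nonneg _)
  set I := ∫ p, |f p| * logPlus |f p| ∂muT2 with hI
  have hpt : ∀ᵐ p ∂muT2, ‖⨆ n : ℕ, |S1 (n + 1) p|‖ₑ ≤ MM (fun q => max (f q) 0) p + MM (fun q => max (-f q) 0) p := by
    filter_upwards [hS2] with p hp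
    have hn : ∀ n : ℕ, ENNReal.ofReal |S1 (n + 1) p| ≤ MM (fun q => max (f q) 0) p + MM (fun q => max (-f q) 0) p := by
      intro n
      have e : ENNReal.ofReal |S1 (n + 1) p| = ‖TT f (n + 1) p‖ₑ := by
        rw [← hp n, ← ofReal_norm, Complex.norm_real, Real.norm_eq_abs]
      rw [e, TT_sub (f := f) i1 i2 (fun q => by
        rcases le_total (f q) 0 with h | h
        · rw [max_eq_right h, max_eq_left (by linarith)]; ring
        · rw [max_eq_left h, max_eq_right (by linarith)]; ring)]
      exact (enorm_sub_le).trans (add_le_add (TT_le_MM _ _ _) (TT_le_MM _ _ _))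
    have h0 : 0 ≤ ⨆ n : ℕ, |S1 (n + 1) p| := Real.iSup_nonneg fun _ => abs_nonneg _
    rw [← ofReal_norm, Real.norm_eq_abs, abs_of_nonneg h0]
    by_cases ht : MM (fun q => max (f q) 0) p + MM (fun q => max (-f q) 0) p = ⊤
    · rw [ht]; exact le_top
    · apply ENNReal.ofReal_le_of_le_toReal
      exact ciSup_le fun n => (ENNReal.ofReal_le_iff_le_toReal ht).1 (hn n)
  have h1 : ‖∫ p, ⨆ n : ℕ, |S1 (n + 1) p| ∂muT2‖ₑ ≤ ENNReal.ofReal (2 * (4 * Real.pi * (90 * (4 * Real.pi ^ 2 + I)))) := by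
    refine (enorm_integral_le_lintegral_enorm _).trans ((lintegral_mono_ae hpt).trans ?_)
    rw [lintegral_add_left (MM_meas _), two_mul, ENNReal.ofReal_add (by positivity) (by positivity)]
    exact add_le_add b1 b2
  rw [← ofReal_norm, ENNReal.ofReal_le_ofReal_iff (by positivity)] at h1
  refine (Real.le_norm_self _).trans (h1.trans ?_)
  have hpi := Real.pi_gt_three
  have : I ≤ 4 * Real.pi ^ 2 * I := le_mul_of_one_le_left hI0 (by nlinarith)
  have : 720 * Real.pi * I ≤ 720 * Real.pi * (4 * Real.pi ^ 2 * I) := by gcongr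
  linarith
end
end

section
/- Let f ∈ L log L(𝕋²) and define A(x,y) = p.v. (1/π)∫_𝕋 f(x+v, y+v)/(2 tan(v/2)) dv. Then A(x,y) is defined for almost every (x,y) ∈ 𝕋², and there is an absolute constant c > 0 such that ∬_{𝕋²} |A(x,y)| dx dy ≤ c·(1 + ∬_{𝕋²} |f| log⁺|f|). -/
open MeasureTheory Filter Set

noncomputable section

namespace HT
open Real Topology

def Dk (r v : ℝ) : ℝ := 1 - 2 * r * cos v + r ^ 2
def Pk (r v : ℝ) : ℝ := (1 - r ^ 2) / Dk r v
def Qk (r v : ℝ) : ℝ := 2 * r * sin v / Dk r v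
def kk (ε v : ℝ) : ℝ := ε / (ε ^ 2 + v ^ 2)

lemma Dk_pos {r : ℝ} (h0 : 0 ≤ r) (h1 : r < 1) (v : ℝ) : 0 < Dk r v := by
  unfold Dk
  have := cos_le_one v
  nlinarith [mul_nonneg h0 (sub_nonneg.2 this), mul_pos (sub_pos.2 h1) (sub_pos.2 h1)]

lemma Pk_nonneg {r : ℝ} (h0 : 0 ≤ r) (h1 : r < 1) (v : ℝ) : 0 ≤ Pk r v :=
  div_nonneg (by nlinarith) (Dk_pos h0 h1 v).le

lemma continuous_Dk (r : ℝ) : Continuous (Dk r) := by unfold Dk; fun_prop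

lemma continuous_Pk {r : ℝ} (h0 : 0 ≤ r) (h1 : r < 1) : Continuous (Pk r) := by
  unfold Pk
  exact continuous_const.div (continuous_Dk r) fun v => (Dk_pos h0 h1 v).ne'

lemma continuous_Qk {r : ℝ} (h0 : 0 ≤ r) (h1 : r < 1) : Continuous (Qk r) := by
  unfold Qk
  exact Continuous.div (by fun_prop) (continuous_Dk r) fun v => (Dk_pos h0 h1 v).ne'

lemma Dk_periodic (r : ℝ) : Function.Periodic (Dk r) (2 * π) := fun v => by simp [Dk]
lemma Pk_periodic (r : ℝ) : Function.Periodic (Pk r) (2 * π) := fun v => by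
  simp [Pk, Dk_periodic r v]

lemma Qk_neg (r v : ℝ) : Qk r (-v) = - Qk r v := by simp [Qk, Dk, neg_div]

lemma kk_pos {ε : ℝ} (h : 0 < ε) (v : ℝ) : 0 < kk ε v := by unfold kk; positivity

lemma Dk_lower {ε v : ℝ} (h : 0 < ε) (h2 : ε ≤ 1 / 2) (hv : |v| ≤ π) :
    (ε ^ 2 + v ^ 2) / 8 ≤ Dk (1 - ε) v := by
  have hc := cos_le_one_sub_mul_cos_sq hv
  have hpi : π ^ 2 < 16 := by nlinarith [pi_lt_four, pi_pos]
  have hq : 1 / 8 ≤ 2 / π ^ 2 := by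
    rw [div_le_div_iff₀ (by norm_num) (by positivity)]; linarith
  have h3 : v ^ 2 / 8 ≤ 2 / π ^ 2 * v ^ 2 := by
    have := mul_le_mul_of_nonneg_right hq (sq_nonneg v)
    linarith
  have h4 : v ^ 2 / 8 ≤ 1 - cos v := by linarith
  unfold Dk
  nlinarith [sq_nonneg v]

lemma Pk_le {ε v : ℝ} (h : 0 < ε) (h2 : ε ≤ 1 / 2) (hv : |v| ≤ π) :
    |Pk (1 - ε) v| ≤ 16 * kk ε v := by
  rw [abs_of_nonneg (Pk_nonneg (by linarith) (by linarith) v)]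
  have hD := Dk_lower h h2 hv
  have hp := Dk_pos (r := 1 - ε) (by linarith) (by linarith) v
  have hq : 0 < ε ^ 2 + v ^ 2 := by positivity
  unfold Pk kk
  rw [mul_div_assoc', div_le_div_iff₀ hp hq]
  have : 1 - (1 - ε) ^ 2 ≤ 2 * ε := by nlinarith
  calc _ ≤ 2 * ε * (ε ^ 2 + v ^ 2) := by gcongr
    _ = 16 * ε * ((ε ^ 2 + v ^ 2) / 8) := by ring
    _ ≤ _ := by gcongr

/-- truncated cotangent minus conjugate Poisson kernel -/
def Rk (ε v : ℝ) : ℝ := (if ε < |v| then 1 / tan (v / 2) else 0) - Qk (1 - ε) v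

lemma Rk_neg (ε v : ℝ) : Rk ε (-v) = - Rk ε v := by
  unfold Rk
  rw [Qk_neg, abs_neg, neg_div, tan_neg]
  split_ifs
  · rw [one_div, one_div, inv_neg]; ring
  · ring

lemma Rk_le {ε v : ℝ} (h : 0 < ε) (h2 : ε ≤ 1 / 2) (hv : |v| < π) :
    |Rk ε v| ≤ 16 * kk ε v := by
  have hD := Dk_lower h h2 hv.le
  have hp := Dk_pos (r := 1 - ε) (by linarith) (by linarith) v
  have hq : 0 < ε ^ 2 + v ^ 2 := by positivity
  unfold Rk kk
  split_ifs with hc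
  · have hv0 : 0 < |v| := h.trans hc
    have htan : |v| / 2 ≤ |tan (v / 2)| := by
      have h1 : |v| / 2 < π / 2 := by linarith
      have := Real.lt_tan (x := |v| / 2) (by linarith) h1
      rcases abs_cases v with ⟨h5, _⟩ | ⟨h5, _⟩
      · rw [h5] at this ⊢; exact this.le.trans (le_abs_self _)
      · rw [h5] at this ⊢
        rw [neg_div, tan_neg] at this
        rw [neg_div]; exact this.le.trans (neg_le_abs _)
    have htan0 : tan (v / 2) ≠ 0 := by
      intro h0; rw [h0] at htan; simp at htan; linarith
    have hcos : cos (v / 2) ≠ 0 := by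
      intro h0; apply htan0; rw [tan_eq_sin_div_cos, h0]; simp
    have hsin : sin (v / 2) ≠ 0 := by
      intro h0; apply htan0; rw [tan_eq_sin_div_cos, h0]; simp
    have key : 1 / tan (v / 2) - Qk (1 - ε) v = ε ^ 2 * (1 / tan (v / 2)) / Dk (1 - ε) v := by
      have hs : sin v = 2 * sin (v / 2) * cos (v / 2) := by
        rw [← sin_two_mul]; congr 1; ring
      have hc : cos v = 1 - 2 * sin (v / 2) ^ 2 := by
        have := cos_two_mul (v / 2)
        rw [show 2 * (v / 2) = v by ring] at this
        rw [this]; nlinarith [sin_sq_add_cos_sq (v / 2)]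
      unfold Qk
      rw [eq_div_iff hp.ne', sub_mul, div_mul_cancel₀ _ hp.ne', tan_eq_sin_div_cos, one_div_div]
      unfold Dk
      rw [hs, hc]
      field_simp
      ring
    rw [key, abs_div, abs_of_pos hp, abs_mul, abs_div, abs_one, abs_of_pos (by positivity : 0 < ε ^ 2)]
    have h5 : ε * (1 / |tan (v / 2)|) ≤ 2 := by
      rw [mul_one_div, div_le_iff₀ (by positivity)]; linarith
    rw [mul_div_assoc' 16, div_le_div_iff₀ hp hq]
    calc ε ^ 2 * (1 / |tan (v / 2)|) * (ε ^ 2 + v ^ 2)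
        = ε * (ε * (1 / |tan (v / 2)|)) * (ε ^ 2 + v ^ 2) := by ring
      _ ≤ ε * 2 * (ε ^ 2 + v ^ 2) := by gcongr
      _ = 16 * ε * ((ε ^ 2 + v ^ 2) / 8) := by ring
      _ ≤ _ := by gcongr
  · rw [zero_sub, abs_neg]
    push Not at hc
    unfold Qk
    rw [abs_div, abs_of_pos hp, abs_mul, abs_of_pos (by linarith : 0 < 2 * (1 - ε)),
      mul_div_assoc', div_le_div_iff₀ hp hq]
    have : |sin v| ≤ |v| := abs_sin_le_abs
    calc 2 * (1 - ε) * |sin v| * (ε ^ 2 + v ^ 2) ≤ 2 * 1 * ε * (ε ^ 2 + v ^ 2) := by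
          gcongr <;> linarith
      _ = 16 * ε * ((ε ^ 2 + v ^ 2) / 8) := by ring
      _ ≤ _ := by gcongr

end HT

namespace HT
open Real Topology

lemma kk_le_aux {ε : ℝ} (h : 0 < ε) (v : ℝ) :
    ∃ j : ℕ, |v| ≤ 2 ^ j * ε ∧ kk ε v ≤ 4 * (1 / 4) ^ j / ε := by
  classical
  have hex : ∃ j : ℕ, |v| ≤ 2 ^ j * ε := by
    obtain ⟨n, hn⟩ := pow_unbounded_of_one_lt (|v| / ε) (by norm_num : (1 : ℝ) < 2)
    exact ⟨n, by rw [div_lt_iff₀ h] at hn; exact hn.le⟩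
  refine ⟨Nat.find hex, Nat.find_spec hex, ?_⟩
  have hq : 0 < ε ^ 2 + v ^ 2 := by positivity
  unfold kk
  rw [div_le_div_iff₀ hq h]
  rcases hj : Nat.find hex with _ | m
  · simp; nlinarith [sq_nonneg v]
  · have hm : ¬ (|v| ≤ 2 ^ m * ε) := Nat.find_min hex (by omega)
    push Not at hm
    have h1 : (2 ^ m * ε) ^ 2 ≤ v ^ 2 := by
      rw [← sq_abs v]; gcongr
    have h2 : ((1 : ℝ) / 4) ^ m * (2 ^ m) ^ 2 = 1 := by
      rw [← pow_mul, mul_comm m 2, pow_mul, ← mul_pow]; norm_num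
    have h3 : (0 : ℝ) < (1 / 4) ^ m := by positivity
    calc ε * ε = ((1 : ℝ) / 4) ^ m * (2 ^ m) ^ 2 * (ε * ε) := by rw [h2, one_mul]
      _ = (1 / 4) ^ m * (2 ^ m * ε) ^ 2 := by ring
      _ ≤ (1 / 4) ^ m * v ^ 2 := by gcongr
      _ ≤ (1 / 4) ^ m * (ε ^ 2 + v ^ 2) := by gcongr; nlinarith
      _ = 4 * (1 / 4) ^ (m + 1) * (ε ^ 2 + v ^ 2) := by ring

/-- `ρ⁻¹ ∫_{|v| ≤ ρ} φ` -/
def av (φ : ℝ → ℝ) (ρ : ℝ) : ℝ := ρ⁻¹ * ∫ v in Icc (-ρ) ρ, φ v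

lemma av_nonneg {φ : ℝ → ℝ} (h0 : ∀ v, 0 ≤ φ v) {ρ : ℝ} (hρ : 0 < ρ) : 0 ≤ av φ ρ :=
  mul_nonneg (by positivity) (integral_nonneg h0)

lemma av_bdd {φ : ℝ → ℝ} (hφ : Integrable φ) (h0 : ∀ v, 0 ≤ φ v)
    (hL : Tendsto (av φ) (𝓝[>] 0) (𝓝 0)) : ∃ M, ∀ ρ, 0 < ρ → av φ ρ ≤ M := by
  have h1 : ∀ᶠ ρ in 𝓝[>] (0 : ℝ), av φ ρ < 1 := hL.eventually (gt_mem_nhds one_pos)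
  obtain ⟨δ, hδ, hδ2⟩ := mem_nhdsGT_iff_exists_Ioo_subset.1 h1
  have hδ : 0 < δ := hδ
  refine ⟨max 1 (δ⁻¹ * ∫ v, φ v), fun ρ hρ => ?_⟩
  by_cases h : ρ < δ
  · exact le_max_of_le_left (hδ2 ⟨hρ, h⟩ : av φ ρ < 1).le
  · push Not at h
    apply le_max_of_le_right
    unfold av
    refine mul_le_mul ?_ ?_ (integral_nonneg h0) (by positivity)
    · gcongr
    · exact setIntegral_le_integral hφ (Eventually.of_forall h0)

lemma lint_kk_le {φ : ℝ → ℝ} (hφ : Integrable φ) (h0 : ∀ v, 0 ≤ φ v) {M : ℝ}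
    (hM : ∀ ρ, 0 < ρ → av φ ρ ≤ M) {ε : ℝ} (hε : 0 < ε) :
    ∫ v, kk ε v * φ v ≤ ∑' j : ℕ, 4 * (1 / 2) ^ j * av φ (2 ^ j * ε) := by
  have hsum : Summable (fun j : ℕ => 4 * (1 / 2 : ℝ) ^ j * av φ (2 ^ j * ε)) := by
    refine Summable.of_nonneg_of_le (f := fun j : ℕ => 4 * (1 / 2 : ℝ) ^ j * M) ?_ ?_ ?_
    · intro j; have := av_nonneg h0 (ρ := 2 ^ j * ε) (by positivity); positivity
    · intro j; have := hM (2 ^ j * ε) (by positivity); gcongr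
    · exact (summable_geometric_two.mul_left 4).mul_right M
  have hnn : ∀ j : ℕ, 0 ≤ 4 * (1 / 2 : ℝ) ^ j * av φ (2 ^ j * ε) := by
    intro j; have := av_nonneg h0 (ρ := 2 ^ j * ε) (by positivity); positivity
  set ψ : ℕ → ℝ → ℝ := fun j v => (Icc (-(2 ^ j * ε)) (2 ^ j * ε)).indicator
    (fun v => 4 * (1 / 4) ^ j / ε * φ v) v with hψ
  have hψi : ∀ j, Integrable (ψ j) := fun j =>
    (hφ.const_mul _).indicator measurableSet_Icc
  have hψ0 : ∀ j v, 0 ≤ ψ j v := fun j v => by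
    apply indicator_nonneg; intro v _; have := h0 v; positivity
  have hψint : ∀ j, ∫ v, ψ j v = 4 * (1 / 2 : ℝ) ^ j * av φ (2 ^ j * ε) := by
    intro j
    rw [hψ]; simp only
    rw [integral_indicator measurableSet_Icc, integral_const_mul]
    unfold av
    have h2 : ((1 : ℝ) / 4) ^ j = (1 / 2) ^ j * (2 ^ j)⁻¹ := by
      rw [← inv_pow, ← mul_pow]; norm_num
    rw [h2, mul_inv]; ring
  rw [integral_eq_lintegral_of_nonneg_ae
    (Eventually.of_forall fun v => mul_nonneg (kk_pos hε v).le (h0 v))]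
  · apply ENNReal.toReal_le_of_le_ofReal (tsum_nonneg hnn)
    rw [ENNReal.ofReal_tsum_of_nonneg hnn hsum]
    calc ∫⁻ v, ENNReal.ofReal (kk ε v * φ v) ≤ ∫⁻ v, ∑' j, ENNReal.ofReal (ψ j v) := by
          apply lintegral_mono
          intro v
          obtain ⟨j, hj1, hj2⟩ := kk_le_aux hε v
          refine le_trans ?_ (ENNReal.le_tsum j)
          apply ENNReal.ofReal_le_ofReal
          simp only [hψ]
          rw [indicator_of_mem (by rw [abs_le] at hj1; exact hj1)]
          exact mul_le_mul_of_nonneg_right hj2 (h0 v)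
      _ = ∑' j, ∫⁻ v, ENNReal.ofReal (ψ j v) :=
          lintegral_tsum fun j => (hψi j).aestronglyMeasurable.aemeasurable.ennreal_ofReal
      _ = ∑' j, ENNReal.ofReal (4 * (1 / 2 : ℝ) ^ j * av φ (2 ^ j * ε)) := by
          congr 1; ext j
          rw [← hψint, ofReal_integral_eq_lintegral_ofReal (hψi j) (Eventually.of_forall (hψ0 j))]
      _ ≤ _ := le_rfl
  · refine AEStronglyMeasurable.mul ?_ hφ.aestronglyMeasurable
    unfold kk
    exact (Measurable.aestronglyMeasurable (by fun_prop))

lemma tendsto_kk {φ : ℝ → ℝ} (hφ : Integrable φ) (h0 : ∀ v, 0 ≤ φ v)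
    (hL : Tendsto (av φ) (𝓝[>] 0) (𝓝 0)) :
    Tendsto (fun ε => ∫ v, kk ε v * φ v) (𝓝[>] 0) (𝓝 0) := by
  obtain ⟨M, hM⟩ := av_bdd hφ h0 hL
  have hpos : ∀ᶠ ε in 𝓝[>] (0 : ℝ), 0 < ε := eventually_mem_nhdsWithin
  have h1 : Tendsto (fun ε => ∑' j : ℕ, 4 * (1 / 2 : ℝ) ^ j * av φ (2 ^ j * ε)) (𝓝[>] 0)
      (𝓝 (∑' j : ℕ, (0 : ℝ))) := by
    apply tendsto_tsum_of_dominated_convergence (bound := fun j : ℕ => 4 * (1 / 2 : ℝ) ^ j * M)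
    · exact (summable_geometric_two.mul_left 4).mul_right M
    · intro j
      have : Tendsto (fun ε : ℝ => 2 ^ j * ε) (𝓝[>] 0) (𝓝[>] 0) := by
        apply tendsto_nhdsWithin_of_tendsto_nhds_of_eventually_within
        · have : Tendsto (fun ε : ℝ => 2 ^ j * ε) (𝓝 0) (𝓝 (2 ^ j * 0)) :=
            (continuous_const.mul continuous_id).tendsto 0
          rw [mul_zero] at this
          exact this.mono_left nhdsWithin_le_nhds
        · filter_upwards [hpos] with ε hε
          exact mem_Ioi.2 (by positivity)
      simpa using (hL.comp this).const_mul (4 * (1 / 2 : ℝ) ^ j)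
    · filter_upwards [hpos] with ε hε j
      have h1 := hM (2 ^ j * ε) (by positivity)
      have h2 := av_nonneg h0 (ρ := 2 ^ j * ε) (by positivity)
      rw [norm_of_nonneg (by positivity)]
      gcongr
  rw [tsum_zero] at h1
  refine tendsto_of_tendsto_of_tendsto_of_le_of_le' tendsto_const_nhds h1 ?_ ?_
  · filter_upwards [hpos] with ε hε
    exact integral_nonneg fun v => mul_nonneg (kk_pos hε v).le (h0 v)
  · filter_upwards [hpos] with ε hε
    exact lint_kk_le hφ h0 hM hε

end HT

namespace HT
open Real Topology

lemma ae_leb {E : Type*} [NormedAddCommGroup E] {h : ℝ → E} (hh : LocallyIntegrable h) :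
    ∀ᵐ x, Tendsto (av (fun v => ‖h (x + v) - h x‖)) (𝓝[>] 0) (𝓝 0) := by
  filter_upwards [IsUnifLocDoublingMeasure.ae_tendsto_average_norm_sub (volume : Measure ℝ) hh 1]
    with x hx
  have h1 := hx (l := 𝓝[>] (0 : ℝ)) (fun _ => x) id tendsto_id (by
    filter_upwards [eventually_mem_nhdsWithin] with ρ hρ
    simp only [id, one_mul]
    exact Metric.mem_closedBall_self (le_of_lt hρ))
  have h2 := h1.const_mul 2
  rw [mul_zero] at h2
  refine h2.congr' ?_
  filter_upwards [eventually_mem_nhdsWithin] with ρ hρ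
  have hρ : 0 < ρ := hρ
  simp only [id]
  rw [setAverage_eq, Real.closedBall_eq_Icc, Real.volume_real_Icc_of_le (by linarith)]
  unfold av
  have : ∫ v in Icc (-ρ) ρ, ‖h (x + v) - h x‖ = ∫ y in Icc (x - ρ) (x + ρ), ‖h y - h x‖ := by
    rw [integral_Icc_eq_integral_Ioc, integral_Icc_eq_integral_Ioc,
      ← intervalIntegral.integral_of_le (by linarith),
      ← intervalIntegral.integral_of_le (by linarith),
      intervalIntegral.integral_comp_add_left (fun y => ‖h y - h x‖) x]
    rfl
  rw [this, smul_eq_mul, show x + ρ - (x - ρ) = 2 * ρ by ring, mul_inv]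
  ring

lemma conv_kernel {E : Type*} [NormedAddCommGroup E] [NormedSpace ℝ E] {h : ℝ → E}
    (hh : LocallyIntegrable h) {x : ℝ}
    (hx : Tendsto (av (fun v => ‖h (x + v) - h x‖)) (𝓝[>] 0) (𝓝 0)) {K : ℝ → ℝ → ℝ}
    (hK : ∀ᶠ ε in 𝓝[>] (0 : ℝ), ∀ v, |v| < π → |K ε v| ≤ 16 * kk ε v) :
    Tendsto (fun ε => ∫ v in Ioo (-π) π, K ε v • (h (x + v) - h x)) (𝓝[>] 0) (𝓝 0) := by
  have hpos : ∀ᶠ ε in 𝓝[>] (0 : ℝ), 0 < ε := eventually_mem_nhdsWithin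
  set φ : ℝ → ℝ := (Ioo (-π) π).indicator (fun v => ‖h (x + v) - h x‖) with hφdef
  have hloc : LocallyIntegrable (fun v => h (x + v) - h x) := by
    refine LocallyIntegrable.sub ?_ (locallyIntegrable_const _)
    have h3 := locallyIntegrable_map_homeomorph (Homeomorph.addLeft x) (f := h)
      (μ := (volume : Measure ℝ))
    rw [show (Homeomorph.addLeft x : ℝ → ℝ) = fun v => x + v from rfl, map_add_left_eq_self] at h3
    exact h3.1 hh
  have hφ : Integrable φ := by
    rw [hφdef, integrable_indicator_iff measurableSet_Ioo]
    exact ((hloc.integrableOn_isCompact isCompact_Icc).mono_set Ioo_subset_Icc_self).norm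
  have h0 : ∀ v, 0 ≤ φ v := fun v => indicator_nonneg (fun _ _ => norm_nonneg _) v
  have hL : Tendsto (av φ) (𝓝[>] 0) (𝓝 0) := by
    refine tendsto_of_tendsto_of_tendsto_of_le_of_le' tendsto_const_nhds hx ?_ ?_
    · filter_upwards [hpos] with ε hε
      exact av_nonneg h0 hε
    · filter_upwards [hpos] with ε hε
      refine mul_le_mul_of_nonneg_left ?_ (by positivity)
      refine integral_mono hφ.integrableOn
        ((hloc.integrableOn_isCompact isCompact_Icc).norm) ?_
      intro v
      exact indicator_le_self' (fun _ _ => norm_nonneg _) v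
  have h1 := (tendsto_kk hφ h0 hL).const_mul 16
  rw [mul_zero] at h1
  refine squeeze_zero_norm' ?_ h1
  filter_upwards [hpos, hK] with ε hε hKε
  rw [← integral_const_mul, ← integral_indicator measurableSet_Ioo]
  refine norm_integral_le_of_norm_le ?_ (Eventually.of_forall fun v => ?_)
  · refine Integrable.const_mul ?_ _
    refine hφ.bdd_mul (c := ε⁻¹) ?_ (Eventually.of_forall fun v => ?_)
    · unfold kk
      exact (Measurable.aestronglyMeasurable (by fun_prop))
    · rw [norm_of_nonneg (kk_pos hε v).le]
      unfold kk
      rw [← one_div, div_le_div_iff₀ (by positivity) hε]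
      nlinarith [sq_nonneg v]
  · simp only [hφdef]
    by_cases hv : v ∈ Ioo (-π) π
    · rw [indicator_of_mem hv, indicator_of_mem hv, norm_smul, ← mul_assoc]
      exact mul_le_mul_of_nonneg_right (hKε v (abs_lt.2 hv)) (norm_nonneg _)
    · rw [indicator_of_notMem hv, indicator_of_notMem hv]; simp

end HT

namespace HT
open Real Topology InnerProductSpace

lemma shift_int {E : Type*} [NormedAddCommGroup E] [NormedSpace ℝ E] {h : ℝ → E}
    (hp : Function.Periodic h (2 * π)) (θ : ℝ) :
    ∫ t in (0 : ℝ)..2 * π, h t = ∫ v in (-π)..π, h (θ + v) := by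
  rw [intervalIntegral.integral_comp_add_left]
  have := hp.intervalIntegral_add_eq 0 (θ + -π)
  rw [zero_add] at this
  rw [this]; congr 1; ring

lemma shift_int' {E : Type*} [NormedAddCommGroup E] [NormedSpace ℝ E] {h : ℝ → E}
    (hp : Function.Periodic h (2 * π)) (θ : ℝ) :
    ∫ v in (-π)..π, h (θ + v) = ∫ v in (-π)..π, h v := by
  rw [← shift_int hp θ, shift_int hp 0]; simp

lemma periodic_arg {E : Type*} {h : ℝ → E} (hp : Function.Periodic h (2 * π)) (t : ℝ) :
    h (Complex.arg (Complex.exp (t * Complex.I))) = h t := by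
  rw [Complex.arg_exp_mul_I]
  unfold toIocMod
  exact hp.sub_zsmul_eq _

lemma li_ii {E : Type*} [NormedAddCommGroup E] {h : ℝ → E} (hh : LocallyIntegrable h)
    (a b : ℝ) : IntervalIntegrable h volume a b := by
  rw [intervalIntegrable_iff']
  exact hh.integrableOn_isCompact isCompact_uIcc

lemma ii_ofReal {h : ℝ → ℝ} {a b : ℝ} (hh : IntervalIntegrable h volume a b) :
    IntervalIntegrable (fun x => (h x : ℂ)) volume a b :=
  ⟨hh.1.ofReal, hh.2.ofReal⟩

def ee (t : ℝ) : ℂ := Complex.exp (t * Complex.I)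

lemma circleMap_ee (r t : ℝ) : circleMap 0 r t = r * ee t := by simp [circleMap, ee]

lemma norm_ee (t : ℝ) : ‖ee t‖ = 1 := Complex.norm_exp_ofReal_mul_I t

lemma continuous_ee : Continuous ee := by unfold ee; fun_prop

lemma ee_periodic : Function.Periodic ee (2 * π) := by
  intro t
  unfold ee
  push_cast
  rw [add_mul, Complex.exp_add, Complex.exp_two_pi_mul_I, mul_one]

lemma mem_ball_ee {r : ℝ} (h0 : 0 ≤ r) (h1 : r < 1) (t : ℝ) :
    (r : ℂ) * ee t ∈ Metric.ball (0 : ℂ) 1 := by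
  simp [norm_ee, abs_of_nonneg h0, h1]

lemma herglotz_ee {r : ℝ} (h0 : 0 ≤ r) (h1 : r < 1) (θ v : ℝ) :
    herglotzRieszKernel 0 (r * ee θ) (ee (θ + v))
      = (Pk r v : ℂ) - Complex.I * (Qk r v : ℂ) := by
  have hD := Dk_pos h0 h1 v
  have he : ee (θ + v) = ee θ * ee v := by
    unfold ee; rw [← Complex.exp_add]; push_cast; congr 1; ring
  have hθ : ee θ ≠ 0 := Complex.exp_ne_zero _
  rw [herglotzRieszKernel_def, he, sub_zero, sub_zero, mul_comm (r : ℂ) (ee θ),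
    ← mul_add, ← mul_sub, mul_div_mul_left _ _ hθ]
  have hv : ee v = (cos v : ℂ) + (sin v : ℂ) * Complex.I := by
    unfold ee; rw [Complex.exp_mul_I]; push_cast; rfl
  have hne : ee v - r ≠ 0 := by
    intro h
    have : ee v = r := by linear_combination h
    have h3 := norm_ee v
    rw [this, Complex.norm_real, norm_of_nonneg h0] at h3
    linarith
  have hD' : (Dk r v : ℂ) ≠ 0 := by exact_mod_cast hD.ne'
  have hsc : (cos v : ℂ) ^ 2 + (sin v : ℂ) ^ 2 = 1 := by
    exact_mod_cast cos_sq_add_sin_sq v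
  unfold Pk Qk
  push_cast
  rw [div_eq_iff hne, mul_div_assoc', ← sub_div, div_mul_eq_mul_div, eq_div_iff hD']
  unfold Dk
  push_cast
  rw [hv]
  push_cast at hsc ⊢
  have hI : Complex.I ^ 2 = -1 := Complex.I_sq
  set c := Complex.cos (v : ℂ)
  set s := Complex.sin (v : ℂ)
  set R : ℂ := (r : ℂ)
  linear_combination (- 2 * R) * hsc + (2 * R * s ^ 2) * hI


lemma poisson_formula {E : Type*} [NormedAddCommGroup E] [NormedSpace ℂ E] [CompleteSpace E]
    {f : ℂ → E} (hf : DiffContOnCl ℂ f (Metric.ball 0 1))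
    {r : ℝ} (h0 : 0 ≤ r) (h1 : r < 1) (θ : ℝ) :
    f (r * ee θ) = (2 * π)⁻¹ • ∫ v in (-π)..π, Pk r v • f (ee (θ + v)) := by
  rw [← hf.circleAverage_re_herglotzRieszKernel_smul (mem_ball_ee h0 h1 θ), circleAverage_def]
  congr 1
  simp only [circleMap_ee, Complex.ofReal_one, one_mul]
  rw [shift_int (θ := θ)]
  · congr 1; ext v
    simp only [Pi.smul_apply', Function.comp_apply]
    rw [herglotz_ee h0 h1]; simp
  · intro t
    simp only [Pi.smul_apply', Function.comp_apply]
    rw [ee_periodic t]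

lemma int_Pk {r : ℝ} (h0 : 0 ≤ r) (h1 : r < 1) : ∫ v in (-π)..π, Pk r v = 2 * π := by
  have := poisson_formula (f := fun _ => (1 : ℂ)) (diffContOnCl_const) h0 h1 0
  simp only [Complex.real_smul, mul_one] at this
  rw [intervalIntegral.integral_ofReal] at this
  have h2 : (1 : ℝ) = (2 * π)⁻¹ * ∫ v in (-π)..π, Pk r v := by exact_mod_cast this
  have := pi_pos
  field_simp at h2
  linarith

/-- the Herglotz transform of `g` -/
def FF (g : ℝ → ℝ) (z : ℂ) : ℂ :=
  circleAverage (fun ζ => herglotzRieszKernel 0 z ζ • (g (Complex.arg ζ) : ℂ)) 0 1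

lemma FF_diff {g : ℝ → ℝ} (hp : Function.Periodic g (2 * π)) (hl : LocallyIntegrable g) :
    DifferentiableOn ℂ (FF g) (Metric.ball 0 1) := by
  apply differentiableOn_circleAverage_herglotzRieszKernel_smul
  unfold CircleIntegrable
  simp only [circleMap_ee, Complex.ofReal_one, one_mul]
  have : (fun θ : ℝ => ((g (Complex.arg (ee θ)) : ℝ) : ℂ)) = fun θ => ((g θ : ℝ) : ℂ) := by
    ext θ; unfold ee; rw [periodic_arg hp]
  rw [this]
  exact ii_ofReal (li_ii hl 0 (2 * π))

lemma FF_eq {g : ℝ → ℝ} (hp : Function.Periodic g (2 * π))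
    {r : ℝ} (h0 : 0 ≤ r) (h1 : r < 1) (θ : ℝ) :
    FF g (r * ee θ) = (2 * π)⁻¹ • ∫ v in (-π)..π,
      ((Pk r v : ℂ) - Complex.I * (Qk r v : ℂ)) * (g (θ + v) : ℂ) := by
  unfold FF
  rw [circleAverage_def]
  congr 1
  simp only [circleMap_ee, Complex.ofReal_one, one_mul]
  rw [shift_int (θ := θ)]
  · congr 1; ext v
    rw [herglotz_ee h0 h1]
    unfold ee
    rw [periodic_arg hp]; rfl
  · intro t
    simp only
    rw [ee_periodic t]

lemma locInt_shift {E : Type*} [NormedAddCommGroup E] {h : ℝ → E} (hh : LocallyIntegrable h)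
    (x : ℝ) : LocallyIntegrable (fun v => h (x + v)) := by
  have h3 := locallyIntegrable_map_homeomorph (Homeomorph.addLeft x) (f := h)
      (μ := (volume : Measure ℝ))
  rw [show (Homeomorph.addLeft x : ℝ → ℝ) = fun v => x + v from rfl, map_add_left_eq_self] at h3
  exact h3.1 hh

lemma ii_mul {g : ℝ → ℝ} (hl : LocallyIntegrable g) {k : ℝ → ℝ} (hk : Continuous k) (θ a b : ℝ) :
    IntervalIntegrable (fun v => k v * g (θ + v)) volume a b :=
  (li_ii (locInt_shift hl θ) a b).continuousOn_mul hk.continuousOn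

lemma FF_eq' {g : ℝ → ℝ} (hp : Function.Periodic g (2 * π)) (hl : LocallyIntegrable g)
    {r : ℝ} (h0 : 0 ≤ r) (h1 : r < 1) (θ : ℝ) :
    FF g (r * ee θ) = (((2 * π)⁻¹ * ∫ v in (-π)..π, Pk r v * g (θ + v) : ℝ) : ℂ) -
      Complex.I * (((2 * π)⁻¹ * ∫ v in (-π)..π, Qk r v * g (θ + v) : ℝ) : ℂ) := by
  rw [FF_eq hp h0 h1]
  have e1 : ∀ v, ((Pk r v : ℂ) - Complex.I * (Qk r v : ℂ)) * (g (θ + v) : ℂ)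
    = ((Pk r v * g (θ + v) : ℝ) : ℂ) - Complex.I * ((Qk r v * g (θ + v) : ℝ) : ℂ) := by
    intro v; push_cast; ring
  simp_rw [e1]
  rw [intervalIntegral.integral_sub, intervalIntegral.integral_const_mul,
    intervalIntegral.integral_ofReal, intervalIntegral.integral_ofReal]
  · rw [Complex.real_smul]; push_cast; ring
  · exact ii_ofReal (ii_mul hl (continuous_Pk h0 h1) θ _ _)
  · exact (ii_ofReal (ii_mul hl (continuous_Qk h0 h1) θ _ _)).const_mul _

lemma FF_re {g : ℝ → ℝ} (hp : Function.Periodic g (2 * π)) (hl : LocallyIntegrable g)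
    {r : ℝ} (h0 : 0 ≤ r) (h1 : r < 1) (θ : ℝ) :
    (FF g (r * ee θ)).re = (2 * π)⁻¹ * ∫ v in (-π)..π, Pk r v * g (θ + v) := by
  rw [FF_eq' hp hl h0 h1, Complex.sub_re, Complex.ofReal_re, Complex.re_mul_ofReal]; simp

lemma FF_im {g : ℝ → ℝ} (hp : Function.Periodic g (2 * π)) (hl : LocallyIntegrable g)
    {r : ℝ} (h0 : 0 ≤ r) (h1 : r < 1) (θ : ℝ) :
    (FF g (r * ee θ)).im = - ((2 * π)⁻¹ * ∫ v in (-π)..π, Qk r v * g (θ + v)) := by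
  rw [FF_eq' hp hl h0 h1, Complex.sub_im, Complex.ofReal_im, Complex.im_mul_ofReal]; simp

lemma exists_polar {z : ℂ} (hz : z ∈ Metric.ball (0 : ℂ) 1) :
    ∃ r θ : ℝ, 0 ≤ r ∧ r < 1 ∧ z = r * ee θ :=
  ⟨‖z‖, z.arg, norm_nonneg _, by simpa using hz, (Complex.norm_mul_exp_arg_mul_I z).symm⟩

lemma one_le_FF_re {g : ℝ → ℝ} (hp : Function.Periodic g (2 * π)) (hl : LocallyIntegrable g)
    (hg : ∀ x, 1 ≤ g x) {z : ℂ} (hz : z ∈ Metric.ball (0 : ℂ) 1) : 1 ≤ (FF g z).re := by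
  obtain ⟨r, θ, h0, h1, rfl⟩ := exists_polar hz
  rw [FF_re hp hl h0 h1]
  have h2 : 2 * π ≤ ∫ v in (-π)..π, Pk r v * g (θ + v) := by
    rw [← int_Pk h0 h1]
    apply intervalIntegral.integral_mono_on (by linarith [pi_pos])
      ((continuous_Pk h0 h1).intervalIntegrable _ _) (ii_mul hl (continuous_Pk h0 h1) θ _ _)
    intro v _
    have := Pk_nonneg h0 h1 v
    nlinarith [hg (θ + v)]
  rw [inv_mul_eq_div, le_div_iff₀ (by positivity)]; linarith

lemma FF_zero_im {g : ℝ → ℝ} (hp : Function.Periodic g (2 * π)) (hl : LocallyIntegrable g) :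
    (FF g 0).im = 0 := by
  have := FF_im hp hl le_rfl one_pos 0
  simpa [Qk] using this

/-- Jensen, pointwise. -/
lemma jensen {g : ℝ → ℝ} (hp : Function.Periodic g (2 * π)) (hl : LocallyIntegrable g)
    (hl2 : LocallyIntegrable (fun x => g x * log (g x)))
    (hg : ∀ x, 1 ≤ g x) {r : ℝ} (h0 : 0 ≤ r) (h1 : r < 1) (θ : ℝ) :
    (FF g (r * ee θ)).re * log (FF g (r * ee θ)).re ≤
      (2 * π)⁻¹ * ∫ v in (-π)..π, Pk r v * (g (θ + v) * log (g (θ + v))) := by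
  have hu := one_le_FF_re hp hl hg (mem_ball_ee h0 h1 θ)
  have hre := FF_re hp hl h0 h1 θ
  set u := (FF g (r * ee θ)).re
  have i1 := ii_mul hl (continuous_Pk h0 h1) θ (-π) π
  have i2 := ii_mul hl2 (continuous_Pk h0 h1) θ (-π) π
  have i3 := (continuous_Pk h0 h1).intervalIntegrable (μ := volume) (-π) π
  have h2 : ∫ v in (-π)..π, ((1 + log u) * (Pk r v * g (θ + v)) - u * Pk r v) ≤
      ∫ v in (-π)..π, Pk r v * (g (θ + v) * log (g (θ + v))) := by
    apply intervalIntegral.integral_mono_on (by linarith [pi_pos])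
      ((i1.const_mul _).sub (i3.const_mul _)) i2
    intro v _
    have hP := Pk_nonneg h0 h1 v
    have hx := hg (θ + v)
    set x := g (θ + v)
    have hlog := Real.one_sub_inv_le_log_of_pos (x := x / u) (by positivity)
    rw [log_div (by positivity) (by positivity), inv_div] at hlog
    have h3 : x * (1 - u / x) ≤ x * (log x - log u) := by gcongr
    rw [mul_sub, mul_div_cancel₀ _ (by positivity)] at h3
    nlinarith
  rw [intervalIntegral.integral_sub (i1.const_mul _) (i3.const_mul _),
    intervalIntegral.integral_const_mul, intervalIntegral.integral_const_mul, int_Pk h0 h1] at h2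
  have hpi := pi_pos
  have h4 : ∫ v in (-π)..π, Pk r v * g (θ + v) = 2 * π * u := by
    rw [hre]; field_simp
  rw [h4] at h2
  rw [inv_mul_eq_div, le_div_iff₀ (by positivity)]
  nlinarith

end HT

namespace HT
open Real Topology InnerProductSpace

lemma lint_shift {h : ℝ → ENNReal} (hm : Measurable h) (hp : Function.Periodic h (2 * π)) (x : ℝ) :
    ∫⁻ v in Ioc (-π) π, h (x + v) = ∫⁻ v in Ioc (-π) π, h v := by
  have e1 : ∫⁻ v in Ioc (-π) π, h (x + v) = ∫⁻ v in Ioc (x - π) (x - π + 2 * π), h v := by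
    rw [← lintegral_indicator measurableSet_Ioc, ← lintegral_indicator measurableSet_Ioc,
      ← lintegral_add_left_eq_self ((Ioc (x - π) (x - π + 2 * π)).indicator _) x]
    congr 1; ext v
    simp only [indicator, mem_Ioc]
    congr 1
    apply propext
    constructor <;> rintro ⟨h1, h2⟩ <;> constructor <;> linarith
  have e2 : Ioc (-π) π = Ioc (-π) (-π + 2 * π) := by congr 1; ring
  rw [e1, e2]
  have : VAddInvariantMeasure (AddSubgroup.zmultiples (2 * π)) ℝ volume :=
    ⟨fun c s _ => measure_preimage_add _ _ _⟩
  refine IsAddFundamentalDomain.setLIntegral_eq (G := AddSubgroup.zmultiples (2 * π))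
    (isAddFundamentalDomain_Ioc two_pi_pos (x - π) volume)
    (isAddFundamentalDomain_Ioc two_pi_pos (-π) volume) h ?_
  rintro ⟨c, hc⟩ y
  obtain ⟨n, rfl⟩ := AddSubgroup.mem_zmultiples_iff.1 hc
  show h (n • (2 * π) + y) = h y
  rw [add_comm]
  exact hp.zsmul n y

lemma cont_FF {f : ℂ → ℂ} (hf : DifferentiableOn ℂ f (Metric.ball 0 1))
    {r : ℝ} (h0 : 0 ≤ r) (h1 : r < 1) : Continuous (fun θ => f (r * ee θ)) :=
  hf.continuousOn.comp_continuous (continuous_const.mul continuous_ee)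
    (fun θ => mem_ball_ee h0 h1 θ)

lemma int_ulogu {g : ℝ → ℝ} (hm : Measurable g) (hp : Function.Periodic g (2 * π))
    (hl : LocallyIntegrable g)
    (hl2 : LocallyIntegrable (fun x => g x * log (g x)))
    (hg : ∀ x, 1 ≤ g x) {r : ℝ} (h0 : 0 ≤ r) (h1 : r < 1) :
    ∫ θ in (-π)..π, (FF g (r * ee θ)).re * log (FF g (r * ee θ)).re ≤
      ∫ θ in (-π)..π, g θ * log (g θ) := by
  have hpi : -π ≤ π := by linarith [pi_pos]
  set ψ : ℝ → ℝ := fun x => g x * log (g x) with hψ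
  have hψ0 : ∀ x, 0 ≤ ψ x := fun x => mul_nonneg (by linarith [hg x]) (log_nonneg (hg x))
  have hψm : Measurable ψ := hm.mul (measurable_log.comp hm)
  have hψp : Function.Periodic ψ (2 * π) := fun x => by simp [hψ, hp x]
  have hψi : IntegrableOn ψ (Ioc (-π) π) :=
    (hl2.integrableOn_isCompact isCompact_Icc).mono_set Ioc_subset_Icc_self
  have hψ_int : ∫⁻ v in Ioc (-π) π, ENNReal.ofReal (ψ v) = ENNReal.ofReal (∫ θ in (-π)..π, ψ θ) := by
    rw [intervalIntegral.integral_of_le hpi,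
      ofReal_integral_eq_lintegral_ofReal hψi (Eventually.of_forall hψ0)]
  have hu := fun θ => one_le_FF_re hp hl hg (mem_ball_ee h0 h1 θ)
  have hPm : Measurable (Pk r) := (continuous_Pk h0 h1).measurable
  have hnn0 : 0 ≤ ∫ θ in (-π)..π, ψ θ := intervalIntegral.integral_nonneg hpi fun x _ => hψ0 x
  have hcont : Continuous (fun θ => (FF g (r * ee θ)).re * log (FF g (r * ee θ)).re) := by
    have := Complex.continuous_re.comp (cont_FF (FF_diff hp hl) h0 h1)
    exact this.mul (this.log fun θ => by have := hu θ; simp only [Function.comp]; linarith)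
  rw [intervalIntegral.integral_of_le hpi, integral_eq_lintegral_of_nonneg_ae
    (Eventually.of_forall fun θ => mul_nonneg (by linarith [hu θ]) (log_nonneg (hu θ)))
    hcont.aestronglyMeasurable]
  apply ENNReal.toReal_le_of_le_ofReal hnn0
  calc ∫⁻ θ in Ioc (-π) π, ENNReal.ofReal ((FF g (r * ee θ)).re * log (FF g (r * ee θ)).re)
      ≤ ∫⁻ θ in Ioc (-π) π, ∫⁻ v in Ioc (-π) π,
          ENNReal.ofReal ((2 * π)⁻¹ * Pk r v) * ENNReal.ofReal (ψ (θ + v)) := by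
        apply lintegral_mono
        intro θ
        refine (ENNReal.ofReal_le_ofReal (jensen hp hl hl2 hg h0 h1 θ)).trans ?_
        rw [← intervalIntegral.integral_const_mul, intervalIntegral.integral_of_le hpi,
          ofReal_integral_eq_lintegral_ofReal]
        · apply lintegral_mono
          intro v
          simp only
          rw [← ENNReal.ofReal_mul (mul_nonneg (by positivity) (Pk_nonneg h0 h1 v)), mul_assoc]
        · have := (ii_mul hl2 (continuous_Pk h0 h1) θ (-π) π).const_mul (2 * π)⁻¹
          rw [intervalIntegrable_iff_integrableOn_Ioc_of_le hpi] at this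
          exact this
        · exact Eventually.of_forall fun v => mul_nonneg (by positivity)
            (mul_nonneg (Pk_nonneg h0 h1 v) (hψ0 _))
    _ = ∫⁻ v in Ioc (-π) π, ∫⁻ θ in Ioc (-π) π,
          ENNReal.ofReal ((2 * π)⁻¹ * Pk r v) * ENNReal.ofReal (ψ (θ + v)) := by
        apply lintegral_lintegral_swap
        apply Measurable.aemeasurable
        unfold Function.uncurry
        fun_prop
    _ = ∫⁻ v in Ioc (-π) π,
          ENNReal.ofReal ((2 * π)⁻¹ * Pk r v) * ENNReal.ofReal (∫ θ in (-π)..π, ψ θ) := by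
        congr 1; ext v
        rw [lintegral_const_mul _ (by fun_prop)]
        congr 1
        simp_rw [add_comm _ v]
        rw [lint_shift (h := fun x => ENNReal.ofReal (ψ x)) (by fun_prop)
          (fun x => by simp only [hψp x]) v, hψ_int]
    _ = ENNReal.ofReal (∫ θ in (-π)..π, ψ θ) := by
        rw [lintegral_mul_const _ (by fun_prop), ← ofReal_integral_eq_lintegral_ofReal,
          integral_const_mul, ← intervalIntegral.integral_of_le hpi, int_Pk h0 h1,
          inv_mul_cancel₀ (by positivity)]
        · simp
        · have := ((continuous_Pk h0 h1).intervalIntegrable (μ := volume) (-π) π).const_mul (2 * π)⁻¹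
          rw [intervalIntegrable_iff_integrableOn_Ioc_of_le hpi] at this
          exact this
        · exact Eventually.of_forall fun v => mul_nonneg (by positivity) (Pk_nonneg h0 h1 v)
    _ ≤ _ := le_rfl

lemma ptwise {w : ℂ} (hw : 1 ≤ w.re) :
    ‖w‖ ≤ -2 * (w * Complex.log w).re + 4 * (w.re * log w.re) + 2 := by
  have hn : w.re ≤ ‖w‖ := Complex.re_le_norm w
  have hw0 : w ≠ 0 := by rintro rfl; simp at hw; linarith
  have hnpos : 0 < ‖w‖ := by linarith
  set a := w.arg with ha
  have hre : w.re = ‖w‖ * cos a := (Complex.norm_mul_cos_arg w).symm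
  have him : w.im = ‖w‖ * sin a := (Complex.norm_mul_sin_arg w).symm
  have hcos : 0 < cos a := by
    by_contra h; push Not at h; nlinarith
  have hsa : sin a ^ 2 ≤ sin a * a := by
    have hle := Complex.abs_arg_le_pi w
    rw [← ha, abs_le] at hle
    rcases le_total 0 a with h | h
    · have h1 := sin_le h
      have h2 := sin_nonneg_of_nonneg_of_le_pi h hle.2
      nlinarith
    · have h1 := sin_le (neg_nonneg.2 h)
      have h2 := sin_nonneg_of_nonneg_of_le_pi (neg_nonneg.2 h) (by linarith)
      rw [sin_neg] at h1 h2
      nlinarith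
  have hva : ‖w‖ - w.re ≤ w.im * a := by
    rw [hre, him]
    have h1 : 1 - cos a ≤ sin a * a := by nlinarith [sin_sq_add_cos_sq a, cos_le_one a]
    nlinarith
  have hlog : w.re * log ‖w‖ ≤ w.re * log w.re + ‖w‖ / 2 + w.re * log 2 - w.re := by
    have h1 := Real.log_le_sub_one_of_pos (x := ‖w‖ / (2 * w.re)) (by positivity)
    rw [log_div (by positivity) (by positivity), log_mul (by norm_num) (by positivity)] at h1
    have h2 : w.re * (log ‖w‖ - (log 2 + log w.re)) ≤ w.re * (‖w‖ / (2 * w.re) - 1) := by gcongr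
    have h3 : w.re * (‖w‖ / (2 * w.re) - 1) = ‖w‖ / 2 - w.re := by
      have : w.re ≠ 0 := by positivity
      field_simp
    nlinarith
  have hml : (w * Complex.log w).re = w.re * log ‖w‖ - w.im * a := by
    rw [Complex.mul_re, Complex.log_re, Complex.log_im]
  have hul : w.re - 1 ≤ w.re * log w.re := by
    have h1 := Real.one_sub_inv_le_log_of_pos (x := w.re) (by positivity)
    have h2 : w.re * (1 - w.re⁻¹) ≤ w.re * log w.re := by gcongr
    rw [mul_sub, mul_inv_cancel₀ (by positivity)] at h2; linarith
  have hl2 : w.re * log 2 ≤ w.re := by nlinarith [log_two_lt_d9]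
  rw [hml]; linarith

lemma int_norm_FF {g : ℝ → ℝ} (hm : Measurable g) (hp : Function.Periodic g (2 * π))
    (hl : LocallyIntegrable g)
    (hl2 : LocallyIntegrable (fun x => g x * log (g x)))
    (hg : ∀ x, 1 ≤ g x) {r : ℝ} (h0 : 0 ≤ r) (h1 : r < 1) :
    ∫ θ in (-π)..π, ‖FF g (r * ee θ)‖ ≤ 4 * (∫ θ in (-π)..π, g θ * log (g θ)) + 4 * π := by
  have hpi : -π ≤ π := by linarith [pi_pos]
  have hd := FF_diff hp hl
  have hu := fun z hz => one_le_FF_re hp hl hg (z := z) hz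
  set Φ : ℂ → ℂ := fun z => FF g z * Complex.log (FF g z) with hΦ
  have hΦd : DifferentiableOn ℂ Φ (Metric.ball 0 1) := by
    refine hd.mul (hd.clog fun z hz => ?_)
    exact Or.inl (by linarith [hu z hz])
  have hca : circleAverage Φ 0 r = Φ 0 := by
    apply DiffContOnCl.circleAverage
    rw [abs_of_nonneg h0]
    exact hΦd.diffContOnCl_ball (Metric.closedBall_subset_ball h1)
  have hΦc : Continuous (fun θ => Φ (r * ee θ)) := cont_FF hΦd h0 h1
  have hFc : Continuous (fun θ => FF g (r * ee θ)) := cont_FF hd h0 h1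
  have hi0 : 0 ≤ ∫ θ in (-π)..π, (Φ (r * ee θ)).re := by
    have h2 : (circleAverage Φ 0 r).re = (2 * π)⁻¹ * ∫ θ in (-π)..π, (Φ (r * ee θ)).re := by
      rw [circleAverage_def]
      simp only [circleMap_ee]
      rw [shift_int (θ := 0) (fun t => by simp only [ee_periodic t])]
      simp only [zero_add]
      rw [Complex.real_smul, Complex.re_ofReal_mul]
      congr 1
      exact (Complex.reCLM.intervalIntegral_comp_comm
        (hΦc.intervalIntegrable (μ := volume) (-π) π)).symm
    have h3 : 0 ≤ (circleAverage Φ 0 r).re := by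
      rw [hca]
      have h4 := hu 0 (by simp)
      have h5 : FF g 0 = ((FF g 0).re : ℂ) := by
        apply Complex.ext <;> simp [FF_zero_im hp hl]
      simp only [hΦ]
      rw [h5, ← Complex.ofReal_log (by linarith), ← Complex.ofReal_mul, Complex.ofReal_re]
      exact mul_nonneg (by linarith) (log_nonneg h4)
    rw [h2] at h3
    exact (mul_nonneg_iff_of_pos_left (by positivity)).1 h3
  have hcont : Continuous (fun θ => (FF g (r * ee θ)).re * log (FF g (r * ee θ)).re) := by
    have := Complex.continuous_re.comp hFc
    exact this.mul (this.log fun θ => by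
      have := hu _ (mem_ball_ee h0 h1 θ); simp only [Function.comp]; linarith)
  have hc2 : Continuous (fun θ => (Φ (r * ee θ)).re) := Complex.continuous_re.comp hΦc
  have h6 : ∫ θ in (-π)..π, ‖FF g (r * ee θ)‖ ≤ ∫ θ in (-π)..π, (-2 * (Φ (r * ee θ)).re +
      4 * ((FF g (r * ee θ)).re * log (FF g (r * ee θ)).re) + 2) := by
    apply intervalIntegral.integral_mono_on hpi (hFc.norm.intervalIntegrable _ _)
      (Continuous.intervalIntegrable (by fun_prop) _ _)
    intro θ _
    exact ptwise (hu _ (mem_ball_ee h0 h1 θ))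
  rw [intervalIntegral.integral_add (Continuous.intervalIntegrable (by fun_prop) _ _)
    (Continuous.intervalIntegrable (by fun_prop) _ _),
    intervalIntegral.integral_add (Continuous.intervalIntegrable (by fun_prop) _ _)
    (Continuous.intervalIntegrable (by fun_prop) _ _), intervalIntegral.integral_const_mul,
    intervalIntegral.integral_const_mul, intervalIntegral.integral_const] at h6
  have h7 := int_ulogu hm hp hl hl2 hg h0 h1
  simp only [smul_eq_mul] at h6
  linarith

end HT

namespace HT
open Real Topology InnerProductSpace

lemma weak_lim {E : Type*} [NormedAddCommGroup E] [InnerProductSpace ℂ E] [CompleteSpace E]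
    (u : ℕ → E) (R : ℝ) (hu : ∀ n, ‖u n‖ ≤ R) :
    ∃ w : E, ‖w‖ ≤ R ∧ ∀ h : E, Tendsto (fun n => inner ℂ (u n) h)
      (hyperfilter ℕ : Filter ℕ) (𝓝 (inner ℂ w h)) := by
  have hc := WeakDual.isCompact_closedBall (𝕜 := ℂ) (E := E) 0 R
  let L : ℕ → WeakDual ℂ E := fun n => StrongDual.toWeakDual (toDual ℂ E (u n))
  obtain ⟨Λ, hΛ, hl⟩ := hc.ultrafilter_le_nhds' ((hyperfilter ℕ).map L) (by
    rw [Ultrafilter.mem_map]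
    refine Filter.univ_mem' fun n => ?_
    simp only [L, mem_preimage, Metric.mem_closedBall, dist_zero_right]
    simpa using hu n)
  refine ⟨(toDual ℂ E).symm (WeakDual.toStrongDual Λ), ?_, fun h => ?_⟩
  · simpa using hΛ
  · rw [toDual_symm_apply]
    have h1 : Tendsto L (hyperfilter ℕ : Filter ℕ) (𝓝 Λ) := hl
    have h2 := (WeakDual.eval_continuous (𝕜 := ℂ) h).tendsto Λ
    exact h2.comp h1

abbrev mu0 : Measure ℝ := volume.restrict (Ioc (-π) π)

lemma memLp_cont {h : ℝ → ℂ} (hh : Continuous h) : MemLp h 2 mu0 := by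
  obtain ⟨C, hC⟩ := (isCompact_Icc (a := -π) (b := π)).exists_bound_of_continuousOn hh.continuousOn
  refine MemLp.of_bound hh.aestronglyMeasurable C ?_
  filter_upwards [ae_restrict_mem measurableSet_Ioc] with x hx
  exact hC x ⟨hx.1.le, hx.2⟩

lemma norm_toLp_cont {h : ℝ → ℂ} (hh : Continuous h) :
    ‖(memLp_cont hh).toLp h‖ ^ 2 = ∫ θ in (-π)..π, ‖h θ‖ ^ 2 := by
  have := inner_self_eq_norm_sq_to_K (𝕜 := ℂ) ((memLp_cont hh).toLp h)
  rw [L2.inner_def] at this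
  have h2 : (∫ a, inner ℂ (((memLp_cont hh).toLp h) a) (((memLp_cont hh).toLp h) a) ∂mu0)
      = ((∫ θ in (-π)..π, ‖h θ‖ ^ 2 : ℝ) : ℂ) := by
    rw [intervalIntegral.integral_of_le (by linarith [pi_pos]), ← integral_complex_ofReal]
    refine integral_congr_ae ?_
    filter_upwards [(memLp_cont hh).coeFn_toLp] with x hx
    rw [hx, inner_self_eq_norm_sq_to_K]; simp
  rw [h2] at this
  exact Complex.ofReal_injective (by rw [this]; simp)

lemma lint_sq (w : Lp ℂ 2 mu0) : ∫⁻ x, ‖w x‖ₑ ^ 2 ∂mu0 = ENNReal.ofReal (‖w‖ ^ 2) := by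
  have := Lp.norm_def w
  rw [ENNReal.ofReal_pow (norm_nonneg _), this, ENNReal.ofReal_toReal (Lp.eLpNorm_ne_top w),
    eLpNorm_eq_lintegral_rpow_enorm_toReal (by norm_num) (by norm_num)]
  rw [← ENNReal.rpow_natCast, ← ENNReal.rpow_mul]
  simp

lemma poisson_dil {S : ℂ → ℂ} (hS : DifferentiableOn ℂ S (Metric.ball 0 1)) {s : ℝ} (hs0 : 0 ≤ s)
    (hs1 : s < 1) {r : ℝ} (h0 : 0 ≤ r) (h1 : r < 1) (θ : ℝ) :
    S (s * (r * ee θ)) = (2 * π)⁻¹ • ∫ t in (-π)..π, Pk r (t - θ) • S (s * ee t) := by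
  have hd : DiffContOnCl ℂ (fun z => S (s * z)) (Metric.ball 0 1) := by
    apply DifferentiableOn.diffContOnCl
    refine hS.comp (by fun_prop) ?_
    intro z hz
    have hz' := Metric.closure_ball_subset_closedBall hz
    simp only [mem_closedBall_zero_iff, mem_ball_zero_iff, norm_mul, Complex.norm_real,
      Real.norm_eq_abs, abs_of_nonneg hs0] at hz' ⊢
    nlinarith
  rw [poisson_formula hd h0 h1 θ]
  congr 1
  have hp : Function.Periodic (fun t => Pk r (t - θ) • S (s * ee t)) (2 * π) := by
    intro t
    simp only [ee_periodic t]
    rw [show t + 2 * π - θ = t - θ + 2 * π by ring, Pk_periodic r]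
  rw [← shift_int' hp θ]
  simp

lemma weak_poisson {S : ℂ → ℂ} (hS : DifferentiableOn ℂ S (Metric.ball 0 1)) {M : ℝ}
    (hM : ∀ r : ℝ, 0 ≤ r → r < 1 → ∫ θ in (-π)..π, ‖S (r * ee θ)‖ ^ 2 ≤ M) :
    ∃ s : ℝ → ℂ, Measurable s ∧ Function.Periodic s (2 * π) ∧
      (∫⁻ x in Ioc (-π) π, ‖s x‖ₑ ^ 2 ≤ ENNReal.ofReal M) ∧
      ∀ r : ℝ, 0 ≤ r → r < 1 → ∀ θ : ℝ,
        S (r * ee θ) = (2 * π)⁻¹ • ∫ v in (-π)..π, Pk r v • s (θ + v) := by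
  have hpi := pi_pos
  let q : ℕ → ℝ := fun n => 1 - 1 / ((n : ℝ) + 1)
  have hq0 : ∀ n, 0 ≤ q n := fun n => by
    have : 1 / ((n : ℝ) + 1) ≤ 1 := by
      rw [div_le_one (by positivity)]; linarith [Nat.cast_nonneg (α := ℝ) n]
    simp only [q]; linarith
  have hq1 : ∀ n, q n < 1 := fun n => by
    have : 0 < 1 / ((n : ℝ) + 1) := by positivity
    simp only [q]; linarith
  have hql : Tendsto q atTop (𝓝 1) := by
    simpa [q] using (tendsto_const_nhds (x := (1:ℝ))).sub tendsto_one_div_add_atTop_nhds_zero_nat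
  have hM0 : 0 ≤ M := (intervalIntegral.integral_nonneg (by linarith)
    (fun x _ => by positivity)).trans (hM 0 le_rfl one_pos)
  have hc : ∀ n, Continuous (fun t => S (q n * ee t)) := fun n => cont_FF hS (hq0 n) (hq1 n)
  let u : ℕ → Lp ℂ 2 mu0 := fun n => (memLp_cont (hc n)).toLp _
  have hu : ∀ n, ‖u n‖ ≤ √M := fun n => by
    apply Real.le_sqrt_of_sq_le
    rw [norm_toLp_cont (hc n)]
    exact hM _ (hq0 n) (hq1 n)
  obtain ⟨w, hw, hlim⟩ := weak_lim u (√M) hu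
  -- measurable representative
  have hwm := (Lp.stronglyMeasurable w).measurable
  let s : ℝ → ℂ := fun t => w (Complex.arg (Complex.exp (t * Complex.I)))
  have hs_eq : ∀ t ∈ Ioc (-π) π, s t = w t := fun t ht => by
    simp only [s]
    rw [Complex.arg_exp_mul_I, (toIocMod_eq_self Real.two_pi_pos).2]
    rw [show -π + 2 * π = π by ring]; exact ht
  have hsp : Function.Periodic s (2 * π) := fun t => by
    have := ee_periodic t
    unfold ee at this
    simp only [s, this]
  have hsm : Measurable s := hwm.comp (by fun_prop)
  refine ⟨s, hsm, hsp, ?_, ?_⟩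
  · rw [setLIntegral_congr_fun measurableSet_Ioc (g := fun x => ‖w x‖ₑ ^ 2)
      (fun x hx => by simp only [hs_eq x hx]), lint_sq]
    apply ENNReal.ofReal_le_ofReal
    calc ‖w‖ ^ 2 ≤ (√M) ^ 2 := by gcongr
      _ = M := Real.sq_sqrt hM0
  · intro r h0 h1 θ
    have hk : Continuous (fun t => ((Pk r (t - θ) : ℝ) : ℂ)) :=
      Complex.continuous_ofReal.comp ((continuous_Pk h0 h1).comp (by fun_prop))
    let h : Lp ℂ 2 mu0 := (memLp_cont hk).toLp _
    have e1 : ∀ n, inner ℂ h (u n) = (2 * π : ℝ) • S (q n * (r * ee θ)) := fun n => by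
      rw [poisson_dil hS (hq0 n) (hq1 n) h0 h1 θ, smul_smul, mul_inv_cancel₀ (by positivity),
        one_smul, intervalIntegral.integral_of_le (by linarith), L2.inner_def]
      refine integral_congr_ae ?_
      filter_upwards [(memLp_cont (hc n)).coeFn_toLp, (memLp_cont hk).coeFn_toLp] with x hx hx2
      simp only [u, h]
      rw [hx, hx2]
      simp [mul_comm]
    have e2 : inner ℂ h w = ∫ v in (-π)..π, Pk r v • s (θ + v) := by
      have hp : Function.Periodic (fun t => Pk r (t - θ) • s t) (2 * π) := by
        intro t
        simp only [hsp t]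
        rw [show t + 2 * π - θ = t - θ + 2 * π by ring, Pk_periodic r]
      have e3 := shift_int' hp θ
      simp only [add_sub_cancel_left] at e3
      rw [e3, intervalIntegral.integral_of_le (by linarith), L2.inner_def]
      refine integral_congr_ae ?_
      filter_upwards [(memLp_cont hk).coeFn_toLp, ae_restrict_mem measurableSet_Ioc] with x hx hx2
      simp only [h]
      rw [hx, hs_eq x hx2]
      simp [mul_comm]
    have l1 : Tendsto (fun n => inner ℂ h (u n)) (hyperfilter ℕ : Filter ℕ) (𝓝 (inner ℂ h w)) := by
      have := (Complex.continuous_conj.tendsto _).comp (hlim h)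
      simpa only [Function.comp_def, inner_conj_symm] using this
    have l2 : Tendsto (fun n => inner ℂ h (u n)) (hyperfilter ℕ : Filter ℕ)
        (𝓝 ((2 * π : ℝ) • S (r * ee θ))) := by
      simp only [e1]
      have hcont : ContinuousAt S (r * ee θ) :=
        (hS.differentiableAt (Metric.isOpen_ball.mem_nhds (mem_ball_ee h0 h1 θ))).continuousAt
      have hz : Tendsto (fun n => (q n : ℂ) * (r * ee θ)) (hyperfilter ℕ : Filter ℕ)
          (𝓝 (r * ee θ)) := by
        have : Tendsto (fun n => (q n : ℂ)) (hyperfilter ℕ : Filter ℕ) (𝓝 ((1:ℝ) : ℂ)) :=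
          (Complex.continuous_ofReal.tendsto _).comp (hql.mono_left Nat.hyperfilter_le_atTop)
        simpa using this.mul_const (r * ee θ)
      exact (hcont.tendsto.comp hz).const_smul _
    have := tendsto_nhds_unique l1 l2
    rw [← e2, this, smul_smul, inv_mul_cancel₀ (by positivity), one_smul]

end HT

namespace HT
open Real Topology

lemma li_of_periodic {E : Type*} [NormedAddCommGroup E] {h : ℝ → E}
    (hp : Function.Periodic h (2 * π)) (hi : IntegrableOn h (Ioc (-π) π)) :
    LocallyIntegrable h := by
  have h1 : IntervalIntegrable h volume (-π) (-π + 2 * π) := by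
    rw [show -π + 2 * π = π by ring,
      intervalIntegrable_iff_integrableOn_Ioc_of_le (by linarith [pi_pos])]
    exact hi
  have h2 := hp.intervalIntegrable (by positivity) h1
  rw [locallyIntegrable_iff]
  intro k hk
  obtain ⟨R, hR⟩ := hk.isBounded.subset_closedBall 0
  rw [Real.closedBall_eq_Icc] at hR
  refine IntegrableOn.mono_set ?_ (hR.trans (Icc_subset_uIcc))
  rw [← intervalIntegrable_iff']
  exact h2 _ _

lemma Rk_meas (ε : ℝ) : Measurable (Rk ε) := by
  unfold Rk Qk Dk
  refine Measurable.sub (Measurable.ite ?_ ?_ measurable_const) (by fun_prop)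
  · exact measurableSet_lt measurable_const (by fun_prop)
  · simp only [tan_eq_sin_div_cos]; fun_prop

lemma Rk_bdd {ε v : ℝ} (h : 0 < ε) (h2 : ε ≤ 1 / 2) (hv : |v| < π) : |Rk ε v| ≤ 16 / ε := by
  refine (Rk_le h h2 hv).trans ?_
  unfold kk
  rw [mul_div_assoc']
  rw [div_le_div_iff₀ (by positivity) h]
  nlinarith [sq_nonneg v]

lemma Rk_int_mul {ε : ℝ} (h : 0 < ε) (h2 : ε ≤ 1 / 2) {k : ℝ → ℝ}
    (hk : IntegrableOn k (Ioo (-π) π)) : IntegrableOn (fun v => Rk ε v * k v) (Ioo (-π) π) := by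
  refine Integrable.bdd_mul (c := 16 / ε) hk (Rk_meas ε).aestronglyMeasurable ?_
  filter_upwards [ae_restrict_mem measurableSet_Ioo] with x hx
  exact Rk_bdd h h2 (abs_lt.2 hx)

lemma Rk_int_zero (ε : ℝ) : ∫ v in Ioo (-π) π, Rk ε v = 0 := by
  rw [← integral_Ioc_eq_integral_Ioo, ← intervalIntegral.integral_of_le (by linarith [pi_pos])]
  have := intervalIntegral.integral_comp_neg (a := -π) (b := π) (Rk ε)
  simp only [Rk_neg, neg_neg, intervalIntegral.integral_neg] at this
  linarith

def trK (φ : ℝ → ℝ) (ε : ℝ) : ℝ :=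
  ∫ v in {t : ℝ | ε < |t| ∧ |t| < π}, (1 / π) * (φ v / (2 * tan (v / 2)))

lemma meas_tr (ε : ℝ) : MeasurableSet {t : ℝ | ε < |t| ∧ |t| < π} :=
  (measurableSet_lt (g := fun t : ℝ => |t|) measurable_const (by fun_prop)).inter
    (measurableSet_lt (f := fun t : ℝ => |t|) (by fun_prop) measurable_const)

lemma trK_eq {φ : ℝ → ℝ} (hφ : IntegrableOn φ (Ioo (-π) π)) {ε : ℝ} (h : 0 < ε) (h2 : ε ≤ 1 / 2)
    (c : ℝ) : trK φ ε = (2 * π)⁻¹ * ((∫ v in Ioo (-π) π, Rk ε v • (φ v - c))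
      + ∫ v in (-π)..π, Qk (1 - ε) v * φ v) := by
  have hq : IntegrableOn (fun v => Qk (1 - ε) v * φ v) (Ioo (-π) π) := by
    obtain ⟨C, hC⟩ := (isCompact_Icc (a := -π) (b := π)).exists_bound_of_continuousOn
      (continuous_Qk (r := 1 - ε) (by linarith) (by linarith)).continuousOn
    refine Integrable.bdd_mul (c := C) hφ
      (continuous_Qk (r := 1 - ε) (by linarith) (by linarith)).aestronglyMeasurable ?_
    filter_upwards [ae_restrict_mem measurableSet_Ioo] with x hx
    exact hC x ⟨hx.1.le, hx.2.le⟩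
  have hc : IntegrableOn (fun _ : ℝ => c) (Ioo (-π) π) := by
    simp
  have e1 : ∫ v in Ioo (-π) π, Rk ε v • (φ v - c) = ∫ v in Ioo (-π) π, Rk ε v * φ v := by
    simp only [smul_eq_mul, mul_sub]
    rw [integral_sub (Rk_int_mul h h2 hφ) (Rk_int_mul h h2 hc), integral_mul_const, Rk_int_zero]
    simp
  rw [e1, intervalIntegral.integral_of_le (by linarith [pi_pos]), integral_Ioc_eq_integral_Ioo,
    ← integral_add (Rk_int_mul h h2 hφ) hq, ← integral_const_mul, trK,
    ← integral_indicator (meas_tr ε), ← integral_indicator measurableSet_Ioo]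
  congr 1
  ext v
  by_cases hv : |v| < π
  · have hv' : v ∈ Ioo (-π) π := abs_lt.1 hv
    rw [indicator_of_mem hv']
    by_cases hε : ε < |v|
    · rw [indicator_of_mem (show v ∈ {t : ℝ | ε < |t| ∧ |t| < π} from ⟨hε, hv⟩)]
      simp only [Rk, if_pos hε]
      simp only [div_eq_mul_inv, mul_inv]; ring
    · rw [indicator_of_notMem (fun hh => hε hh.1)]
      simp only [Rk, if_neg hε]; ring
  · rw [indicator_of_notMem (fun hh => hv hh.2), 
      indicator_of_notMem (fun hh : v ∈ Ioo (-π) π => hv (abs_lt.2 hh))]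

lemma sqrt_FF {F : ℂ → ℂ} (hF : DifferentiableOn ℂ F (Metric.ball 0 1))
    (h1 : ∀ z ∈ Metric.ball (0 : ℂ) 1, 1 ≤ (F z).re) :
    ∃ S : ℂ → ℂ, DifferentiableOn ℂ S (Metric.ball 0 1) ∧
      ∀ z ∈ Metric.ball (0 : ℂ) 1, S z ^ 2 = F z := by
  refine ⟨fun z => Complex.exp (Complex.log (F z) / 2), ?_, ?_⟩
  · refine DifferentiableOn.cexp (DifferentiableOn.div_const (hF.clog ?_) _)
    intro z hz
    exact Or.inl (by linarith [h1 z hz])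
  · intro z hz
    rw [← Complex.exp_nat_mul]
    push_cast
    rw [mul_div_cancel₀ _ (by norm_num : (2:ℂ) ≠ 0), Complex.exp_log]
    intro h0
    have := h1 z hz
    rw [h0] at this; norm_num at this

lemma oneD {g : ℝ → ℝ} (hm : Measurable g) (hp : Function.Periodic g (2 * π))
    (hl : LocallyIntegrable g) (hl2 : LocallyIntegrable (fun x => g x * log (g x)))
    (hg : ∀ x, 1 ≤ g x) :
    ∃ B : ℝ → ℝ, Measurable B ∧ (∀ᵐ x, Tendsto (trK (fun v => g (x + v))) (𝓝[>] 0) (𝓝 (B x))) ∧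
      ∫⁻ x in Ioc (-π) π, ENNReal.ofReal |B x|
        ≤ ENNReal.ofReal (4 * (∫ θ in (-π)..π, g θ * log (g θ)) + 4 * π) := by
  have hpi := pi_pos
  obtain ⟨S, hS, hSF⟩ := sqrt_FF (FF_diff hp hl) (fun z hz => one_le_FF_re hp hl hg hz)
  have hnorm : ∀ r : ℝ, 0 ≤ r → r < 1 → ∫ θ in (-π)..π, ‖S (r * ee θ)‖ ^ 2
      ≤ 4 * (∫ θ in (-π)..π, g θ * log (g θ)) + 4 * π := by
    intro r h0 h1
    refine le_trans (le_of_eq ?_) (int_norm_FF hm hp hl hl2 hg h0 h1)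
    congr 1; ext θ
    rw [← norm_pow, hSF _ (mem_ball_ee h0 h1 θ)]
  obtain ⟨s, hsm, hsp, hsM, hsP⟩ := weak_poisson hS hnorm
  have hsl : LocallyIntegrable s := by
    refine li_of_periodic hsp ?_
    have : MemLp s 2 (volume.restrict (Ioc (-π) π)) := by
      refine ⟨hsm.aestronglyMeasurable, ?_⟩
      rw [eLpNorm_lt_top_iff_lintegral_rpow_enorm_lt_top (by norm_num) (by norm_num)]
      refine lt_of_le_of_lt ?_ (lt_of_le_of_lt hsM ENNReal.ofReal_lt_top)
      simp
    exact this.integrable (by norm_num)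
  have hsmall : ∀ᶠ ε in 𝓝[>] (0 : ℝ), 0 < ε ∧ ε ≤ 1 / 2 := by
    filter_upwards [Ioc_mem_nhdsGT (show (0:ℝ) < 1 / 2 by norm_num)] with ε hε using hε
  refine ⟨fun x => -((s x) ^ 2).im, by fun_prop, ?_, ?_⟩
  · filter_upwards [ae_leb hsl, ae_leb hl] with x hx1 hx2
    have k1 := conv_kernel hsl hx1 (K := fun ε v => Pk (1 - ε) v) (by
      filter_upwards [hsmall] with ε hε v hv using Pk_le hε.1 hε.2 hv.le)
    have k2 := conv_kernel hl hx2 (K := Rk) (by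
      filter_upwards [hsmall] with ε hε v hv using Rk_le hε.1 hε.2 hv)
    have k3 : Tendsto (fun ε : ℝ => S (((1 - ε : ℝ) : ℂ) * ee x)) (𝓝[>] 0) (𝓝 (s x)) := by
      have := (k1.const_smul ((2 * π)⁻¹)).add_const (s x)
      rw [smul_zero, zero_add] at this
      refine this.congr' ?_
      filter_upwards [hsmall] with ε hε
      rw [hsP _ (by linarith) (by linarith [hε.1]) x]
      have hcP := continuous_Pk (r := 1 - ε) (by linarith) (by linarith [hε.1])
      have i1 : IntervalIntegrable (fun v => Pk (1 - ε) v • s (x + v)) volume (-π) π :=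
        IntervalIntegrable.continuousOn_smul (li_ii (locInt_shift hsl x) _ _) hcP.continuousOn
      have i2 : IntervalIntegrable (fun v => Pk (1 - ε) v • s x) volume (-π) π :=
        (hcP.smul continuous_const).intervalIntegrable _ _
      rw [← integral_Ioc_eq_integral_Ioo, ← intervalIntegral.integral_of_le (by linarith)]
      simp only [smul_sub]
      rw [intervalIntegral.integral_sub i1 i2, intervalIntegral.integral_smul_const,
        int_Pk (by linarith) (by linarith [hε.1]), smul_sub, smul_smul,
        inv_mul_cancel₀ (by positivity), one_smul]
      abel
    have k4 : Tendsto (fun ε : ℝ => (FF g (((1 - ε : ℝ) : ℂ) * ee x)).im) (𝓝[>] 0)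
        (𝓝 ((s x) ^ 2).im) := by
      refine ((Complex.continuous_im.tendsto _).comp (k3.pow 2)).congr' ?_
      filter_upwards [hsmall] with ε hε
      simp only [Function.comp]
      rw [hSF _ (mem_ball_ee (by linarith) (by linarith [hε.1]) x)]
    have k5 := (k2.const_mul ((2 * π)⁻¹)).sub k4
    rw [mul_zero, zero_sub] at k5
    refine k5.congr' ?_
    filter_upwards [hsmall] with ε hε
    rw [trK_eq ?_ hε.1 hε.2 (g x), FF_im hp hl (by linarith) (by linarith [hε.1])]
    · ring
    · have := (li_ii (locInt_shift hl x) (-π) π)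
      rw [intervalIntegrable_iff_integrableOn_Ioo_of_le (by linarith)] at this
      exact this
  · refine le_trans (lintegral_mono fun x => ?_) hsM
    rw [← ofReal_norm, ← ENNReal.ofReal_pow (norm_nonneg _)]
    apply ENNReal.ofReal_le_ofReal
    rw [abs_neg, ← norm_pow]
    exact Complex.abs_im_le_norm _

end HT

namespace HT
open Real Topology

lemma trK_integrable {φ : ℝ → ℝ} (hφ : IntegrableOn φ (Ioo (-π) π)) {ε : ℝ} (h : 0 < ε)
    (h2 : ε ≤ 1 / 2) : IntegrableOn (fun v => (1 / π) * (φ v / (2 * tan (v / 2))))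
      {t : ℝ | ε < |t| ∧ |t| < π} := by
  have hsub : {t : ℝ | ε < |t| ∧ |t| < π} ⊆ Ioo (-π) π := fun t ht => abs_lt.1 ht.2
  obtain ⟨C, hC⟩ := (isCompact_Icc (a := -π) (b := π)).exists_bound_of_continuousOn
      (continuous_Qk (r := 1 - ε) (by linarith) (by linarith)).continuousOn
  have hk : Measurable (fun v : ℝ => (2 * π)⁻¹ * (1 / tan (v / 2))) := by
    simp only [tan_eq_sin_div_cos]; fun_prop
  have := Integrable.bdd_mul (c := (2 * π)⁻¹ * (16 / ε + C)) (hφ.mono_set hsub)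
    hk.aestronglyMeasurable (by
      filter_upwards [ae_restrict_mem (meas_tr ε)] with v hv
      have h1 := Rk_bdd h h2 hv.2
      have h3 := hC v ⟨(hsub hv).1.le, (hsub hv).2.le⟩
      rw [norm_mul, Real.norm_eq_abs, abs_of_pos (by positivity : 0 < (2 * π)⁻¹)]
      gcongr
      have e : 1 / tan (v / 2) = Rk ε v + Qk (1 - ε) v := by
        rw [Rk, if_pos hv.1]; ring
      rw [e]
      exact (norm_add_le _ _).trans (add_le_add h1 h3))
  refine this.congr (Eventually.of_forall fun v => ?_)
  simp only [div_eq_mul_inv, mul_inv]; ring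

lemma trK_sub {φ ψ : ℝ → ℝ} (hφ : IntegrableOn φ (Ioo (-π) π)) (hψ : IntegrableOn ψ (Ioo (-π) π))
    {ε : ℝ} (h : 0 < ε) (h2 : ε ≤ 1 / 2) :
    trK (fun v => φ v - ψ v) ε = trK φ ε - trK ψ ε := by
  unfold trK
  rw [← integral_sub (trK_integrable hφ h h2) (trK_integrable hψ h h2)]
  congr 1; ext v; ring

lemma trK_right_cont {φ : ℝ → ℝ} (hφ : IntegrableOn φ (Ioo (-π) π)) {ε : ℝ} (h : 0 < ε)
    (h2 : ε ≤ 1 / 2) : Tendsto (trK φ) (𝓝[>] ε) (𝓝 (trK φ ε)) := by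
  have hi := trK_integrable hφ h h2
  have e : ∀ δ, trK φ δ = ∫ v, {t : ℝ | δ < |t| ∧ |t| < π}.indicator
      (fun v => (1 / π) * (φ v / (2 * tan (v / 2)))) v := fun δ => by
    rw [trK, integral_indicator (meas_tr δ)]
  rw [e ε, show trK φ = fun δ => ∫ v, {t : ℝ | δ < |t| ∧ |t| < π}.indicator
      (fun v => (1 / π) * (φ v / (2 * tan (v / 2)))) v from funext e]
  rw [← integrable_indicator_iff (meas_tr ε)] at hi
  have hsub : ∀ δ, ε < δ → {t : ℝ | δ < |t| ∧ |t| < π} ⊆ {t : ℝ | ε < |t| ∧ |t| < π} :=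
    fun δ hδ t ht => ⟨hδ.trans ht.1, ht.2⟩
  refine tendsto_integral_filter_of_dominated_convergence _ ?_ ?_ hi.norm ?_
  · filter_upwards [self_mem_nhdsWithin] with δ hδ
    rw [← inter_eq_self_of_subset_left (hsub δ hδ), ← indicator_indicator]
    exact (hi.1.indicator (meas_tr δ))
  · filter_upwards [self_mem_nhdsWithin] with δ hδ
    refine Eventually.of_forall fun v => ?_
    exact norm_indicator_le_of_subset (hsub δ hδ) _ _
  · refine Eventually.of_forall fun v => ?_
    by_cases hv : ε < |v|
    · apply tendsto_const_nhds.congr'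
      filter_upwards [Ioo_mem_nhdsGT hv] with δ hδ
      by_cases hp : |v| < π
      · rw [indicator_of_mem (show v ∈ {t : ℝ | ε < |t| ∧ |t| < π} from ⟨hv, hp⟩),
          indicator_of_mem (show v ∈ {t : ℝ | δ < |t| ∧ |t| < π} from ⟨hδ.2, hp⟩)]
      · rw [indicator_of_notMem (fun hh => hp hh.2), indicator_of_notMem (fun hh => hp hh.2)]
    · apply tendsto_const_nhds.congr'
      filter_upwards [self_mem_nhdsWithin] with δ hδ
      rw [indicator_of_notMem (fun hh => hv hh.1),
        indicator_of_notMem (fun hh => hv ((lt_trans (mem_Ioi.1 hδ) hh.1)))]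

lemma rat_lim {F : ℝ → ℝ} (hF : ∀ ε : ℝ, 0 < ε → ε ≤ 1 / 2 → Tendsto F (𝓝[>] ε) (𝓝 (F ε)))
    {c : ℝ} (hc : Tendsto (fun q : ℚ => F q) (comap ((↑) : ℚ → ℝ) (𝓝[>] 0)) (𝓝 c)) :
    Tendsto F (𝓝[>] 0) (𝓝 c) := by
  rw [(closed_nhds_basis c).tendsto_right_iff]
  rintro V ⟨hV, hVc⟩
  have h1 := hc hV
  rw [mem_map, mem_comap] at h1
  obtain ⟨t, ht, hsub⟩ := h1
  obtain ⟨δ, hδ, hδt⟩ := mem_nhdsGT_iff_exists_Ioo_subset.1 ht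
  have hδ : 0 < δ := hδ
  filter_upwards [Ioo_mem_nhdsGT (lt_min hδ (by norm_num : (0:ℝ) < 1 / 2))] with ε hε
  refine hVc.mem_of_frequently_of_tendsto ?_ (hF ε hε.1 (hε.2.le.trans (min_le_right _ _)))
  rw [(nhdsGT_basis ε).frequently_iff]
  intro b hb
  obtain ⟨q, hq1, hq2⟩ := exists_rat_btwn (lt_min hb (hε.2.trans_le (min_le_left _ _)))
  refine ⟨q, ⟨hq1, hq2.trans_le (min_le_left _ _)⟩, ?_⟩
  exact hsub (hδt ⟨hε.1.trans hq1, hq2.trans_le (min_le_right _ _)⟩)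

lemma logPlus_nonneg (u : ℝ) : 0 ≤ logPlus u := by
  unfold logPlus
  split_ifs with h
  · exact log_nonneg h.le
  · exact le_rfl

lemma measurable_logPlus : Measurable logPlus := by
  unfold logPlus
  exact Measurable.ite (measurableSet_lt measurable_const measurable_id) measurable_log
    measurable_const

lemma ulogu_le {a u : ℝ} (ha : 0 ≤ a) (hau : a = 0 ∨ a = u) (hu : 0 ≤ u) :
    (a + 1) * log (a + 1) ≤ 6 + 4 * (u * logPlus u) := by
  have hpos := mul_nonneg hu (logPlus_nonneg u)
  rcases hau with rfl | rfl
  · simp; linarith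
  have hle : log (a + 1) ≤ a := by
    have := log_le_sub_one_of_pos (by linarith : 0 < a + 1); linarith
  by_cases h1 : 1 < a
  · have hl2 : log 2 ≤ 1 := by linarith [log_two_lt_d9]
    have h2 : log (a + 1) ≤ log 2 + log a := by
      rw [← log_mul (by norm_num) (by linarith)]
      exact log_le_log (by linarith) (by linarith)
    have hlog : 0 ≤ log a := log_nonneg h1.le
    have h3 : a ≤ 3 + a * log a := by
      by_cases h3 : a ≤ 3
      · nlinarith
      · have : 1 ≤ log a := by
          rw [le_log_iff_exp_le (by linarith)]
          linarith [exp_one_lt_d9]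
        nlinarith
    simp only [logPlus, if_pos h1]
    calc (a + 1) * log (a + 1) ≤ (2 * a) * (1 + log a) := by
          gcongr
          · exact log_nonneg (by linarith)
          · linarith
          · linarith
      _ ≤ _ := by nlinarith
  · have : (a + 1) * log (a + 1) ≤ 2 * 1 := by
      have h0 : 0 ≤ log (a + 1) := log_nonneg (by linarith)
      nlinarith
    linarith

lemma oneD_pos {φ a : ℝ → ℝ} (ham : Measurable a)
    (hap : Function.Periodic a (2 * π)) (ha : ∀ x, 0 ≤ a x) (hau : ∀ x, a x = 0 ∨ a x = |φ x|)
    (hi : IntegrableOn φ (Ioc (-π) π))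
    (hi2 : IntegrableOn (fun x => |φ x| * logPlus |φ x|) (Ioc (-π) π)) :
    LocallyIntegrable (fun x => a x + 1) ∧
    ∃ B : ℝ → ℝ, Measurable B ∧ (∀ᵐ x, Tendsto (trK (fun v => a (x + v) + 1)) (𝓝[>] 0) (𝓝 (B x))) ∧
      ∫⁻ x in Ioc (-π) π, ENNReal.ofReal |B x|
        ≤ ENNReal.ofReal (16 * (∫ x in Ioc (-π) π, |φ x| * logPlus |φ x|) + 52 * π) := by
  have hpi := pi_pos
  have hle : ∀ x, a x ≤ |φ x| := fun x => by
    rcases hau x with h | h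
    · rw [h]; positivity
    · exact h.le
  have hfin : volume (Ioc (-π) π) ≠ ⊤ := measure_Ioc_lt_top.ne
  have hgp : Function.Periodic (fun x => a x + 1) (2 * π) := fun x => by simp only [hap x]
  have hgm : Measurable (fun x => a x + 1) := by fun_prop
  have hai : IntegrableOn a (Ioc (-π) π) := by
    refine Integrable.mono' hi.abs ham.aestronglyMeasurable (Eventually.of_forall fun x => ?_)
    rw [Real.norm_eq_abs, abs_of_nonneg (ha x)]; exact hle x
  have hgl : LocallyIntegrable (fun x => a x + 1) :=
    li_of_periodic hgp (hai.add (integrableOn_const hfin))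
  have hbound : ∀ x, (a x + 1) * log (a x + 1) ≤ 6 + 4 * (|φ x| * logPlus |φ x|) :=
    fun x => ulogu_le (ha x) (hau x) (abs_nonneg _)
  have hnn : ∀ x, 0 ≤ (a x + 1) * log (a x + 1) := fun x =>
    mul_nonneg (by linarith [ha x]) (log_nonneg (by linarith [ha x]))
  have hbi : IntegrableOn (fun x => 6 + 4 * (|φ x| * logPlus |φ x|)) (Ioc (-π) π) :=
    (integrableOn_const hfin).add (hi2.const_mul 4)
  have hgi : IntegrableOn (fun x => (a x + 1) * log (a x + 1)) (Ioc (-π) π) := by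
    refine Integrable.mono' hbi
      ((hgm.mul (measurable_log.comp hgm)).aestronglyMeasurable) (Eventually.of_forall fun x => ?_)
    rw [Real.norm_eq_abs, abs_of_nonneg (hnn x)]; exact hbound x
  have hgl2 : LocallyIntegrable (fun x => (a x + 1) * log (a x + 1)) :=
    li_of_periodic (fun x => by simp only [hap x]) hgi
  obtain ⟨B, hBm, hB1, hB2⟩ := oneD hgm hgp hgl hgl2 (fun x => by linarith [ha x])
  refine ⟨hgl, B, hBm, hB1, hB2.trans (ENNReal.ofReal_le_ofReal ?_)⟩
  rw [intervalIntegral.integral_of_le (by linarith)]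
  have := integral_mono hgi hbi hbound
  have hc6 : Integrable (fun _ : ℝ => (6 : ℝ)) (volume.restrict (Ioc (-π) π)) :=
    integrableOn_const hfin
  rw [integral_add hc6 (hi2.const_mul 4), integral_const_mul] at this
  simp only [integral_const, measureReal_restrict_apply_univ, Real.volume_real_Ioc_of_le
    (by linarith : -π ≤ π), smul_eq_mul] at this
  linarith

lemma oneD_signed {φ : ℝ → ℝ} (hm : Measurable φ) (hp : Function.Periodic φ (2 * π))
    (hi : IntegrableOn φ (Ioc (-π) π))
    (hi2 : IntegrableOn (fun x => |φ x| * logPlus |φ x|) (Ioc (-π) π)) :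
    ∃ B : ℝ → ℝ, (∀ᵐ x, Tendsto (trK (fun v => φ (x + v))) (𝓝[>] 0) (𝓝 (B x))) ∧
      ∫⁻ x in Ioc (-π) π, ENNReal.ofReal |B x|
        ≤ ENNReal.ofReal (32 * (∫ x in Ioc (-π) π, |φ x| * logPlus |φ x|) + 104 * π) := by
  have hpi := pi_pos
  obtain ⟨l1, B1, m1, h1, hb1⟩ := oneD_pos (a := fun x => max (φ x) 0) (by fun_prop)
    (fun x => by simp only [hp x]) (fun x => le_max_right _ _) (fun x => by
      rcases le_total (φ x) 0 with h | h
      · left; simp [h]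
      · right; simp [h, abs_of_nonneg]) hi hi2
  obtain ⟨l2, B2, m2, h2, hb2⟩ := oneD_pos (a := fun x => max (-φ x) 0) (by fun_prop)
    (fun x => by simp only [hp x]) (fun x => le_max_right _ _) (fun x => by
      rcases le_total (φ x) 0 with h | h
      · right; simp [h, abs_of_nonpos]
      · left; simp [h]) hi hi2
  have hshift : ∀ {h : ℝ → ℝ} (_ : LocallyIntegrable h) (x : ℝ),
      IntegrableOn (fun v => h (x + v)) (Ioo (-π) π) := fun hl x => by
    have := (li_ii (locInt_shift hl x) (-π) π)
    rw [intervalIntegrable_iff_integrableOn_Ioo_of_le (by linarith)] at this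
    exact this
  refine ⟨fun x => B1 x - B2 x, ?_, ?_⟩
  · filter_upwards [h1, h2] with x hx1 hx2
    refine (hx1.sub hx2).congr' ?_
    filter_upwards [Ioc_mem_nhdsGT (show (0:ℝ) < 1 / 2 by norm_num)] with ε hε
    rw [← trK_sub (hshift l1 x) (hshift l2 x) hε.1 hε.2]
    congr 1; ext v
    rcases le_total (φ (x + v)) 0 with h | h
    · simp [h]
    · simp [h]
  · have hJ : 0 ≤ ∫ x in Ioc (-π) π, |φ x| * logPlus |φ x| :=
      integral_nonneg fun x => mul_nonneg (abs_nonneg _) (logPlus_nonneg _)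
    calc ∫⁻ x in Ioc (-π) π, ENNReal.ofReal |B1 x - B2 x|
        ≤ ∫⁻ x in Ioc (-π) π, (ENNReal.ofReal |B1 x| + ENNReal.ofReal |B2 x|) := by
          refine lintegral_mono fun x => ?_
          rw [← ENNReal.ofReal_add (abs_nonneg _) (abs_nonneg _)]
          exact ENNReal.ofReal_le_ofReal (abs_sub _ _)
      _ = _ := lintegral_add_left (by fun_prop) _
      _ ≤ _ := add_le_add hb1 hb2
      _ = _ := by
        rw [← ENNReal.ofReal_add (by positivity) (by positivity)]
        congr 1; ring

lemma shear {h : ℝ × ℝ → ENNReal} (hm : Measurable h)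
    (hp : ∀ x y, h (x, y + 2 * π) = h (x, y)) :
    ∫⁻ p in T2, h p = ∫⁻ t in Ioc (-π) π, ∫⁻ x in Ioc (-π) π, h (x, x + t) := by
  have e : (volume : Measure (ℝ × ℝ)).restrict T2
      = (volume.restrict (Ioc (-π) π)).prod (volume.restrict (Ioc (-π) π)) := by
    rw [T2, T1, Measure.volume_eq_prod, ← Measure.prod_restrict,
      restrict_Ico_eq_restrict_Ioc]
  rw [e, lintegral_prod _ hm.aemeasurable,
    lintegral_lintegral_swap (f := fun t x => h (x, x + t))
      (Measurable.aemeasurable (hm.comp (by fun_prop)))]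
  refine lintegral_congr fun x => ?_
  exact (lint_shift (h := fun y => h (x, y)) (by fun_prop) (fun y => hp x y) x).symm

lemma ae_periodic {Q : ℝ → Prop} (hQ : ∀ t, Q (t + 2 * π) ↔ Q t)
    (h : ∀ᵐ t ∂(volume.restrict (Ioc (-π) π)), Q t) : ∀ᵐ t, Q t := by
  have hd := isAddFundamentalDomain_Ioc (T := 2 * π) (by positivity) (-π)
  rw [show -π + 2 * π = π by ring] at hd
  have hper : Function.Periodic Q (2 * π) := fun t => propext (hQ t)
  refine hd.measure_zero_of_invariant {t | ¬ Q t} ?_ ?_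
  · rintro ⟨g, hg⟩
    obtain ⟨k, rfl⟩ := AddSubgroup.mem_zmultiples_iff.1 hg
    ext t
    rw [Set.mem_vadd_set_iff_neg_vadd_mem]
    simp only [mem_ofPred_eq]
    have : (-(⟨k • (2 * π), hg⟩ : AddSubgroup.zmultiples (2 * π))) +ᵥ t = t - k • (2 * π) := by
      rw [AddSubgroup.vadd_def]; simp; ring
    rw [this, hper.sub_zsmul_eq]
  · rw [ae_restrict_iff' measurableSet_Ioc, ae_iff] at h
    convert h using 2
    ext t; simp; tauto

end HT

namespace HT
open Real Topology

lemma slice_integrable {F : ℝ × ℝ → ℝ} (hm : Measurable F) (hb : Biperiodic F)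
    (hi : IntegrableOn F T2) :
    ∀ᵐ t, IntegrableOn (fun x => F (x, x + t)) (Ioc (-π) π) := by
  have h1 := shear (h := fun p => ‖F p‖ₑ) (by fun_prop) (fun x y => by simp only [(hb x y).2])
  have h2 : ∫⁻ t in Ioc (-π) π, ∫⁻ x in Ioc (-π) π, ‖F (x, x + t)‖ₑ ≠ ⊤ := by
    rw [← h1]; exact hi.2.ne
  have hmm : Measurable fun t => ∫⁻ x in Ioc (-π) π, ‖F (x, x + t)‖ₑ :=
    Measurable.lintegral_prod_right' (f := fun q : ℝ × ℝ => ‖F (q.2, q.2 + q.1)‖ₑ)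
      (hm.comp (f := fun q : ℝ × ℝ => (q.2, q.2 + q.1)) (by fun_prop)).enorm
  refine ae_periodic (fun t => ?_) ?_
  · have : (fun x => F (x, x + (t + 2 * π))) = fun x => F (x, x + t) := by
      ext x; rw [← add_assoc, (hb _ _).2]
    rw [this]
  · filter_upwards [ae_lt_top hmm h2] with t ht
    exact ⟨(hm.comp (by fun_prop)).aestronglyMeasurable, ht⟩

lemma trK_meas {f : ℝ × ℝ → ℝ} (hm : Measurable f) (ε : ℝ) :
    Measurable fun p : ℝ × ℝ => trK (fun v => f (p.1 + v, p.2 + v)) ε := by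
  unfold trK
  refine (StronglyMeasurable.integral_prod_right (f := fun (p : ℝ × ℝ) v =>
    (1 / π) * (f (p.1 + v, p.2 + v) / (2 * tan (v / 2)))) ?_).measurable
  apply Measurable.stronglyMeasurable
  simp only [tan_eq_sin_div_cos, Function.uncurry_def]
  have : Measurable fun x : (ℝ × ℝ) × ℝ => f (x.1.1 + x.2, x.1.2 + x.2) := hm.comp (by fun_prop)
  fun_prop

theorem twoD {f : ℝ × ℝ → ℝ} (hm : Measurable f) (hb : Biperiodic f) (hi : IntegrableOn f T2)
    (hi2 : IntegrableOn (fun p => |f p| * logPlus |f p|) T2) :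
    ∃ A : ℝ × ℝ → ℝ,
      (∀ᵐ p : ℝ × ℝ, Tendsto (trK (fun v => f (p.1 + v, p.2 + v))) (𝓝[>] 0) (𝓝 (A p))) ∧
      ∫⁻ p in T2, ENNReal.ofReal |A p|
        ≤ ENNReal.ofReal (32 * (∫ p in T2, |f p| * logPlus |f p|) + 208 * π ^ 2) := by
  have hpi := pi_pos
  have hem : Measurable fun p => |f p| * logPlus |f p| :=
    (hm.abs).mul (measurable_logPlus.comp hm.abs)
  have heb : Biperiodic fun p => |f p| * logPlus |f p| := fun x y => by
    simp only [(hb x y).1, (hb x y).2, and_self]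
  -- slices
  have hsl : ∀ᵐ t, ∃ B : ℝ → ℝ,
      (∀ᵐ x, Tendsto (trK (fun v => f (x + v, x + t + v))) (𝓝[>] 0) (𝓝 (B x))) ∧
      (∀ x, IntegrableOn (fun v => f (x + v, x + t + v)) (Ioo (-π) π)) ∧
      ∫⁻ x in Ioc (-π) π, ENNReal.ofReal |B x|
        ≤ 32 * (∫⁻ x in Ioc (-π) π, ENNReal.ofReal (|f (x, x + t)| * logPlus |f (x, x + t)|))
          + ENNReal.ofReal (104 * π) := by
    filter_upwards [slice_integrable hm hb hi, slice_integrable hem heb hi2] with t h1 h2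
    have hφm : Measurable fun x => f (x, x + t) := hm.comp (by fun_prop)
    have hφp : Function.Periodic (fun x => f (x, x + t)) (2 * π) := fun x => by
      simp only
      rw [add_right_comm, (hb _ _).2, (hb _ _).1]
    obtain ⟨B, hB1, hB2⟩ := oneD_signed hφm hφp h1 h2
    refine ⟨B, ?_, ?_, ?_⟩
    · filter_upwards [hB1] with x hx
      simpa only [add_right_comm x t] using hx
    · intro x
      have := (li_ii (locInt_shift (li_of_periodic hφp h1) x) (-π) π)
      rw [intervalIntegrable_iff_integrableOn_Ioo_of_le (by linarith)] at this
      simpa only [add_right_comm x t] using this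
    · have hnn : ∀ x, 0 ≤ |f (x, x + t)| * logPlus |f (x, x + t)| :=
        fun x => mul_nonneg (abs_nonneg _) (logPlus_nonneg _)
      have hJ : 0 ≤ ∫ x in Ioc (-π) π, |f (x, x + t)| * logPlus |f (x, x + t)| :=
        integral_nonneg hnn
      refine hB2.trans (le_of_eq ?_)
      rw [← ofReal_integral_eq_lintegral_ofReal h2 (Eventually.of_forall hnn),
        ENNReal.ofReal_add (by positivity) (by positivity), ENNReal.ofReal_mul (by norm_num)]
      norm_num
  -- the good set
  let P : Set (ℝ × ℝ) := {p | IntegrableOn (fun v => f (p.1 + v, p.2 + v)) (Ioo (-π) π)} ∩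
    {p | ∃ c, Tendsto (fun q : ℚ => trK (fun v => f (p.1 + v, p.2 + v)) q)
      (comap ((↑) : ℚ → ℝ) (𝓝[>] 0)) (𝓝 c)}
  have hPm : MeasurableSet P := by
    refine MeasurableSet.inter ?_ ?_
    · refine measurableSet_integrable (f := fun (p : ℝ × ℝ) v => f (p.1 + v, p.2 + v)) ?_
      exact (hm.comp (by fun_prop)).stronglyMeasurable
    · exact measurableSet_exists_tendsto fun q => trK_meas hm q
  have hmp := measurePreserving_prod_add_swap (volume : Measure ℝ) (volume : Measure ℝ)
  have hP : ∀ᵐ p : ℝ × ℝ, p ∈ P := by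
    rw [Measure.volume_eq_prod, ← hmp.map_eq]
    refine (ae_map_iff (p := fun p => p ∈ P) hmp.measurable.aemeasurable hPm).2 ?_
    have := (Measure.ae_prod_mem_iff_ae_ae_mem (μ := volume) (ν := volume)
      (hmp.measurable hPm)).2
    apply this
    filter_upwards [hsl] with t ht
    obtain ⟨B, hB1, hB2, -⟩ := ht
    filter_upwards [hB1] with x hx
    exact ⟨hB2 x, B x, hx.comp tendsto_comap⟩
  have hlim : ∀ p ∈ P, ∃ c, Tendsto (trK (fun v => f (p.1 + v, p.2 + v))) (𝓝[>] 0) (𝓝 c) := by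
    rintro p ⟨h1, c, hc⟩
    exact ⟨c, rat_lim (fun ε h0 h2 => trK_right_cont h1 h0 h2) hc⟩
  choose! A hA using hlim
  have hAt : ∀ᵐ p : ℝ × ℝ, Tendsto (trK (fun v => f (p.1 + v, p.2 + v))) (𝓝[>] 0) (𝓝 (A p)) := by
    filter_upwards [hP] with p hp using hA p hp
  refine ⟨A, hAt, ?_⟩
  let a : ℕ → ℝ × ℝ → ENNReal := fun n p =>
    ENNReal.ofReal |trK (fun v => f (p.1 + v, p.2 + v)) (1 / ((n : ℝ) + 1))|
  let m : ℝ × ℝ → ENNReal := fun p => liminf (fun n => a n p) atTop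
  have ham : ∀ n, Measurable (a n) := fun n => (trK_meas hm _).abs.ennreal_ofReal
  have hmm : Measurable m := Measurable.liminf ham
  have hmp2 : ∀ x y, m (x, y + 2 * π) = m (x, y) := fun x y => by
    simp only [m, a, add_right_comm y (2 * π), (hb _ _).2]
  have hseq : Tendsto (fun n : ℕ => 1 / ((n : ℝ) + 1)) atTop (𝓝[>] 0) := by
    rw [tendsto_nhdsWithin_iff]
    refine ⟨tendsto_one_div_add_atTop_nhds_zero_nat, Eventually.of_forall fun n => ?_⟩
    simp only [mem_Ioi]; positivity
  have hml : ∀ (p : ℝ × ℝ) (c : ℝ), Tendsto (trK (fun v => f (p.1 + v, p.2 + v))) (𝓝[>] 0) (𝓝 c) →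
      m p = ENNReal.ofReal |c| := fun p c hc => by
    have : Tendsto (fun n => a n p) atTop (𝓝 (ENNReal.ofReal |c|)) :=
      (ENNReal.continuous_ofReal.tendsto _).comp ((continuous_abs.tendsto _).comp (hc.comp hseq))
    exact this.liminf_eq
  have hnn : ∀ p, 0 ≤ |f p| * logPlus |f p| :=
    fun p => mul_nonneg (abs_nonneg _) (logPlus_nonneg _)
  have hJ : 0 ≤ ∫ p in T2, |f p| * logPlus |f p| := integral_nonneg hnn
  have hEm : Measurable fun t => ∫⁻ x in Ioc (-π) π,
      ENNReal.ofReal (|f (x, x + t)| * logPlus |f (x, x + t)|) :=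
    Measurable.lintegral_prod_right'
      (f := fun q : ℝ × ℝ => ENNReal.ofReal (|f (q.2, q.2 + q.1)| * logPlus |f (q.2, q.2 + q.1)|))
      (hem.comp (g := fun p => |f p| * logPlus |f p|)
        (f := fun q : ℝ × ℝ => (q.2, q.2 + q.1)) (by fun_prop)).ennreal_ofReal
  calc ∫⁻ p in T2, ENNReal.ofReal |A p|
      = ∫⁻ p in T2, m p := by
        refine lintegral_congr_ae (ae_restrict_of_ae ?_)
        filter_upwards [hAt] with p hp using (hml p _ hp).symm
    _ = ∫⁻ t in Ioc (-π) π, ∫⁻ x in Ioc (-π) π, m (x, x + t) := shear hmm hmp2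
    _ ≤ ∫⁻ t in Ioc (-π) π, (32 * (∫⁻ x in Ioc (-π) π,
          ENNReal.ofReal (|f (x, x + t)| * logPlus |f (x, x + t)|)) + ENNReal.ofReal (104 * π)) := by
        refine lintegral_mono_ae (ae_restrict_of_ae ?_)
        filter_upwards [hsl] with t ht
        obtain ⟨B, hB1, -, hB3⟩ := ht
        refine le_trans (le_of_eq ?_) hB3
        refine lintegral_congr_ae (ae_restrict_of_ae ?_)
        filter_upwards [hB1] with x hx using hml (x, x + t) _ hx
    _ = 32 * (∫⁻ p in T2, ENNReal.ofReal (|f p| * logPlus |f p|))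
          + ENNReal.ofReal (104 * π) * ENNReal.ofReal (2 * π) := by
        rw [lintegral_add_left (hEm.const_mul _), lintegral_const_mul _ hEm,
          shear (h := fun p => ENNReal.ofReal (|f p| * logPlus |f p|)) hem.ennreal_ofReal
            (fun x y => by simp only [(hb x y).2])]
        congr 1
        rw [lintegral_const, Measure.restrict_apply_univ, Real.volume_Ioc]
        congr 2; ring
    _ = _ := by
        rw [← ofReal_integral_eq_lintegral_ofReal hi2 (Eventually.of_forall hnn),
          ENNReal.ofReal_add (by positivity) (by positivity), ENNReal.ofReal_mul (by norm_num),
          show 208 * π ^ 2 = (104 * π) * (2 * π) by ring,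
          ENNReal.ofReal_mul (p := 104 * π) (by positivity)]
        norm_num

end HT

/-- for `f ∈ L log L(𝕋²)` the principal value
`A(x,y) = p.v. (1/π) ∫_𝕋 f(x+v, y+v)/(2 tan(v/2)) dv` exists for a.e. `(x,y) ∈ 𝕋²` and
`∬_{𝕋²} |A| ≤ c (1 + ∬_{𝕋²} |f| log⁺|f|)` for an absolute constant `c > 0`. -/
theorem A_exists_and_L1_bound :
    ∃ c : ℝ, 0 < c ∧ ∀ f : ℝ × ℝ → ℝ, Measurable f → Biperiodic f →
      IntegrableOn f T2 → IntegrableOn (fun p => |f p| * logPlus |f p|) T2 →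
      ∃ A : ℝ × ℝ → ℝ,
        (∀ᵐ p : ℝ × ℝ,
          pvT1 (fun v => (1 / Real.pi) * (f (p.1 + v, p.2 + v) / (2 * Real.tan (v / 2))))
            (A p)) ∧
        (∫ p in T2, |A p|) ≤ c * (1 + ∫ p in T2, |f p| * logPlus |f p|) := by
  refine ⟨32 + 208 * Real.pi ^ 2, by positivity, fun f hm hb hi hi2 => ?_⟩
  obtain ⟨A, hA1, hA2⟩ := HT.twoD hm hb hi hi2
  refine ⟨A, hA1, ?_⟩
  have hJ : 0 ≤ ∫ p in T2, |f p| * logPlus |f p| :=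
    integral_nonneg fun p => mul_nonneg (abs_nonneg _) (HT.logPlus_nonneg _)
  have hbd : 32 * (∫ p in T2, |f p| * logPlus |f p|) + 208 * Real.pi ^ 2
      ≤ (32 + 208 * Real.pi ^ 2) * (1 + ∫ p in T2, |f p| * logPlus |f p|) := by
    have : 0 ≤ Real.pi ^ 2 * ∫ p in T2, |f p| * logPlus |f p| := by positivity
    nlinarith
  refine le_trans ?_ hbd
  by_cases hAi : IntegrableOn (fun p => |A p|) T2
  · rw [← ofReal_integral_eq_lintegral_ofReal hAi (Eventually.of_forall fun p => abs_nonneg _)]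
      at hA2
    exact (ENNReal.ofReal_le_ofReal_iff (by positivity)).1 hA2
  · rw [integral_undef hAi]; positivity
end
end
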